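/- arXiv:2605.25462 — 2 statements merged into one kernel-verified Lean document; each statement's English description precedes it below -/
import Mathlib

section
/- Let u : (0,∞) × ℝ² → ℝ be a twice continuously differentiable function satisfying (e^u)_{ζζ} + u_{xx} + u_{yy} = 0 on (0,∞) × ℝ², where subscripts denote partial derivatives in the variables (ζ,x,y). If the function (ζ,x,y) ↦ u(ζ,x,y) − log ζ is bounded on (0,∞) × ℝ², then there exists a constant c > 0 such that u(ζ,x,y) = log(c·ζ) for all (ζ,x,y) ∈ (0,∞) × ℝ². -/
open Real

noncomputable section

namespace TodaLiouville

open intervalIntegral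

/-! ### Interval integrals of continuous functions -/

lemma integral_mono_of_continuous {a b : ℝ} (hab : a ≤ b) {f g : ℝ → ℝ} (hf : Continuous f)
    (hg : Continuous g) (h : ∀ x ∈ Set.Icc a b, f x ≤ g x) :
    ∫ x in a..b, f x ≤ ∫ x in a..b, g x :=
  integral_mono_on hab (hf.intervalIntegrable _ _) (hg.intervalIntegrable _ _) h

lemma sq_integral_mul_le {a b : ℝ} (hab : a ≤ b) {f g : ℝ → ℝ} (hf : Continuous f)
    (hg : Continuous g) :
    (∫ x in a..b, f x * g x) ^ 2 ≤ (∫ x in a..b, f x ^ 2) * ∫ x in a..b, g x ^ 2 := by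
  have key : ∀ t : ℝ, 0 ≤ (∫ x in a..b, f x ^ 2) * (t * t) + (2 * ∫ x in a..b, f x * g x) * t
      + ∫ x in a..b, g x ^ 2 := by
    intro t
    have h0 : 0 ≤ ∫ x in a..b, (t * f x + g x) ^ 2 :=
      integral_nonneg hab fun x _ => sq_nonneg _
    have h1 : (∫ x in a..b, (t * f x + g x) ^ 2)
        = (∫ x in a..b, (t * t) * f x ^ 2) + (∫ x in a..b, (2 * t) * (f x * g x))
          + ∫ x in a..b, g x ^ 2 := by
      rw [← integral_add, ← integral_add]
      · congr 1; ext x; ring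
      all_goals exact Continuous.intervalIntegrable (by fun_prop) _ _
    rw [h1, integral_const_mul, integral_const_mul] at h0
    linarith
  have h2 := discrim_le_zero key
  rw [discrim] at h2
  linarith

lemma integral_sqrt_mul_sqrt_le {a b : ℝ} (hab : a ≤ b) {f g : ℝ → ℝ} (hf : Continuous f)
    (hg : Continuous g) (hf0 : ∀ x ∈ Set.Icc a b, 0 ≤ f x) (hg0 : ∀ x ∈ Set.Icc a b, 0 ≤ g x) :
    ∫ x in a..b, √(f x) * √(g x) ≤ √(∫ x in a..b, f x) * √(∫ x in a..b, g x) := by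
  have h := sq_integral_mul_le hab (f := fun x => √(f x)) (g := fun x => √(g x))
    (by fun_prop) (by fun_prop)
  have e1 : (∫ x in a..b, √(f x) ^ 2) = ∫ x in a..b, f x :=
    integral_congr fun x hx => Real.sq_sqrt (hf0 x (by rwa [Set.uIcc_of_le hab] at hx))
  have e2 : (∫ x in a..b, √(g x) ^ 2) = ∫ x in a..b, g x :=
    integral_congr fun x hx => Real.sq_sqrt (hg0 x (by rwa [Set.uIcc_of_le hab] at hx))
  rw [e1, e2] at h
  rw [← Real.sqrt_mul (integral_nonneg hab hf0)]
  exact Real.le_sqrt_of_sq_le h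

lemma integral_swap {a b c d : ℝ} {f : ℝ × ℝ → ℝ} (hf : Continuous f) :
    ∫ x in a..b, ∫ y in c..d, f (x, y) = ∫ y in c..d, ∫ x in a..b, f (x, y) := by
  refine MeasureTheory.intervalIntegral_intervalIntegral_swap (F := fun x y => f (x, y)) ?_
  have : MeasureTheory.IntegrableOn f (Set.uIcc a b ×ˢ Set.uIcc c d)
      (MeasureTheory.volume.prod MeasureTheory.volume) :=
    hf.continuousOn.integrableOn_compact (isCompact_uIcc.prod isCompact_uIcc)
  exact this.mono_set (Set.prod_mono Set.uIoc_subset_uIcc Set.uIoc_subset_uIcc)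

lemma integral_mul_deriv_of_boundary {a b : ℝ} {u v u' v' : ℝ → ℝ}
    (hu : ∀ x, HasDerivAt u (u' x) x) (hv : ∀ x, HasDerivAt v (v' x) x)
    (hu' : Continuous u') (hv' : Continuous v') (ha : v a = 0) (hb : v b = 0) :
    ∫ x in a..b, u x * v' x = - ∫ x in a..b, u' x * v x := by
  rw [integral_mul_deriv_eq_deriv_mul (fun x _ => hu x) (fun x _ => hv x)
    (hu'.intervalIntegrable _ _) (hv'.intervalIntegrable _ _), ha, hb]
  ring

/-- A function vanishing at the right end point is bounded by the integral of a bound for its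
derivative. -/
lemma abs_le_integral_of_deriv {a b : ℝ} {v v' k : ℝ → ℝ}
    (hv : ∀ x, HasDerivAt v (v' x) x) (hv' : Continuous v') (hk : Continuous k)
    (hb : v b = 0) (h : ∀ x ∈ Set.Icc a b, |v' x| ≤ k x) {c : ℝ} (hc : c ∈ Set.Icc a b) :
    |v c| ≤ ∫ x in a..b, k x := by
  have h1 : ∫ x in c..b, v' x = v b - v c :=
    integral_eq_sub_of_hasDerivAt (fun x _ => hv x) (hv'.intervalIntegrable _ _)
  rw [hb, zero_sub] at h1
  have h2 : |v c| = |∫ x in c..b, v' x| := by rw [h1, abs_neg]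
  rw [h2]
  calc |∫ x in c..b, v' x| ≤ ∫ x in c..b, |v' x| := abs_integral_le_integral_abs hc.2
    _ ≤ ∫ x in c..b, k x := integral_mono_of_continuous hc.2 (by fun_prop) hk
        fun x hx => h x ⟨hc.1.trans hx.1, hx.2⟩
    _ ≤ ∫ x in a..b, k x := by
        rw [← integral_add_adjacent_intervals (hk.intervalIntegrable a c)
          (hk.intervalIntegrable c b)]
        have : 0 ≤ ∫ x in a..c, k x := integral_nonneg hc.1
          fun x hx => (abs_nonneg _).trans (h x ⟨hx.1, hx.2.trans hc.2⟩)
        linarith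

/-! ### Iterated integrals over boxes -/

/-- The integral over the box `[a, b] × [-R, R] × [-R, R]`. -/
def boxInt (a b R : ℝ) (f : ℝ × ℝ × ℝ → ℝ) : ℝ :=
  ∫ s in a..b, ∫ x in -R..R, ∫ y in -R..R, f (s, x, y)

section boxInt

variable {a b R : ℝ} {f g : ℝ × ℝ × ℝ → ℝ}

lemma boxInt_add (hf : Continuous f) (hg : Continuous g) :
    boxInt a b R (fun p => f p + g p) = boxInt a b R f + boxInt a b R g := by
  simp only [boxInt]
  rw [← integral_add (Continuous.intervalIntegrable (by fun_prop) _ _)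
    (Continuous.intervalIntegrable (by fun_prop) _ _)]
  congr 1; ext s
  rw [← integral_add (Continuous.intervalIntegrable (by fun_prop) _ _)
    (Continuous.intervalIntegrable (by fun_prop) _ _)]
  congr 1; ext x
  rw [← integral_add (Continuous.intervalIntegrable (by fun_prop) _ _)
    (Continuous.intervalIntegrable (by fun_prop) _ _)]

lemma boxInt_const_mul (c : ℝ) :
    boxInt a b R (fun p => c * f p) = c * boxInt a b R f := by
  simp only [boxInt, integral_const_mul]

lemma boxInt_mono (hab : a ≤ b) (hR : 0 ≤ R) (hf : Continuous f) (hg : Continuous g)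
    (h : ∀ s ∈ Set.Icc a b, ∀ x ∈ Set.Icc (-R) R, ∀ y ∈ Set.Icc (-R) R,
      f (s, x, y) ≤ g (s, x, y)) : boxInt a b R f ≤ boxInt a b R g := by
  have hR' : -R ≤ R := by linarith
  refine integral_mono_of_continuous hab (by fun_prop) (by fun_prop) fun s hs => ?_
  refine integral_mono_of_continuous hR' (by fun_prop) (by fun_prop) fun x hx => ?_
  exact integral_mono_of_continuous hR' (by fun_prop) (by fun_prop) fun y hy => h s hs x hx y hy

lemma boxInt_nonneg (hab : a ≤ b) (hR : 0 ≤ R)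
    (h : ∀ s ∈ Set.Icc a b, ∀ x ∈ Set.Icc (-R) R, ∀ y ∈ Set.Icc (-R) R, 0 ≤ f (s, x, y)) :
    0 ≤ boxInt a b R f := by
  have hR' : -R ≤ R := by linarith
  exact integral_nonneg hab fun s hs => integral_nonneg hR' fun x hx =>
    integral_nonneg hR' fun y hy => h s hs x hx y hy

lemma boxInt_eq_xys (hf : Continuous f) :
    boxInt a b R f = ∫ x in -R..R, ∫ y in -R..R, ∫ s in a..b, f (s, x, y) := by
  rw [boxInt, integral_swap (f := fun q : ℝ × ℝ => ∫ y in -R..R, f (q.1, q.2, y)) (by fun_prop)]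
  congr 1; ext x
  exact integral_swap (f := fun q : ℝ × ℝ => f (q.1, x, q.2)) (by fun_prop)

lemma boxInt_eq_syx (hf : Continuous f) :
    boxInt a b R f = ∫ s in a..b, ∫ y in -R..R, ∫ x in -R..R, f (s, x, y) := by
  rw [boxInt]
  congr 1; ext s
  exact integral_swap (f := fun q : ℝ × ℝ => f (s, q.1, q.2)) (by fun_prop)

lemma integral_mono_interval_of_nonneg {c d c' d' : ℝ} (h1 : c ≤ c') (h2 : c' ≤ d') (h3 : d' ≤ d)
    {k : ℝ → ℝ} (hk : Continuous k) (h0 : ∀ x ∈ Set.Icc c d, 0 ≤ k x) :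
    ∫ x in c'..d', k x ≤ ∫ x in c..d, k x := by
  refine integral_mono_interval h1 h2 h3 ?_ (hk.intervalIntegrable _ _)
  exact (MeasureTheory.ae_restrict_mem measurableSet_Ioc).mono
    fun x hx => h0 x (Set.Ioc_subset_Icc_self hx)

lemma boxInt_mono_box {a' b' R' : ℝ} (ha : a ≤ a') (hab : a' ≤ b') (hb : b' ≤ b) (hR' : 0 ≤ R')
    (hR : R' ≤ R) (hf : Continuous f)
    (h : ∀ s ∈ Set.Icc a b, ∀ x ∈ Set.Icc (-R) R, ∀ y ∈ Set.Icc (-R) R, 0 ≤ f (s, x, y)) :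
    boxInt a' b' R' f ≤ boxInt a b R f := by
  have hRR : -R ≤ R := by linarith
  have hRR' : -R' ≤ R' := by linarith
  have hRn : -R ≤ -R' := by linarith
  calc boxInt a' b' R' f
      ≤ ∫ s in a'..b', ∫ x in -R..R, ∫ y in -R..R, f (s, x, y) := by
        refine integral_mono_of_continuous hab (by fun_prop) (by fun_prop) fun s hs => ?_
        have hs' : s ∈ Set.Icc a b := ⟨ha.trans hs.1, hs.2.trans hb⟩
        calc ∫ x in -R'..R', ∫ y in -R'..R', f (s, x, y)
            ≤ ∫ x in -R'..R', ∫ y in -R..R, f (s, x, y) := by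
              refine integral_mono_of_continuous hRR' (by fun_prop) (by fun_prop) fun x hx => ?_
              exact integral_mono_interval_of_nonneg hRn hRR' hR (by fun_prop)
                fun y hy => h s hs' x ⟨hRn.trans hx.1, hx.2.trans hR⟩ y hy
          _ ≤ _ := integral_mono_interval_of_nonneg hRn hRR' hR (by fun_prop)
                fun x hx => integral_nonneg hRR fun y hy => h s hs' x hx y hy
    _ ≤ _ := integral_mono_interval_of_nonneg ha hab hb (by fun_prop)
        fun s hs => integral_nonneg hRR fun x hx => integral_nonneg hRR
          fun y hy => h s hs x hx y hy

lemma boxInt_pos (hab : a < b) (hR : 0 < R) (hf : Continuous f)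
    (h : ∀ s ∈ Set.Icc a b, ∀ x ∈ Set.Icc (-R) R, ∀ y ∈ Set.Icc (-R) R, 0 ≤ f (s, x, y))
    {s x y : ℝ} (hs : s ∈ Set.Icc a b) (hx : x ∈ Set.Icc (-R) R) (hy : y ∈ Set.Icc (-R) R)
    (hpos : 0 < f (s, x, y)) : 0 < boxInt a b R f := by
  have hRR : -R < R := by linarith
  refine integral_pos hab (Continuous.continuousOn (by fun_prop))
    (fun s hs => integral_nonneg hRR.le fun x hx => integral_nonneg hRR.le
      fun y hy => h s (Set.Ioc_subset_Icc_self hs) x hx y hy) ⟨s, hs, ?_⟩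
  refine integral_pos hRR (Continuous.continuousOn (by fun_prop))
    (fun x hx => integral_nonneg hRR.le
      fun y hy => h s hs x (Set.Ioc_subset_Icc_self hx) y hy) ⟨x, hx, ?_⟩
  exact integral_pos hRR (Continuous.continuousOn (by fun_prop))
    (fun y hy => h s hs x hx y (Set.Ioc_subset_Icc_self hy)) ⟨y, hy, hpos⟩

end boxInt

/-! ### Continuously differentiable functions and a Sobolev inequality -/

/-- `f` is continuously differentiable, with partial derivatives `fs`, `fx`, `fy`. -/
structure IsC1 (f fs fx fy : ℝ × ℝ × ℝ → ℝ) : Prop where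
  cont : Continuous f
  cont_s : Continuous fs
  cont_x : Continuous fx
  cont_y : Continuous fy
  deriv_s : ∀ s x y, HasDerivAt (fun t => f (t, x, y)) (fs (s, x, y)) s
  deriv_x : ∀ s x y, HasDerivAt (fun t => f (s, t, y)) (fx (s, x, y)) x
  deriv_y : ∀ s x y, HasDerivAt (fun t => f (s, x, t)) (fy (s, x, y)) y

lemma IsC1.mul {f fs fx fy g gs gx gy : ℝ × ℝ × ℝ → ℝ} (hf : IsC1 f fs fx fy)
    (hg : IsC1 g gs gx gy) :
    IsC1 (fun p => f p * g p) (fun p => fs p * g p + f p * gs p)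
      (fun p => fx p * g p + f p * gx p) (fun p => fy p * g p + f p * gy p) where
  cont := hf.cont.mul hg.cont
  cont_s := (hf.cont_s.mul hg.cont).add (hf.cont.mul hg.cont_s)
  cont_x := (hf.cont_x.mul hg.cont).add (hf.cont.mul hg.cont_x)
  cont_y := (hf.cont_y.mul hg.cont).add (hf.cont.mul hg.cont_y)
  deriv_s s x y := (hf.deriv_s s x y).mul (hg.deriv_s s x y)
  deriv_x s x y := (hf.deriv_x s x y).mul (hg.deriv_x s x y)
  deriv_y s x y := (hf.deriv_y s x y).mul (hg.deriv_y s x y)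

lemma IsC1.comp_pos {f fs fx fy : ℝ × ℝ × ℝ → ℝ} {h h' : ℝ → ℝ} (hf : IsC1 f fs fx fy)
    (hpos : ∀ p, 0 < f p) (hd : ∀ t, 0 < t → HasDerivAt h (h' t) t)
    (hc : ContinuousOn h' (Set.Ioi 0)) :
    IsC1 (fun p => h (f p)) (fun p => h' (f p) * fs p) (fun p => h' (f p) * fx p)
      (fun p => h' (f p) * fy p) := by
  have hh : Continuous fun p => h (f p) :=
    continuous_iff_continuousAt.2 fun p =>
      ((hd _ (hpos p)).continuousAt).comp hf.cont.continuousAt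
  have hh' : Continuous fun p => h' (f p) := hc.comp_continuous hf.cont hpos
  exact
  { cont := hh
    cont_s := hh'.mul hf.cont_s
    cont_x := hh'.mul hf.cont_x
    cont_y := hh'.mul hf.cont_y
    deriv_s := fun s x y => (hd _ (hpos _)).comp s (hf.deriv_s s x y)
    deriv_x := fun s x y => (hd _ (hpos _)).comp x (hf.deriv_x s x y)
    deriv_y := fun s x y => (hd _ (hpos _)).comp y (hf.deriv_y s x y) }

/-- `f` vanishes on the boundary of `[a, b] × [-R, R] × [-R, R]`. -/
structure VanishesOnBoundary (a b R : ℝ) (f : ℝ × ℝ × ℝ → ℝ) : Prop where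
  left : ∀ x y, f (a, x, y) = 0
  right : ∀ x y, f (b, x, y) = 0
  x_left : ∀ s y, f (s, -R, y) = 0
  x_right : ∀ s y, f (s, R, y) = 0
  y_left : ∀ s x, f (s, x, -R) = 0
  y_right : ∀ s x, f (s, x, R) = 0

lemma VanishesOnBoundary.mul_left {a b R : ℝ} {f : ℝ × ℝ × ℝ → ℝ} (h : VanishesOnBoundary a b R f)
    (g : ℝ × ℝ × ℝ → ℝ) : VanishesOnBoundary a b R (fun p => g p * f p) where
  left x y := by simp only [h.left, mul_zero]
  right x y := by simp only [h.right, mul_zero]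
  x_left s y := by simp only [h.x_left, mul_zero]
  x_right s y := by simp only [h.x_right, mul_zero]
  y_left s x := by simp only [h.y_left, mul_zero]
  y_right s x := by simp only [h.y_right, mul_zero]

lemma hasDerivAt_fun_sq {v : ℝ → ℝ} {v' x : ℝ} (h : HasDerivAt v v' x) :
    HasDerivAt (fun t => v t ^ 2) (2 * v x * v') x := by
  simpa using h.fun_pow 2

/-- The degenerate Dirichlet energy density. -/
def energy (fs fx fy : ℝ × ℝ × ℝ → ℝ) (p : ℝ × ℝ × ℝ) : ℝ :=
  exp p.1 * fs p ^ 2 + exp p.1 ^ 2 * (fx p ^ 2 + fy p ^ 2)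

lemma energy_nonneg (fs fx fy : ℝ × ℝ × ℝ → ℝ) (p : ℝ × ℝ × ℝ) : 0 ≤ energy fs fx fy p := by
  unfold energy; positivity

lemma IsC1.continuous_energy {f fs fx fy : ℝ × ℝ × ℝ → ℝ} (hf : IsC1 f fs fx fy) :
    Continuous (energy fs fx fy) := by
  have := hf.cont_s; have := hf.cont_x; have := hf.cont_y
  unfold energy; fun_prop

lemma loomis_whitney {a b R : ℝ} (hab : a ≤ b) (hR : 0 ≤ R) {α β γ : ℝ × ℝ → ℝ}
    (hα : Continuous α) (hβ : Continuous β) (hγ : Continuous γ)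
    (hα0 : ∀ x ∈ Set.Icc (-R) R, ∀ y ∈ Set.Icc (-R) R, 0 ≤ α (x, y))
    (hβ0 : ∀ s ∈ Set.Icc a b, ∀ y ∈ Set.Icc (-R) R, 0 ≤ β (s, y))
    (hγ0 : ∀ s ∈ Set.Icc a b, ∀ x ∈ Set.Icc (-R) R, 0 ≤ γ (s, x)) :
    boxInt a b R (fun p => √(α (p.2.1, p.2.2)) * √(β (p.1, p.2.2)) * √(γ (p.1, p.2.1))) ≤
      √(∫ x in -R..R, ∫ y in -R..R, α (x, y)) * √(∫ s in a..b, ∫ y in -R..R, β (s, y)) *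
        √(∫ s in a..b, ∫ x in -R..R, γ (s, x)) := by
  have hRR : -R ≤ R := by linarith
  simp only [boxInt]
  have inner : ∀ s ∈ Set.Icc a b, ∀ x ∈ Set.Icc (-R) R,
      ∫ y in -R..R, √(α (x, y)) * √(β (s, y)) * √(γ (s, x)) ≤
        √(∫ y in -R..R, α (x, y)) * √(∫ y in -R..R, β (s, y)) * √(γ (s, x)) := by
    intro s hs x hx
    rw [integral_mul_const]
    exact mul_le_mul_of_nonneg_right (integral_sqrt_mul_sqrt_le hRR (by fun_prop) (by fun_prop)
      (hα0 x hx) (hβ0 s hs)) (Real.sqrt_nonneg _)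
  have mid : ∀ s ∈ Set.Icc a b,
      ∫ x in -R..R, ∫ y in -R..R, √(α (x, y)) * √(β (s, y)) * √(γ (s, x)) ≤
        √(∫ x in -R..R, ∫ y in -R..R, α (x, y)) *
          (√(∫ y in -R..R, β (s, y)) * √(∫ x in -R..R, γ (s, x))) := by
    intro s hs
    calc _ ≤ ∫ x in -R..R, √(∫ y in -R..R, α (x, y)) * √(∫ y in -R..R, β (s, y)) * √(γ (s, x)) :=
          integral_mono_of_continuous hRR (by fun_prop) (by fun_prop) (inner s hs)
      _ = (∫ x in -R..R, √(∫ y in -R..R, α (x, y)) * √(γ (s, x))) * √(∫ y in -R..R, β (s, y)) := by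
          rw [← integral_mul_const]; congr 1; ext x; ring
      _ ≤ (√(∫ x in -R..R, ∫ y in -R..R, α (x, y)) * √(∫ x in -R..R, γ (s, x))) *
            √(∫ y in -R..R, β (s, y)) := by
          refine mul_le_mul_of_nonneg_right (integral_sqrt_mul_sqrt_le hRR (by fun_prop)
            (by fun_prop) (fun x hx => integral_nonneg hRR (hα0 x hx)) (hγ0 s hs))
            (Real.sqrt_nonneg _)
      _ = _ := by ring
  calc _ ≤ ∫ s in a..b, √(∫ x in -R..R, ∫ y in -R..R, α (x, y)) *
          (√(∫ y in -R..R, β (s, y)) * √(∫ x in -R..R, γ (s, x))) :=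
        integral_mono_of_continuous hab (by fun_prop) (by fun_prop) mid
    _ ≤ _ := by
        rw [integral_const_mul, mul_assoc]
        refine mul_le_mul_of_nonneg_left (integral_sqrt_mul_sqrt_le hab (by fun_prop)
          (by fun_prop) (fun s hs => integral_nonneg hRR (hβ0 s hs))
          (fun s hs => integral_nonneg hRR (hγ0 s hs))) (Real.sqrt_nonneg _)

section Sobolev

variable {a b R : ℝ} {f fs fx fy : ℝ × ℝ × ℝ → ℝ}

/-- Hardy's inequality. -/
lemma hardy (hab : a ≤ b) (hR : 0 ≤ R) (hf : IsC1 f fs fx fy)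
    (h0 : VanishesOnBoundary a b R f) :
    boxInt a b R (fun p => exp p.1 * f p ^ 2) ≤ 4 * boxInt a b R (energy fs fx fy) := by
  have hc := hf.cont; have hcs := hf.cont_s; have hcx := hf.cont_x; have hcy := hf.cont_y
  have hRR : -R ≤ R := by linarith
  have h1 : boxInt a b R (fun p => exp p.1 * f p ^ 2) ≤
      4 * boxInt a b R (fun p => exp p.1 * fs p ^ 2) := by
    rw [boxInt_eq_xys (by fun_prop), boxInt_eq_xys (by fun_prop), ← integral_const_mul]
    refine integral_mono_of_continuous hRR (by fun_prop) (by fun_prop) fun x _ => ?_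
    rw [← integral_const_mul]
    refine integral_mono_of_continuous hRR (by fun_prop) (by fun_prop) fun y _ => ?_
    have e : ∫ s in a..b, exp s * (2 * f (s, x, y) * fs (s, x, y))
        = - ∫ s in a..b, exp s * f (s, x, y) ^ 2 := by
      refine integral_mul_deriv_of_boundary (v := fun s => f (s, x, y) ^ 2)
        (fun s => Real.hasDerivAt_exp s) (fun s => ?_) (by fun_prop) (by fun_prop)
        (by simp [h0.left]) (by simp [h0.right])
      exact hasDerivAt_fun_sq (hf.deriv_s s x y)
    have m : ∫ s in a..b, -(exp s * (2 * f (s, x, y) * fs (s, x, y))) ≤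
        ∫ s in a..b, ((1 / 2) * (exp s * f (s, x, y) ^ 2) + 2 * (exp s * fs (s, x, y) ^ 2)) := by
      refine integral_mono_of_continuous hab (by fun_prop) (by fun_prop) fun s _ => ?_
      nlinarith [mul_nonneg (exp_pos s).le (sq_nonneg (f (s, x, y) + 2 * fs (s, x, y)))]
    rw [integral_neg, e, integral_add (Continuous.intervalIntegrable (by fun_prop) _ _)
      (Continuous.intervalIntegrable (by fun_prop) _ _), integral_const_mul,
      integral_const_mul] at m
    linarith
  refine h1.trans (mul_le_mul_of_nonneg_left ?_ (by norm_num))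
  refine boxInt_mono hab hR (by fun_prop) hf.continuous_energy fun s _ x _ y _ => ?_
  simp only [energy]
  have : 0 ≤ exp s ^ 2 * (fx (s, x, y) ^ 2 + fy (s, x, y) ^ 2) := by positivity
  linarith

/-- A Sobolev inequality for the energy: the exponent is that of dimension six. -/
lemma sobolev (hab : a ≤ b) (hR : 0 ≤ R) (hf : IsC1 f fs fx fy)
    (h0 : VanishesOnBoundary a b R f) :
    (boxInt a b R (fun p => exp p.1 ^ 2 * |f p| ^ 3)) ^ 2 ≤
      (9 * boxInt a b R (energy fs fx fy)) ^ 3 := by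
  have hc := hf.cont; have hcs := hf.cont_s; have hcx := hf.cont_x; have hcy := hf.cont_y
  have hRR : -R ≤ R := by linarith
  have hE := hf.continuous_energy
  set E := boxInt a b R (energy fs fx fy) with hEdef
  have hE0 : 0 ≤ E := boxInt_nonneg hab hR fun s _ x _ y _ => energy_nonneg _ _ _ _
  have hH := hardy hab hR hf h0
  let α : ℝ × ℝ → ℝ := fun q =>
    ∫ s in a..b, exp s * (2 * f (s, q.1, q.2) ^ 2 + fs (s, q.1, q.2) ^ 2)
  let β : ℝ × ℝ → ℝ := fun q =>
    ∫ x in -R..R, (exp q.1 * f (q.1, x, q.2) ^ 2 + exp q.1 ^ 2 * fx (q.1, x, q.2) ^ 2)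
  let γ : ℝ × ℝ → ℝ := fun q =>
    ∫ y in -R..R, (exp q.1 * f (q.1, q.2, y) ^ 2 + exp q.1 ^ 2 * fy (q.1, q.2, y) ^ 2)
  have hα : Continuous α := by fun_prop
  have hβ : Continuous β := by fun_prop
  have hγ : Continuous γ := by fun_prop
  have hα0 : ∀ q, 0 ≤ α q := fun q => integral_nonneg hab fun s _ => by positivity
  have hβ0 : ∀ q, 0 ≤ β q := fun q => integral_nonneg hRR fun s _ => by positivity
  have hγ0 : ∀ q, 0 ≤ γ q := fun q => integral_nonneg hRR fun s _ => by positivity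
  have Iα : ∫ x in -R..R, ∫ y in -R..R, α (x, y) ≤ 9 * E := by
    have : (∫ x in -R..R, ∫ y in -R..R, α (x, y)) =
        boxInt a b R (fun p => exp p.1 * (2 * f p ^ 2 + fs p ^ 2)) :=
      (boxInt_eq_xys
        (f := fun p => exp p.1 * (2 * f p ^ 2 + fs p ^ 2)) (by fun_prop)).symm
    have l : boxInt a b R (fun p => exp p.1 * (2 * f p ^ 2 + fs p ^ 2)) ≤
        boxInt a b R (fun p => 2 * (exp p.1 * f p ^ 2) + energy fs fx fy p) := by
      refine boxInt_mono hab hR (by fun_prop) (by fun_prop) fun s _ x _ y _ => ?_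
      have : 0 ≤ exp s ^ 2 * (fx (s, x, y) ^ 2 + fy (s, x, y) ^ 2) := by positivity
      simp only [energy]; linarith
    rw [boxInt_add (by fun_prop) hE, boxInt_const_mul] at l
    linarith
  have Iβ : ∫ s in a..b, ∫ y in -R..R, β (s, y) ≤ 9 * E := by
    have : (∫ s in a..b, ∫ y in -R..R, β (s, y)) =
        boxInt a b R (fun p => exp p.1 * f p ^ 2 + exp p.1 ^ 2 * fx p ^ 2) :=
      (boxInt_eq_syx
        (f := fun p => exp p.1 * f p ^ 2 + exp p.1 ^ 2 * fx p ^ 2) (by fun_prop)).symm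
    have l : boxInt a b R (fun p => exp p.1 * f p ^ 2 + exp p.1 ^ 2 * fx p ^ 2) ≤
        boxInt a b R (fun p => exp p.1 * f p ^ 2 + energy fs fx fy p) := by
      refine boxInt_mono hab hR (by fun_prop) (by fun_prop) fun s _ x _ y _ => ?_
      have : 0 ≤ exp s * fs (s, x, y) ^ 2 + exp s ^ 2 * fy (s, x, y) ^ 2 := by positivity
      simp only [energy]; linarith
    rw [boxInt_add (by fun_prop) hE] at l
    linarith
  have Iγ : ∫ s in a..b, ∫ x in -R..R, γ (s, x) ≤ 9 * E := by
    have : (∫ s in a..b, ∫ x in -R..R, γ (s, x)) =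
        boxInt a b R (fun p => exp p.1 * f p ^ 2 + exp p.1 ^ 2 * fy p ^ 2) := rfl
    have l : boxInt a b R (fun p => exp p.1 * f p ^ 2 + exp p.1 ^ 2 * fy p ^ 2) ≤
        boxInt a b R (fun p => exp p.1 * f p ^ 2 + energy fs fx fy p) := by
      refine boxInt_mono hab hR (by fun_prop) (by fun_prop) fun s _ x _ y _ => ?_
      have : 0 ≤ exp s * fs (s, x, y) ^ 2 + exp s ^ 2 * fx (s, x, y) ^ 2 := by positivity
      simp only [energy]; linarith
    rw [boxInt_add (by fun_prop) hE] at l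
    linarith
  have hexp : ∀ s : ℝ, exp s = exp (s / 2) ^ 2 := fun s => by
    rw [← Real.exp_nat_mul]; congr 1; push_cast; ring
  have cross : ∀ s u v : ℝ, |exp (s / 2) ^ 3 * (2 * u * v)| ≤
      exp s * u ^ 2 + exp s ^ 2 * v ^ 2 := by
    intro s u v
    rw [hexp s, abs_le]
    constructor
    · nlinarith [sq_nonneg (exp (s / 2) * u + exp (s / 2) ^ 2 * v)]
    · nlinarith [sq_nonneg (exp (s / 2) * u - exp (s / 2) ^ 2 * v)]
  have pα : ∀ s ∈ Set.Icc a b, ∀ x y, exp s * f (s, x, y) ^ 2 ≤ α (x, y) := by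
    intro s hs x y
    have := abs_le_integral_of_deriv (v := fun s => exp s * f (s, x, y) ^ 2)
      (v' := fun s => exp s * f (s, x, y) ^ 2 + exp s * (2 * f (s, x, y) * fs (s, x, y)))
      (k := fun s => exp s * (2 * f (s, x, y) ^ 2 + fs (s, x, y) ^ 2))
      (fun s => (Real.hasDerivAt_exp s).mul (hasDerivAt_fun_sq (hf.deriv_s s x y)))
      (by fun_prop) (by fun_prop) (by simp [h0.right]) (fun s _ => ?_) hs
    · exact (le_abs_self _).trans this
    · rw [← mul_add, abs_mul, abs_of_pos (exp_pos s)]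
      refine mul_le_mul_of_nonneg_left (abs_le.2 ⟨?_, ?_⟩) (exp_pos s).le
      · nlinarith [sq_nonneg (f (s, x, y) + fs (s, x, y)), sq_nonneg (f (s, x, y))]
      · nlinarith [sq_nonneg (f (s, x, y) - fs (s, x, y)), sq_nonneg (f (s, x, y))]
  have pβ : ∀ s, ∀ x ∈ Set.Icc (-R) R, ∀ y, exp (s / 2) ^ 3 * f (s, x, y) ^ 2 ≤ β (s, y) := by
    intro s x hx y
    exact (le_abs_self _).trans (abs_le_integral_of_deriv
      (v := fun x => exp (s / 2) ^ 3 * f (s, x, y) ^ 2)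
      (v' := fun x => exp (s / 2) ^ 3 * (2 * f (s, x, y) * fx (s, x, y)))
      (fun x => HasDerivAt.const_mul _ (hasDerivAt_fun_sq (hf.deriv_x s x y)))
      (by fun_prop) (by fun_prop) (by simp [h0.x_right]) (fun x _ => cross _ _ _) hx)
  have pγ : ∀ s x, ∀ y ∈ Set.Icc (-R) R, exp (s / 2) ^ 3 * f (s, x, y) ^ 2 ≤ γ (s, x) := by
    intro s x y hy
    exact (le_abs_self _).trans (abs_le_integral_of_deriv
      (v := fun y => exp (s / 2) ^ 3 * f (s, x, y) ^ 2)
      (v' := fun y => exp (s / 2) ^ 3 * (2 * f (s, x, y) * fy (s, x, y)))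
      (fun y => HasDerivAt.const_mul _ (hasDerivAt_fun_sq (hf.deriv_y s x y)))
      (by fun_prop) (by fun_prop) (by simp [h0.y_right]) (fun y _ => cross _ _ _) hy)
  have main : boxInt a b R (fun p => exp p.1 ^ 2 * |f p| ^ 3) ≤ √(9 * E) * √(9 * E) * √(9 * E) := by
    calc _ ≤ boxInt a b R
          (fun p => √(α (p.2.1, p.2.2)) * √(β (p.1, p.2.2)) * √(γ (p.1, p.2.1))) := by
          refine boxInt_mono hab hR (by fun_prop) (by fun_prop) fun s hs x hx y hy => ?_
          rw [← Real.sqrt_mul (hα0 _), ← Real.sqrt_mul (mul_nonneg (hα0 _) (hβ0 _))]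
          refine Real.le_sqrt_of_sq_le ?_
          calc (exp s ^ 2 * |f (s, x, y)| ^ 3) ^ 2
              = (exp s * f (s, x, y) ^ 2) * (exp (s / 2) ^ 3 * f (s, x, y) ^ 2) *
                (exp (s / 2) ^ 3 * f (s, x, y) ^ 2) := by
                rw [hexp s]; simp only [mul_pow, ← pow_mul]
                rw [pow_mul' |f (s, x, y)| 3 2, sq_abs]; ring
            _ ≤ _ := by
                have := pα s hs x y; have := pβ s x hx y; have := pγ s x y hy
                have := hα0 (x, y); have := hβ0 (s, y)
                gcongr
      _ ≤ _ := loomis_whitney hab hR hα hβ hγ (fun x _ y _ => hα0 _) (fun s _ y _ => hβ0 _)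
          (fun s _ x _ => hγ0 _)
      _ ≤ _ := by gcongr
  have h1 : 0 ≤ boxInt a b R (fun p => exp p.1 ^ 2 * |f p| ^ 3) :=
    boxInt_nonneg hab hR fun s _ x _ y _ => by positivity
  calc _ ≤ (√(9 * E) * √(9 * E) * √(9 * E)) ^ 2 := by gcongr
    _ = (√(9 * E) ^ 2) ^ 3 := by ring
    _ = _ := by rw [Real.sq_sqrt (by positivity)]

end Sobolev

/-! ### The linear equation and its energy estimate -/

/-- `w` is a classical solution of `∂ₛ (eˢ A ∂ₛ w) + e²ˢ (∂ₓ² w + ∂ᵧ² w) = 0`, where the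
coefficient `A` takes its values in `[m, M]`. -/
structure IsSolution (m M : ℝ) (A w ws wx wy : ℝ × ℝ × ℝ → ℝ) : Prop where
  isC1 : IsC1 w ws wx wy
  cont_A : Continuous A
  lower : ∀ p, m ≤ A p
  upper : ∀ p, A p ≤ M
  eqn : ∃ F G H : ℝ × ℝ × ℝ → ℝ, Continuous F ∧ Continuous G ∧ Continuous H ∧
    (∀ s x y, HasDerivAt (fun t => exp t * A (t, x, y) * ws (t, x, y)) (F (s, x, y)) s) ∧
    (∀ s x y, HasDerivAt (fun t => wx (s, t, y)) (G (s, x, y)) x) ∧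
    (∀ s x y, HasDerivAt (fun t => wy (s, x, t)) (H (s, x, y)) y) ∧
    ∀ p, F p + exp p.1 ^ 2 * (G p + H p) = 0

section Caccioppoli

variable {a b R m M : ℝ} {A w ws wx wy ψ ψs ψx ψy : ℝ × ℝ × ℝ → ℝ}

lemma IsSolution.weak (hw : IsSolution m M A w ws wx wy) (hψ : IsC1 ψ ψs ψx ψy)
    (h0 : VanishesOnBoundary a b R ψ) :
    boxInt a b R (fun p => exp p.1 * A p * ws p * ψs p +
      (exp p.1 ^ 2 * wx p * ψx p + exp p.1 ^ 2 * wy p * ψy p)) = 0 := by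
  obtain ⟨F, G, H, hF, hG, hH, dF, dG, dH, heq⟩ := hw.eqn
  have := hw.isC1.cont_s; have := hw.isC1.cont_x; have := hw.isC1.cont_y; have := hw.cont_A
  have := hψ.cont; have := hψ.cont_s; have := hψ.cont_x; have := hψ.cont_y
  have e1 : boxInt a b R (fun p => exp p.1 * A p * ws p * ψs p) =
      boxInt a b R (fun p => - (F p * ψ p)) := by
    rw [boxInt_eq_xys (by fun_prop), boxInt_eq_xys (by fun_prop)]
    congr 1; ext x; congr 1; ext y
    rw [integral_neg]
    exact integral_mul_deriv_of_boundary (fun s => dF s x y) (fun s => hψ.deriv_s s x y)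
      (by fun_prop) (by fun_prop) (h0.left x y) (h0.right x y)
  have e2 : boxInt a b R (fun p => exp p.1 ^ 2 * wx p * ψx p) =
      boxInt a b R (fun p => - (exp p.1 ^ 2 * G p * ψ p)) := by
    rw [boxInt_eq_syx (by fun_prop), boxInt_eq_syx (by fun_prop)]
    congr 1; ext s; congr 1; ext y
    rw [integral_neg]
    exact integral_mul_deriv_of_boundary (fun x => (dG s x y).const_mul (exp s ^ 2))
      (fun x => hψ.deriv_x s x y) (by fun_prop) (by fun_prop) (h0.x_left s y) (h0.x_right s y)
  have e3 : boxInt a b R (fun p => exp p.1 ^ 2 * wy p * ψy p) =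
      boxInt a b R (fun p => - (exp p.1 ^ 2 * H p * ψ p)) := by
    simp only [boxInt]
    congr 1; ext s; congr 1; ext x
    rw [integral_neg]
    exact integral_mul_deriv_of_boundary (fun y => (dH s x y).const_mul (exp s ^ 2))
      (fun y => hψ.deriv_y s x y) (by fun_prop) (by fun_prop) (h0.y_left s x) (h0.y_right s x)
  rw [boxInt_add (by fun_prop) (by fun_prop), boxInt_add (by fun_prop) (by fun_prop), e1, e2, e3,
    ← boxInt_add (by fun_prop) (by fun_prop), ← boxInt_add (by fun_prop) (by fun_prop)]
  have : (fun p => -(F p * ψ p) + (-(exp p.1 ^ 2 * G p * ψ p) + -(exp p.1 ^ 2 * H p * ψ p))) =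
      fun _ => 0 := by
    ext p; linear_combination (-ψ p) * heq p
  rw [this]
  simp [boxInt]

/-- The energy estimate obtained by testing with `α β ψ²`, where `αβ` is a function of `w` whose
derivative with respect to `w` is at least `α²`. -/
lemma IsSolution.caccioppoli (hab : a ≤ b) (hR : 0 ≤ R) (hm : 0 ≤ m) (hm1 : m ≤ 1) (hM1 : 1 ≤ M)
    (hw : IsSolution m M A w ws wx wy) (hψ : IsC1 ψ ψs ψx ψy)
    (h0 : VanishesOnBoundary a b R ψ) {α β κ : ℝ × ℝ × ℝ → ℝ} (hα : Continuous α)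
    (hβ : Continuous β) (hκ : Continuous κ)
    (hαβ : IsC1 (fun p => α p * β p) (fun p => κ p * ws p) (fun p => κ p * wx p)
      (fun p => κ p * wy p))
    (hle : ∀ p, α p ^ 2 ≤ κ p) :
    m * boxInt a b R (fun p => α p ^ 2 * ψ p ^ 2 * energy ws wx wy p) ≤
      4 * M * boxInt a b R (fun p => β p ^ 2 * energy ψs ψx ψy p) := by
  have hφ := hαβ.mul (hψ.mul hψ)
  have hφ0 : VanishesOnBoundary a b R (fun p => α p * β p * (ψ p * ψ p)) :=
    (h0.mul_left ψ).mul_left _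
  have weak := hw.weak hφ hφ0
  have := hw.isC1.cont; have := hw.isC1.cont_s; have := hw.isC1.cont_x; have := hw.isC1.cont_y
  have := hw.cont_A
  have := hψ.cont; have := hψ.cont_s; have := hψ.cont_x; have := hψ.cont_y
  have := hψ.continuous_energy; have := hw.isC1.continuous_energy
  have key : boxInt a b R (fun p => m / 2 * (α p ^ 2 * ψ p ^ 2 * energy ws wx wy p) +
      (- (2 * M)) * (β p ^ 2 * energy ψs ψx ψy p)) ≤ 0 := by
    rw [← weak]
    refine boxInt_mono hab hR (by fun_prop) (by fun_prop) fun s _ x _ y _ => ?_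
    have aux : ∀ c l p q : ℝ, 0 ≤ c → l * m ≤ c → c ≤ M * l → 0 ≤ l →
        m / 2 * (α (s, x, y) ^ 2 * ψ (s, x, y) ^ 2 * (l * p ^ 2)) -
          2 * M * (β (s, x, y) ^ 2 * (l * q ^ 2)) ≤
        c * p * (κ (s, x, y) * p * (ψ (s, x, y) * ψ (s, x, y)) +
          α (s, x, y) * β (s, x, y) * (q * ψ (s, x, y) + ψ (s, x, y) * q)) := by
      intro c l p q hc h1 h2 hl
      have hl' := hle (s, x, y)
      generalize α (s, x, y) = a' at *
      generalize β (s, x, y) = b' at *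
      generalize κ (s, x, y) = k at *
      generalize ψ (s, x, y) = P at *
      have i1 : 0 ≤ c * (a' * P * p + 2 * b' * q) ^ 2 := by positivity
      have i2 : 0 ≤ c * (p ^ 2 * P ^ 2) * (k - a' ^ 2) :=
        mul_nonneg (by positivity) (by linarith)
      have i3 : 0 ≤ (c - l * m) * (a' * P * p) ^ 2 := mul_nonneg (by linarith) (sq_nonneg _)
      have i4 : 0 ≤ (M * l - c) * (b' * q) ^ 2 := mul_nonneg (by linarith) (sq_nonneg _)
      nlinarith
    have hA := hw.lower (s, x, y)
    have hA' := hw.upper (s, x, y)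
    have he := exp_pos s
    have a1 := aux (exp s * A (s, x, y)) (exp s) (ws (s, x, y)) (ψs (s, x, y))
      (mul_nonneg he.le (hm.trans hA)) (mul_le_mul_of_nonneg_left hA he.le)
      (by rw [mul_comm M]; exact mul_le_mul_of_nonneg_left hA' he.le) he.le
    have a2 := aux (exp s ^ 2) (exp s ^ 2) (wx (s, x, y)) (ψx (s, x, y))
      (by positivity) (by nlinarith [sq_nonneg (exp s)]) (by nlinarith [sq_nonneg (exp s)])
      (by positivity)
    have a3 := aux (exp s ^ 2) (exp s ^ 2) (wy (s, x, y)) (ψy (s, x, y))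
      (by positivity) (by nlinarith [sq_nonneg (exp s)]) (by nlinarith [sq_nonneg (exp s)])
      (by positivity)
    simp only [energy]
    linarith
  rw [boxInt_add (by fun_prop) (by fun_prop), boxInt_const_mul, boxInt_const_mul] at key
  linarith

end Caccioppoli

/-! ### Cutoff functions -/

/-- A function vanishing on the boundary of `{eˢ < R²} × (-R, R)²`. -/
def bump (R : ℝ) (p : ℝ × ℝ × ℝ) : ℝ :=
  (R ^ 2 - exp p.1) * ((R ^ 2 - p.2.1 ^ 2) * (R ^ 2 - p.2.2 ^ 2))

/-- A power of `bump`, cut off near `s = a` by a capacitary potential. -/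
def cutoff (R a σ : ℝ) (p : ℝ × ℝ × ℝ) : ℝ := (1 - exp (a - p.1)) * bump R p ^ σ

/-- The derivative of `cutoff` in the first variable. -/
def cutoffS (R a σ : ℝ) (p : ℝ × ℝ × ℝ) : ℝ :=
  exp (a - p.1) * bump R p ^ σ + (1 - exp (a - p.1)) *
    (σ * bump R p ^ (σ - 1) * (-exp p.1 * ((R ^ 2 - p.2.1 ^ 2) * (R ^ 2 - p.2.2 ^ 2))))

/-- The derivative of `cutoff` in the second variable. -/
def cutoffX (R a σ : ℝ) (p : ℝ × ℝ × ℝ) : ℝ :=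
  (1 - exp (a - p.1)) *
    (σ * bump R p ^ (σ - 1) * ((R ^ 2 - exp p.1) * (-(2 * p.2.1) * (R ^ 2 - p.2.2 ^ 2))))

/-- The derivative of `cutoff` in the third variable. -/
def cutoffY (R a σ : ℝ) (p : ℝ × ℝ × ℝ) : ℝ :=
  (1 - exp (a - p.1)) *
    (σ * bump R p ^ (σ - 1) * ((R ^ 2 - exp p.1) * ((R ^ 2 - p.2.1 ^ 2) * -(2 * p.2.2))))

lemma continuous_bump (R : ℝ) : Continuous (bump R) := by unfold bump; fun_prop

lemma continuous_bump_rpow (R : ℝ) {σ : ℝ} (hσ : 0 ≤ σ) : Continuous fun p => bump R p ^ σ :=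
  (Real.continuous_rpow_const hσ).comp (continuous_bump R)

lemma hasDerivAt_rpow_comp {v : ℝ → ℝ} {v' x σ : ℝ} (hσ : 1 ≤ σ) (h : HasDerivAt v v' x) :
    HasDerivAt (fun t => v t ^ σ) (σ * v x ^ (σ - 1) * v') x :=
  (Real.hasDerivAt_rpow_const (Or.inr hσ)).comp x h

lemma isC1_cutoff (R a : ℝ) {σ : ℝ} (hσ : 1 ≤ σ) :
    IsC1 (cutoff R a σ) (cutoffS R a σ) (cutoffX R a σ) (cutoffY R a σ) := by
  have h1 := continuous_bump_rpow R (zero_le_one.trans hσ)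
  have h2 := continuous_bump_rpow R (sub_nonneg.2 hσ)
  have d2 : ∀ z : ℝ, HasDerivAt (fun t : ℝ => R ^ 2 - t ^ 2) (-(2 * z)) z := fun z => by
    simpa using ((hasDerivAt_id z).fun_pow 2).const_sub (R ^ 2)
  have de : ∀ z : ℝ, HasDerivAt (fun t : ℝ => R ^ 2 - exp t) (-exp z) z := fun z =>
    (Real.hasDerivAt_exp z).const_sub (R ^ 2)
  have dχ : ∀ z : ℝ, HasDerivAt (fun t : ℝ => 1 - exp (a - t)) (exp (a - z)) z := fun z => by
    simpa using (((hasDerivAt_id z).const_sub a).exp).const_sub 1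
  refine ⟨?_, ?_, ?_, ?_, fun s x y => ?_, fun s x y => ?_, fun s x y => ?_⟩
  · unfold cutoff; fun_prop
  · unfold cutoffS; fun_prop
  · unfold cutoffX; fun_prop
  · unfold cutoffY; fun_prop
  · exact (dχ s).mul (hasDerivAt_rpow_comp hσ
      ((de s).mul_const ((R ^ 2 - x ^ 2) * (R ^ 2 - y ^ 2))))
  · exact (hasDerivAt_rpow_comp hσ (((d2 x).mul_const (R ^ 2 - y ^ 2)).const_mul
      (R ^ 2 - exp s))).const_mul
      (1 - exp (a - s))
  · exact (hasDerivAt_rpow_comp hσ (((d2 y).const_mul (R ^ 2 - x ^ 2)).const_mul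
      (R ^ 2 - exp s))).const_mul (1 - exp (a - s))

lemma vanishesOnBoundary_cutoff {R a b σ : ℝ} (hσ : 1 ≤ σ) (hb : exp b = R ^ 2) :
    VanishesOnBoundary a b R (cutoff R a σ) := by
  have hσ0 : σ ≠ 0 := by linarith
  constructor <;> intros <;> simp [cutoff, bump, hb, Real.zero_rpow hσ0]

section bounds

variable {R a b : ℝ} {s x y : ℝ}

lemma sq_sub_mem {R x : ℝ} (hx : x ∈ Set.Icc (-R) R) : 0 ≤ R ^ 2 - x ^ 2 := by
  nlinarith [hx.1, hx.2]

lemma bump_nonneg (hb : exp b = R ^ 2) (hs : s ≤ b) (hx : x ∈ Set.Icc (-R) R)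
    (hy : y ∈ Set.Icc (-R) R) : 0 ≤ bump R (s, x, y) := by
  have h1 := sq_sub_mem hx
  have h2 := sq_sub_mem hy
  have h3 : 0 ≤ R ^ 2 - exp s := by rw [← hb]; exact sub_nonneg.2 (exp_le_exp.2 hs)
  simp only [bump]
  positivity

lemma bump_le (hb : exp b = R ^ 2) (hs : s ≤ b) (hx : x ∈ Set.Icc (-R) R)
    (hy : y ∈ Set.Icc (-R) R) : bump R (s, x, y) ≤ R ^ 6 := by
  have h1 := sq_sub_mem hx
  have h2 := sq_sub_mem hy
  have h3 : 0 ≤ R ^ 2 - exp s := by rw [← hb]; exact sub_nonneg.2 (exp_le_exp.2 hs)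
  have h4 : R ^ 2 - exp s ≤ R ^ 2 := by linarith [exp_pos s]
  have h5 : R ^ 2 - x ^ 2 ≤ R ^ 2 := by linarith [sq_nonneg x]
  have h6 : R ^ 2 - y ^ 2 ≤ R ^ 2 := by linarith [sq_nonneg y]
  calc bump R (s, x, y) ≤ R ^ 2 * (R ^ 2 * R ^ 2) := by simp only [bump]; gcongr
    _ = R ^ 6 := by ring

lemma energy_cutoff_le {σ : ℝ} (hb : exp b = R ^ 2) (hs : s ∈ Set.Icc a b)
    (hx : x ∈ Set.Icc (-R) R) (hy : y ∈ Set.Icc (-R) R) :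
    energy (cutoffS R a σ) (cutoffX R a σ) (cutoffY R a σ) (s, x, y) ≤
      2 * (bump R (s, x, y) ^ σ) ^ 2 * (exp a ^ 2 * exp (-s)) +
        10 * R ^ 10 * σ ^ 2 * (exp s ^ 2 * (bump R (s, x, y) ^ (σ - 1)) ^ 2) := by
  have h1 := sq_sub_mem hx
  have h2 := sq_sub_mem hy
  have hes : exp s ≤ R ^ 2 := by rw [← hb]; exact exp_le_exp.2 hs.2
  have h3 : 0 ≤ R ^ 2 - exp s := by linarith
  have h4 : R ^ 2 - exp s ≤ R ^ 2 := by linarith [exp_pos s]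
  have h5 : R ^ 2 - x ^ 2 ≤ R ^ 2 := by linarith [sq_nonneg x]
  have h6 : R ^ 2 - y ^ 2 ≤ R ^ 2 := by linarith [sq_nonneg y]
  have h7 : x ^ 2 ≤ R ^ 2 := by linarith
  have h8 : y ^ 2 ≤ R ^ 2 := by linarith
  have hχ0 : 0 ≤ 1 - exp (a - s) := by
    rw [sub_nonneg]; exact Real.exp_le_one_iff.2 (by linarith [hs.1])
  have hχ1 : 1 - exp (a - s) ≤ 1 := by linarith [exp_pos (a - s)]
  have hχ2 : (1 - exp (a - s)) ^ 2 ≤ 1 := pow_le_one₀ hχ0 hχ1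
  have he : exp s * exp (a - s) ^ 2 = exp a ^ 2 * exp (-s) := by
    rw [sq, sq, ← exp_add, ← exp_add, ← exp_add, ← exp_add]; congr 1; ring
  simp only [energy, cutoffS, cutoffX, cutoffY]
  generalize bump R (s, x, y) ^ σ = E
  generalize bump R (s, x, y) ^ (σ - 1) = E'
  generalize 1 - exp (a - s) = c at *
  have b1 : exp s *
      (exp (a - s) * E + c * (σ * E' * (-exp s * ((R ^ 2 - x ^ 2) * (R ^ 2 - y ^ 2))))) ^ 2
      ≤ 2 * E ^ 2 * (exp a ^ 2 * exp (-s)) + 2 * R ^ 10 * σ ^ 2 * (exp s ^ 2 * E' ^ 2) := by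
    calc _ ≤ exp s * (2 * (exp (a - s) * E) ^ 2 + 2 *
          (c * (σ * E' * (-exp s * ((R ^ 2 - x ^ 2) * (R ^ 2 - y ^ 2))))) ^ 2) := by
          refine mul_le_mul_of_nonneg_left ?_ (exp_pos s).le
          exact (add_sq_le).trans_eq (by ring)
      _ = 2 * E ^ 2 * (exp s * exp (a - s) ^ 2) + 2 * (σ ^ 2 * (exp s ^ 2 * E' ^ 2)) *
          (c ^ 2 * exp s * ((R ^ 2 - x ^ 2) ^ 2 * (R ^ 2 - y ^ 2) ^ 2)) := by ring
      _ ≤ 2 * E ^ 2 * (exp a ^ 2 * exp (-s)) + 2 * (σ ^ 2 * (exp s ^ 2 * E' ^ 2)) *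
          (1 * R ^ 2 * ((R ^ 2) ^ 2 * (R ^ 2) ^ 2)) := by rw [he]; gcongr
      _ = _ := by ring
  have b2 : exp s ^ 2 * (c * (σ * E' * ((R ^ 2 - exp s) * (-(2 * x) * (R ^ 2 - y ^ 2))))) ^ 2 ≤
      4 * R ^ 10 * σ ^ 2 * (exp s ^ 2 * E' ^ 2) := by
    calc _ = 4 * (σ ^ 2 * (exp s ^ 2 * E' ^ 2)) *
          (c ^ 2 * ((R ^ 2 - exp s) ^ 2 * (x ^ 2 * (R ^ 2 - y ^ 2) ^ 2))) := by ring
      _ ≤ 4 * (σ ^ 2 * (exp s ^ 2 * E' ^ 2)) *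
          (1 * ((R ^ 2) ^ 2 * (R ^ 2 * (R ^ 2) ^ 2))) := by gcongr
      _ = _ := by ring
  have b3 : exp s ^ 2 * (c * (σ * E' * ((R ^ 2 - exp s) * ((R ^ 2 - x ^ 2) * -(2 * y))))) ^ 2 ≤
      4 * R ^ 10 * σ ^ 2 * (exp s ^ 2 * E' ^ 2) := by
    calc _ = 4 * (σ ^ 2 * (exp s ^ 2 * E' ^ 2)) *
          (c ^ 2 * ((R ^ 2 - exp s) ^ 2 * ((R ^ 2 - x ^ 2) ^ 2 * y ^ 2))) := by ring
      _ ≤ 4 * (σ ^ 2 * (exp s ^ 2 * E' ^ 2)) *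
          (1 * ((R ^ 2) ^ 2 * ((R ^ 2) ^ 2 * R ^ 2))) := by gcongr
      _ = _ := by ring
  linarith

/-- The energy of the capacitary potential tends to zero. -/
lemma boxInt_capacity_le (R a b : ℝ) :
    boxInt a b R (fun p => exp a ^ 2 * exp (-p.1)) ≤ 4 * R ^ 2 * exp a := by
  have h : ∫ s in a..b, exp (-s) = exp (-a) - exp (-b) := by simp
  have e : boxInt a b R (fun p => exp a ^ 2 * exp (-p.1)) =
      4 * R ^ 2 * (exp a ^ 2 * (exp (-a) - exp (-b))) := by
    simp only [boxInt, integral_const, integral_const_mul, smul_eq_mul, h]; ring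
  rw [e]
  have h2 : exp a * exp (-a) = 1 := by rw [← exp_add]; simp
  have h3 : exp a ^ 2 * (exp (-a) - exp (-b)) ≤ exp a := by
    have : 0 ≤ exp a ^ 2 * exp (-b) := by positivity
    linear_combination this + exp a * h2
  gcongr

/-- The boxes have bounded measure. -/
lemma boxInt_exp_sq_le (R : ℝ) (hab : a ≤ b) :
    boxInt a b R (fun p => exp p.1 ^ 2) ≤ 4 * R ^ 2 * exp b ^ 2 := by
  have h : ∫ s in a..b, exp s ^ 2 ≤ exp b ^ 2 := by
    have e : ∫ s in a..b, 2 * exp s ^ 2 = exp b ^ 2 - exp a ^ 2 := by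
      refine integral_eq_sub_of_hasDerivAt (f := fun s => exp s ^ 2) (fun s _ => ?_)
        (Continuous.intervalIntegrable (by fun_prop) _ _)
      exact (hasDerivAt_fun_sq (Real.hasDerivAt_exp s)).congr_deriv (by ring)
    have h0 : 0 ≤ ∫ s in a..b, exp s ^ 2 := integral_nonneg hab fun s _ => by positivity
    rw [integral_const_mul] at e
    nlinarith [sq_nonneg (exp a)]
  have e : boxInt a b R (fun p => exp p.1 ^ 2) = 4 * R ^ 2 * ∫ s in a..b, exp s ^ 2 := by
    simp only [boxInt, integral_const, integral_mul_const, integral_const_mul, smul_eq_mul]; ring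
  rw [e]
  gcongr

end bounds

/-! ### A Poincaré inequality -/

lemma sq_sub_le_of_weight {a b c d : ℝ} {v v' : ℝ → ℝ} (hv : ∀ x, HasDerivAt v (v' x) x)
    (hv' : Continuous v') (hc : c ∈ Set.Icc a b) (hd : d ∈ Set.Icc a b) {k : ℝ → ℝ}
    (hk : Continuous k) :
    (v c - v d) ^ 2 ≤ (∫ x in a..b, exp (k x) * v' x ^ 2) * |∫ x in c..d, exp (-k x)| := by
  wlog hcd : c ≤ d generalizing c d
  · have := this hd hc (le_of_not_ge hcd)
    rw [integral_symm d c, abs_neg]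
    linarith [sq_nonneg (v c - v d), show (v c - v d) ^ 2 = (v d - v c) ^ 2 by ring]
  have h1 : ∫ x in c..d, v' x = v d - v c :=
    integral_eq_sub_of_hasDerivAt (fun x _ => hv x) (hv'.intervalIntegrable _ _)
  have h2 : ∫ x in c..d, v' x = ∫ x in c..d, (exp (k x / 2) * v' x) * exp (-k x / 2) := by
    congr 1; ext x
    have : exp (k x / 2) * exp (-k x / 2) = 1 := by rw [← exp_add]; ring_nf; simp
    linear_combination (-v' x) * this
  have h3 := sq_integral_mul_le hcd (f := fun x => exp (k x / 2) * v' x)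
    (g := fun x => exp (-k x / 2)) (by fun_prop) (by fun_prop)
  rw [← h2, h1] at h3
  have e1 : (fun x => (exp (k x / 2) * v' x) ^ 2) = fun x => exp (k x) * v' x ^ 2 := by
    ext x; rw [mul_pow, ← Real.exp_nat_mul]; congr 2; push_cast; ring
  have e2 : (fun x => exp (-k x / 2) ^ 2) = fun x => exp (-k x) := by
    ext x; rw [← Real.exp_nat_mul]; congr 1; push_cast; ring
  rw [e1, e2] at h3
  calc (v c - v d) ^ 2 = (v d - v c) ^ 2 := by ring
    _ ≤ _ := h3
    _ ≤ (∫ x in a..b, exp (k x) * v' x ^ 2) * |∫ x in c..d, exp (-k x)| := by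
      refine mul_le_mul ?_ (le_abs_self _) (integral_nonneg hcd fun x _ => (exp_pos _).le)
        (integral_nonneg (hc.1.trans hc.2) fun x _ => by positivity)
      exact integral_mono_interval_of_nonneg hc.1 hcd hd.2 (by fun_prop) fun x _ => by positivity

section Poincare

variable {f fs fx fy : ℝ × ℝ × ℝ → ℝ} {t : ℝ}

lemma sq_sub_le_energy (ht : t ≤ -1) (hf : IsC1 f fs fx fy) {s s' x x' y y' : ℝ}
    (hs : s ∈ Set.Icc t 0) (hs' : s' ∈ Set.Icc (-1) 0)
    (hx : x ∈ Set.Icc (-1) 1) (hx' : x' ∈ Set.Icc (-1) 1)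
    (hy : y ∈ Set.Icc (-1) 1) (hy' : y' ∈ Set.Icc (-1) 1) :
    (f (s, x, y) - f (s', x', y')) ^ 2 ≤
      3 * ((exp (-s) + 3) * (∫ σ in t..0, exp σ * fs (σ, x, y) ^ 2)) +
        6 * (∫ ξ in -1..1, fx (s', ξ, y) ^ 2) + 6 * (∫ η in -1..1, fy (s', x', η) ^ 2) := by
  have := hf.cont_s; have := hf.cont_x; have := hf.cont_y
  have h1 := sq_sub_le_of_weight (v := fun s => f (s, x, y)) (fun s => hf.deriv_s s x y)
    (by fun_prop) hs (d := s') ⟨ht.trans hs'.1, hs'.2⟩ (k := fun s => s) (by fun_prop)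
  have h2 := sq_sub_le_of_weight (v := fun x => f (s', x, y)) (fun x => hf.deriv_x s' x y)
    (by fun_prop) hx hx' (k := fun _ => 0) (by fun_prop)
  have h3 := sq_sub_le_of_weight (v := fun y => f (s', x', y)) (fun y => hf.deriv_y s' x' y)
    (by fun_prop) hy hy' (k := fun _ => 0) (by fun_prop)
  simp only [exp_zero, one_mul, neg_zero, integral_const, smul_eq_mul, mul_one] at h2 h3
  have a1 : |∫ σ in s..s', exp (-σ)| ≤ exp (-s) + 3 := by
    have e : ∫ σ in s..s', exp (-σ) = exp (-s) - exp (-s') := by simp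
    have : exp (-s') ≤ 3 := by
      refine (exp_le_exp.2 (by linarith [hs'.1] : -s' ≤ 1)).trans ?_
      linarith [Real.exp_one_lt_d9]
    rw [e, abs_le]
    constructor <;> linarith [exp_pos (-s), exp_pos (-s')]
  have a2 : |x' - x| ≤ 2 := by rw [abs_le]; constructor <;> linarith [hx.1, hx.2, hx'.1, hx'.2]
  have a3 : |y' - y| ≤ 2 := by rw [abs_le]; constructor <;> linarith [hy.1, hy.2, hy'.1, hy'.2]
  have n1 : 0 ≤ ∫ σ in t..0, exp σ * fs (σ, x, y) ^ 2 :=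
    integral_nonneg (by linarith) fun _ _ => by positivity
  have n2 : 0 ≤ ∫ ξ in -1..1, fx (s', ξ, y) ^ 2 :=
    integral_nonneg (by norm_num) fun _ _ => by positivity
  have n3 : 0 ≤ ∫ η in -1..1, fy (s', x', η) ^ 2 :=
    integral_nonneg (by norm_num) fun _ _ => by positivity
  have b1 := h1.trans (mul_le_mul_of_nonneg_left a1 n1)
  have b2 := h2.trans (mul_le_mul_of_nonneg_left a2 n2)
  have b3 := h3.trans (mul_le_mul_of_nonneg_left a3 n3)
  have tri : ∀ p q r : ℝ, (p + q + r) ^ 2 ≤ 3 * (p ^ 2 + q ^ 2 + r ^ 2) := fun p q r => by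
    nlinarith [sq_nonneg (p - q), sq_nonneg (q - r), sq_nonneg (p - r)]
  calc (f (s, x, y) - f (s', x', y')) ^ 2
      = ((f (s, x, y) - f (s', x, y)) + (f (s', x, y) - f (s', x', y)) +
        (f (s', x', y) - f (s', x', y'))) ^ 2 := by ring
    _ ≤ _ := tri _ _ _
    _ ≤ _ := by linarith

/-- A weighted Poincaré inequality. -/
lemma poincare (ht : t ≤ -1) (hf : IsC1 f fs fx fy) {q θ : ℝ × ℝ × ℝ → ℝ} (hq : Continuous q)
    (hθ : Continuous θ)
    (h : ∀ s ∈ Set.Icc t 0, ∀ x ∈ Set.Icc (-1) 1, ∀ y ∈ Set.Icc (-1) 1, ∀ s' ∈ Set.Icc (-1) 0,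
      ∀ x' ∈ Set.Icc (-1) 1, ∀ y' ∈ Set.Icc (-1) 1,
      θ (s', x', y') * q (s, x, y) ≤ (f (s, x, y) - f (s', x', y')) ^ 2) :
    boxInt (-1) 0 1 θ * boxInt t 0 1 (fun p => exp p.1 ^ 2 * q p) ≤
      1000 * boxInt t 0 1 (energy fs fx fy) := by
  have := hf.cont_s; have := hf.cont_x; have := hf.cont_y; have := hf.continuous_energy
  have ht0 : t ≤ 0 := by linarith
  have h11 : (-1 : ℝ) ≤ 1 := by norm_num
  have h10 : (-1 : ℝ) ≤ 0 := by norm_num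
  set E := boxInt t 0 1 (energy fs fx fy) with hE
  let D : ℝ × ℝ → ℝ := fun z => ∫ σ in t..0, exp σ * fs (σ, z.1, z.2) ^ 2
  let D₂ : ℝ × ℝ → ℝ := fun z => ∫ ξ in -1..1, fx (z.1, ξ, z.2) ^ 2
  let D₃ : ℝ × ℝ → ℝ := fun z => ∫ η in -1..1, fy (z.1, z.2, η) ^ 2
  have hD : Continuous D := by fun_prop
  have hD₂ : Continuous D₂ := by fun_prop
  have hD₃ : Continuous D₃ := by fun_prop
  have hDn : ∀ z, 0 ≤ D z := fun z => integral_nonneg ht0 fun _ _ => by positivity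
  have hD₂n : ∀ z, 0 ≤ D₂ z := fun z => integral_nonneg h11 fun _ _ => by positivity
  have ID : ∫ x in -1..1, ∫ y in -1..1, D (x, y) ≤ E := by
    rw [← boxInt_eq_xys (f := fun p => exp p.1 * fs p ^ 2) (by fun_prop)]
    refine boxInt_mono ht0 zero_le_one (by fun_prop) (by fun_prop) fun s _ x _ y _ => ?_
    have : 0 ≤ exp s ^ 2 * (fx (s, x, y) ^ 2 + fy (s, x, y) ^ 2) := by positivity
    simp only [energy]; linarith
  have hes : ∀ s ∈ Set.Icc (-1 : ℝ) 0, 1 ≤ 9 * exp s ^ 2 := by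
    intro s hs
    have h1 : exp s * exp (-s) = 1 := by rw [← exp_add]; simp
    have h2 : exp (-s) ≤ 3 := by
      refine (exp_le_exp.2 (by linarith [hs.1] : -s ≤ 1)).trans ?_
      linarith [Real.exp_one_lt_d9]
    have h3 : 1 ≤ 3 * exp s := by nlinarith [exp_pos s]
    nlinarith
  have Esub : boxInt (-1) 0 1 (energy fs fx fy) ≤ E :=
    boxInt_mono_box ht h10 le_rfl zero_le_one le_rfl (by fun_prop)
      fun s _ x _ y _ => energy_nonneg _ _ _ _
  have ID₂ : ∫ y in -1..1, ∫ s in -1..0, D₂ (s, y) ≤ 9 * E := by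
    rw [← integral_swap (f := D₂) hD₂, ← boxInt_eq_syx (f := fun p => fx p ^ 2) (by fun_prop)]
    calc _ ≤ boxInt (-1) 0 1 (fun p => 9 * energy fs fx fy p) := by
          refine boxInt_mono h10 zero_le_one (by fun_prop) (by fun_prop) fun s hs x _ y _ => ?_
          have h1 : 0 ≤ exp s * fs (s, x, y) ^ 2 + exp s ^ 2 * fy (s, x, y) ^ 2 := by positivity
          have h2 := mul_le_mul_of_nonneg_right (hes s hs) (sq_nonneg (fx (s, x, y)))
          simp only [energy]; linarith
      _ ≤ _ := by rw [boxInt_const_mul]; linarith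
  have ID₃ : ∫ s in -1..0, ∫ x in -1..1, D₃ (s, x) ≤ 9 * E := by
    change boxInt (-1) 0 1 (fun p => fy p ^ 2) ≤ _
    calc _ ≤ boxInt (-1) 0 1 (fun p => 9 * energy fs fx fy p) := by
          refine boxInt_mono h10 zero_le_one (by fun_prop) (by fun_prop) fun s hs x _ y _ => ?_
          have h1 : 0 ≤ exp s * fs (s, x, y) ^ 2 + exp s ^ 2 * fx (s, x, y) ^ 2 := by positivity
          have h2 := mul_le_mul_of_nonneg_right (hes s hs) (sq_nonneg (fy (s, x, y)))
          simp only [energy]; linarith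
      _ ≤ _ := by rw [boxInt_const_mul]; linarith
  have step : ∀ s ∈ Set.Icc t 0, ∀ x ∈ Set.Icc (-1 : ℝ) 1, ∀ y ∈ Set.Icc (-1 : ℝ) 1,
      boxInt (-1) 0 1 θ * q (s, x, y) ≤ 12 * ((exp (-s) + 3) * D (x, y)) +
        24 * (∫ s' in -1..0, D₂ (s', y)) + 12 * (∫ s' in -1..0, ∫ x' in -1..1, D₃ (s', x')) := by
    intro s hs x hx y hy
    calc boxInt (-1) 0 1 θ * q (s, x, y) = boxInt (-1) 0 1 (fun p => q (s, x, y) * θ p) := by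
          rw [boxInt_const_mul, mul_comm]
      _ ≤ boxInt (-1) 0 1 (fun p => 3 * ((exp (-s) + 3) * D (x, y)) +
          6 * D₂ (p.1, y) + 6 * D₃ (p.1, p.2.1)) := by
          refine boxInt_mono h10 zero_le_one (by fun_prop) (by fun_prop)
            fun s' hs' x' hx' y' hy' => ?_
          rw [mul_comm]
          exact (h s hs x hx y hy s' hs' x' hx' y' hy').trans
            (sq_sub_le_energy ht hf hs hs' hx hx' hy hy')
      _ = _ := by
          rw [boxInt_add (by fun_prop) (by fun_prop), boxInt_add (by fun_prop) (by fun_prop)]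
          simp only [boxInt, integral_const, integral_const_mul, smul_eq_mul]
          ring
  have hI1 : ∫ s in t..0, exp s ≤ 1 := by
    rw [integral_exp, exp_zero]; linarith [exp_pos t]
  have hI1' : 0 ≤ ∫ s in t..0, exp s := integral_nonneg ht0 fun _ _ => (exp_pos _).le
  have n1 : 0 ≤ ∫ x in -1..1, ∫ y in -1..1, D (x, y) :=
    integral_nonneg h11 fun _ _ => integral_nonneg h11 fun _ _ => hDn _
  have n2 : 0 ≤ ∫ y in -1..1, ∫ s in -1..0, D₂ (s, y) :=
    integral_nonneg h11 fun _ _ => integral_nonneg h10 fun _ _ => hD₂n _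
  have n3' : ∀ s, 0 ≤ ∫ x in -1..1, D₃ (s, x) :=
    fun s => integral_nonneg h11 fun _ _ => integral_nonneg h11 fun _ _ => by positivity
  have n3 : 0 ≤ ∫ s in -1..0, ∫ x in -1..1, D₃ (s, x) :=
    integral_nonneg h10 fun _ _ => n3' _
  set E₃ := ∫ s in -1..0, ∫ x in -1..1, D₃ (s, x) with hE₃
  calc boxInt (-1) 0 1 θ * boxInt t 0 1 (fun p => exp p.1 ^ 2 * q p)
      = boxInt t 0 1 (fun p => boxInt (-1) 0 1 θ * (exp p.1 ^ 2 * q p)) :=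
        (boxInt_const_mul _).symm
    _ ≤ boxInt t 0 1 (fun p => 48 * (exp p.1 * D (p.2.1, p.2.2)) +
        24 * (exp p.1 * ∫ s' in -1..0, D₂ (s', p.2.2)) + 12 * (exp p.1 * E₃)) := by
        refine boxInt_mono ht0 zero_le_one (by fun_prop) (by fun_prop) fun s hs x hx y hy => ?_
        have h1 := mul_le_mul_of_nonneg_left (step s hs x hx y hy) (sq_nonneg (exp s))
        have h2 : exp s * exp (-s) = 1 := by rw [← exp_add]; simp
        have h3 : exp s ^ 2 ≤ exp s := by
          have : exp s ≤ 1 := Real.exp_le_one_iff.2 hs.2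
          nlinarith [exp_pos s]
        have h4 : exp s ^ 2 * ((exp (-s) + 3) * D (x, y)) ≤ 4 * (exp s * D (x, y)) := by
          have : exp s ^ 2 * (exp (-s) + 3) ≤ 4 * exp s := by
            linear_combination 3 * h3 + exp s * h2
          calc _ = (exp s ^ 2 * (exp (-s) + 3)) * D (x, y) := by ring
            _ ≤ (4 * exp s) * D (x, y) := mul_le_mul_of_nonneg_right this (hDn _)
            _ = _ := by ring
        have h5 := mul_le_mul_of_nonneg_right h3
          (integral_nonneg (μ := MeasureTheory.volume) h10 fun s' _ => hD₂n (s', y))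
        have h6 := mul_le_mul_of_nonneg_right h3 n3
        simp only
        linarith
    _ = 48 * ((∫ s in t..0, exp s) * ∫ x in -1..1, ∫ y in -1..1, D (x, y)) +
        48 * ((∫ s in t..0, exp s) * ∫ y in -1..1, ∫ s in -1..0, D₂ (s, y)) +
        48 * ((∫ s in t..0, exp s) * E₃) := by
        rw [boxInt_add (by fun_prop) (by fun_prop), boxInt_add (by fun_prop) (by fun_prop)]
        simp only [boxInt, integral_const, integral_const_mul, integral_mul_const, smul_eq_mul]
        ring
    _ ≤ 48 * (1 * E) + 48 * (1 * (9 * E)) + 48 * (1 * (9 * E)) := by gcongr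
    _ ≤ 1000 * E := by
        have : 0 ≤ E := n1.trans ID
        linarith

end Poincare

/-! ### The logarithmic estimate -/

section LogEstimate

variable {m M t : ℝ} {A w ws wx wy : ℝ × ℝ × ℝ → ℝ}

lemma boxInt_energy_cutoff_two_le {a : ℝ} (ha : a ≤ 0) :
    boxInt a (log 4) 2 (energy (cutoffS 2 a 1) (cutoffX 2 a 1) (cutoffY 2 a 1)) ≤ 3000000 := by
  have hb : exp (log 4) = (2 : ℝ) ^ 2 := by rw [Real.exp_log (by norm_num)]; norm_num
  have h4 : 0 ≤ log 4 := Real.log_nonneg (by norm_num)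
  have hab : a ≤ log 4 := ha.trans h4
  have hc := (isC1_cutoff 2 a (σ := 1) le_rfl).continuous_energy
  have h1 := boxInt_capacity_le 2 a (log 4)
  have h2 := boxInt_exp_sq_le 2 hab
  rw [hb] at h2
  have h3 : exp a ≤ 1 := Real.exp_le_one_iff.2 ha
  calc _ ≤ boxInt a (log 4) 2 (fun p => 8192 * (exp a ^ 2 * exp (-p.1)) +
        10240 * exp p.1 ^ 2) := by
        refine boxInt_mono hab (by norm_num) hc (by fun_prop) fun s hs x hx y hy => ?_
        have h5 := energy_cutoff_le (σ := 1) hb hs hx hy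
        have h6 := bump_nonneg hb hs.2 hx hy
        have h7 := bump_le hb hs.2 hx hy
        simp only [sub_self, Real.rpow_zero, Real.rpow_one] at h5
        have h8 : bump 2 (s, x, y) ^ 2 ≤ 4096 := by
          calc _ ≤ ((2 : ℝ) ^ 6) ^ 2 := by gcongr
            _ = 4096 := by norm_num
        have h9 : bump 2 (s, x, y) ^ 2 * (exp a ^ 2 * exp (-s)) ≤
            4096 * (exp a ^ 2 * exp (-s)) := by gcongr
        simp only
        linarith
    _ = 8192 * boxInt a (log 4) 2 (fun p => exp a ^ 2 * exp (-p.1)) +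
        10240 * boxInt a (log 4) 2 (fun p => exp p.1 ^ 2) := by
        rw [boxInt_add (by fun_prop) (by fun_prop), boxInt_const_mul 8192, boxInt_const_mul 10240]
    _ ≤ _ := by linarith

lemma one_le_cutoff_two {s x y : ℝ} (hs : s ∈ Set.Icc t 0) (hx : x ∈ Set.Icc (-1) 1)
    (hy : y ∈ Set.Icc (-1) 1) : 1 ≤ cutoff 2 (t - 1) 1 (s, x, y) := by
  have h1 : exp (t - 1 - s) ≤ 1 / 2 := by
    have h2 : exp (t - 1 - s) ≤ exp (-1) := exp_le_exp.2 (by linarith [hs.1])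
    have h3 : exp (-1) * exp 1 = 1 := by rw [← exp_add]; simp
    have h4 : (2 : ℝ) ≤ exp 1 := by linarith [Real.add_one_le_exp (1 : ℝ)]
    nlinarith [exp_pos (-1)]
  have h5 : exp s ≤ 1 := Real.exp_le_one_iff.2 hs.2
  have h6 : 3 ≤ (2 : ℝ) ^ 2 - x ^ 2 := by nlinarith [hx.1, hx.2]
  have h7 : 3 ≤ (2 : ℝ) ^ 2 - y ^ 2 := by nlinarith [hy.1, hy.2]
  have h8 : 3 ≤ (2 : ℝ) ^ 2 - exp s := by linarith
  simp only [cutoff, bump, Real.rpow_one]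
  have h9 : 1 / 2 ≤ 1 - exp (t - 1 - s) := by linarith
  calc (1 : ℝ) ≤ 1 / 2 * (3 * (3 * 3)) := by norm_num
    _ ≤ _ := by gcongr

lemma IsC1.log (hw : IsC1 w ws wx wy) (hpos : ∀ p, 0 < w p) :
    IsC1 (fun p => log (w p)) (fun p => (w p)⁻¹ * ws p) (fun p => (w p)⁻¹ * wx p)
      (fun p => (w p)⁻¹ * wy p) :=
  hw.comp_pos (h := Real.log) (h' := fun t => t⁻¹) hpos (fun _ ht => Real.hasDerivAt_log ht.ne')
    (continuousOn_inv₀.mono fun _ ht => (Set.mem_Ioi.1 ht).ne')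

lemma IsSolution.log_energy_le (hm : 0 < m) (hm1 : m ≤ 1) (hM1 : 1 ≤ M)
    (hw : IsSolution m M A w ws wx wy) (hpos : ∀ p, 0 < w p) (ht : t ≤ 0) :
    boxInt t 0 1 (energy (fun p => (w p)⁻¹ * ws p) (fun p => (w p)⁻¹ * wx p)
      (fun p => (w p)⁻¹ * wy p)) ≤ 12000000 * (M / m) := by
  have hb : exp (log 4) = (2 : ℝ) ^ 2 := by rw [Real.exp_log (by norm_num)]; norm_num
  have h4 : 0 ≤ log 4 := Real.log_nonneg (by norm_num)
  have cw := hw.isC1.cont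
  have hne : ∀ p, w p ≠ 0 := fun p => (hpos p).ne'
  have hα : Continuous fun p => (w p)⁻¹ := cw.inv₀ hne
  have hκ : Continuous fun p => ((w p) ^ 2)⁻¹ := (cw.pow 2).inv₀ fun p => pow_ne_zero 2 (hne p)
  have hd : ∀ t : ℝ, 0 < t → HasDerivAt (fun t : ℝ => t⁻¹ * -1) (t ^ 2)⁻¹ t := fun t ht => by
    simpa using (hasDerivAt_inv ht.ne').mul_const (-1)
  have hE := hw.isC1.continuous_energy
  have hEl := (hw.isC1.log hpos).continuous_energy
  have hψ := isC1_cutoff 2 (t - 1) (σ := 1) le_rfl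
  have cψ := hψ.cont
  have key := hw.caccioppoli (a := t - 1) (b := log 4) (R := 2) (by linarith) (by norm_num) hm.le
    hm1 hM1 hψ (vanishesOnBoundary_cutoff le_rfl hb) (α := fun p => (w p)⁻¹) (β := fun _ => -1)
    (κ := fun p => ((w p) ^ 2)⁻¹) hα continuous_const hκ
    (hw.isC1.comp_pos (h := fun t => t⁻¹ * -1) (h' := fun t => (t ^ 2)⁻¹) hpos hd
      (ContinuousOn.inv₀ (by fun_prop) fun t ht => pow_ne_zero 2 (Set.mem_Ioi.1 ht).ne'))
    fun p => by simp
  have h1 := boxInt_energy_cutoff_two_le (a := t - 1) (by linarith)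
  simp only [neg_one_sq, one_mul] at key
  have h2 : boxInt t 0 1 (energy (fun p => (w p)⁻¹ * ws p) (fun p => (w p)⁻¹ * wx p)
      (fun p => (w p)⁻¹ * wy p)) ≤ boxInt (t - 1) (log 4) 2
        (fun p => (w p)⁻¹ ^ 2 * cutoff 2 (t - 1) 1 p ^ 2 * energy ws wx wy p) := by
    calc _ ≤ boxInt t 0 1
          (fun p => (w p)⁻¹ ^ 2 * cutoff 2 (t - 1) 1 p ^ 2 * energy ws wx wy p) := by
          refine boxInt_mono ht zero_le_one hEl (by fun_prop) fun s hs x hx y hy => ?_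
          have h3 := one_le_cutoff_two hs hx hy
          have h5 : 1 ≤ cutoff 2 (t - 1) 1 (s, x, y) ^ 2 := one_le_pow₀ h3
          have h6 : 0 ≤ (w (s, x, y))⁻¹ ^ 2 * energy ws wx wy (s, x, y) :=
            mul_nonneg (sq_nonneg _) (energy_nonneg _ _ _ _)
          have h7 := mul_le_mul_of_nonneg_right h5 h6
          calc _ = 1 * ((w (s, x, y))⁻¹ ^ 2 * energy ws wx wy (s, x, y)) := by
                simp only [energy]; ring
            _ ≤ _ := h7
            _ = _ := by ring
      _ ≤ _ := boxInt_mono_box (by linarith) ht h4 zero_le_one (by norm_num) (by fun_prop)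
          fun s _ x _ y _ => mul_nonneg (mul_nonneg (sq_nonneg _) (sq_nonneg _))
            (energy_nonneg _ _ _ _)
  have h3 := mul_le_mul_of_nonneg_left h2 hm.le
  rw [mul_div_assoc', le_div_iff₀ hm]
  have h5 := mul_le_mul_of_nonneg_left h1 (by linarith : 0 ≤ 4 * M)
  linarith

/-- A solution which is not small on a fixed set has a logarithm bounded in `L²`. -/
lemma IsSolution.boxInt_log_sq_le (hm : 0 < m) (hm1 : m ≤ 1) (hM1 : 1 ≤ M)
    (hw : IsSolution m M A w ws wx wy) (hpos : ∀ p, 0 < w p) (hw2 : ∀ p, w p ≤ 2)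
    (hθ : 1 ≤ boxInt (-1) 0 1 (fun p => max (w p - 1 / 4) 0)) (ht : t ≤ -1) :
    boxInt t 0 1 (fun p => exp p.1 ^ 2 * (log (1 + w p) - log (w p)) ^ 2) ≤
      100000000000 * (M / m) := by
  have cw := hw.isC1.cont
  have cl := (hw.isC1.log hpos).cont
  have cl1 : Continuous fun p => log (1 + w p) :=
    Continuous.log (by fun_prop) fun p => by linarith [hpos p]
  have hE := hw.log_energy_le hm hm1 hM1 hpos (t := t) (by linarith)
  have key := poincare ht (hw.isC1.log hpos) (θ := fun p => 1 / 2 * max (w p - 1 / 4) 0)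
    (q := fun p => max (- log (w p) - log 4) 0 ^ 2) (by fun_prop) (by fun_prop)
    fun s _ x _ y _ s' _ x' _ y' _ => by
      generalize (s, x, y) = P
      generalize (s', x', y') = P'
      rcases le_or_gt (w P' - 1 / 4) 0 with h | h
      · rw [max_eq_right h]; simp only [mul_zero, zero_mul]; positivity
      rcases le_or_gt (- log (w P) - log 4) 0 with h1 | h1
      · rw [max_eq_right h1]; simp only [ne_eq, OfNat.ofNat_ne_zero, not_false_eq_true, zero_pow,
          mul_zero]; positivity
      rw [max_eq_left h.le, max_eq_left h1.le]
      have h2 : - log 4 ≤ log (w P') := by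
        rw [← Real.log_inv]
        exact Real.log_le_log (by norm_num) (by norm_num; linarith)
      have h3 : (- log (w P) - log 4) ^ 2 ≤ (log (w P') - log (w P)) ^ 2 :=
        pow_le_pow_left₀ h1.le (by linarith) 2
      have h4 : 1 / 2 * (w P' - 1 / 4) ≤ 1 := by linarith [hw2 P']
      calc _ ≤ 1 * (- log (w P) - log 4) ^ 2 := by gcongr
        _ ≤ _ := by linarith [h3, sub_sq_comm (log (w P')) (log (w P))]
  rw [boxInt_const_mul] at key
  have hMm : 1 ≤ M / m := by rw [le_div_iff₀ hm]; linarith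
  have hq : 0 ≤ boxInt t 0 1 (fun p => exp p.1 ^ 2 * max (- log (w p) - log 4) 0 ^ 2) :=
    boxInt_nonneg (by linarith) zero_le_one fun s _ x _ y _ => by positivity
  have h1 : boxInt t 0 1 (fun p => exp p.1 ^ 2 * max (- log (w p) - log 4) 0 ^ 2) ≤
      24000000000 * (M / m) := by
    have := mul_le_mul_of_nonneg_right hθ hq
    linarith
  have h2 := boxInt_exp_sq_le 1 (a := t) (b := 0) (by linarith)
  rw [exp_zero] at h2
  calc _ ≤ boxInt t 0 1 (fun p => 18 * exp p.1 ^ 2 +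
        2 * (exp p.1 ^ 2 * max (- log (w p) - log 4) 0 ^ 2)) := by
        refine boxInt_mono (by linarith) zero_le_one (by fun_prop) (by fun_prop)
          fun s _ x _ y _ => ?_
        simp only
        generalize (s, x, y) = P
        have h3 : log (1 + w P) ≤ log 3 :=
          Real.log_le_log (by linarith [hpos P]) (by linarith [hw2 P])
        have h4 : log 3 + log 4 ≤ 3 := by
          rw [← Real.log_mul (by norm_num) (by norm_num), Real.log_le_iff_le_exp (by norm_num)]
          have e : exp 3 = exp 1 ^ 3 := by rw [← Real.exp_nat_mul]; norm_num
          have : (2.5 : ℝ) ≤ exp 1 := by linarith [Real.exp_one_gt_d9]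
          rw [e]
          calc (3 * 4 : ℝ) ≤ 2.5 ^ 3 := by norm_num
            _ ≤ _ := by gcongr
        have h5 : log (w P) ≤ log (1 + w P) := Real.log_le_log (hpos P) (by linarith)
        have h6 : log (1 + w P) - log (w P) ≤ 3 + max (- log (w P) - log 4) 0 := by
          linarith [le_max_left (- log (w P) - log 4) 0]
        have h7 : (log (1 + w P) - log (w P)) ^ 2 ≤
            18 + 2 * max (- log (w P) - log 4) 0 ^ 2 := by
          calc _ ≤ (3 + max (- log (w P) - log 4) 0) ^ 2 := by gcongr
            _ ≤ 2 * (3 ^ 2 + max (- log (w P) - log 4) 0 ^ 2) := add_sq_le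
            _ = _ := by ring
        calc _ ≤ exp s ^ 2 * (18 + 2 * max (- log (w P) - log 4) 0 ^ 2) := by gcongr
          _ = _ := by ring
    _ = 18 * boxInt t 0 1 (fun p => exp p.1 ^ 2) +
        2 * boxInt t 0 1 (fun p => exp p.1 ^ 2 * max (- log (w p) - log 4) 0 ^ 2) := by
        rw [boxInt_add (by fun_prop) (by fun_prop), boxInt_const_mul, boxInt_const_mul]
    _ ≤ _ := by linarith

end LogEstimate

/-! ### Moser iteration -/

/-- The function `log (1 + 1 / τ)`, whose square dominates the square of its derivative
times `τ²`. -/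
def logGap (τ : ℝ) : ℝ := log (1 + τ) - log τ

lemma logGap_pos {τ : ℝ} (hτ : 0 < τ) : 0 < logGap τ :=
  sub_pos.2 (Real.log_lt_log hτ (by linarith))

lemma hasDerivAt_logGap {τ : ℝ} (hτ : 0 < τ) : HasDerivAt logGap (-(τ * (1 + τ))⁻¹) τ := by
  have h1 : 0 < 1 + τ := by linarith
  have := ((((hasDerivAt_id τ).const_add 1).log h1.ne').sub (Real.hasDerivAt_log hτ.ne'))
  refine this.congr_deriv ?_
  simp only [id]
  field_simp
  ring

lemma continuousOn_logGap : ContinuousOn logGap (Set.Ioi 0) := fun _ hτ =>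
  (hasDerivAt_logGap (Set.mem_Ioi.1 hτ)).continuousAt.continuousWithinAt

lemma hasDerivAt_logGap_rpow {τ : ℝ} (hτ : 0 < τ) (p : ℝ) :
    HasDerivAt (fun t => logGap t ^ p) (p * (logGap τ ^ (p - 1) * -(τ * (1 + τ))⁻¹)) τ := by
  refine ((hasDerivAt_logGap hτ).rpow_const (Or.inl (logGap_pos hτ).ne')).congr_deriv ?_
  ring

lemma continuousOn_logGap_rpow (p : ℝ) : ContinuousOn (fun t => logGap t ^ p) (Set.Ioi 0) :=
  continuousOn_logGap.rpow_const fun _ ht => Or.inl (logGap_pos (Set.mem_Ioi.1 ht)).ne'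

lemma continuousOn_inv_mul_one_add : ContinuousOn (fun t : ℝ => -(t * (1 + t))⁻¹) (Set.Ioi 0) :=
  (ContinuousOn.inv₀ (by fun_prop) fun _ ht => by
    have := Set.mem_Ioi.1 ht
    positivity).neg

lemma energy_mul_le (k β ψ ws wx wy ψs ψx ψy : ℝ × ℝ × ℝ → ℝ) (p : ℝ × ℝ × ℝ) :
    energy (fun p => k p * ws p * ψ p + β p * ψs p) (fun p => k p * wx p * ψ p + β p * ψx p)
      (fun p => k p * wy p * ψ p + β p * ψy p) p ≤
      2 * (k p ^ 2 * ψ p ^ 2 * energy ws wx wy p) + 2 * (β p ^ 2 * energy ψs ψx ψy p) := by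
  simp only [energy]
  have h1 := add_sq_le (a := k p * ws p * ψ p) (b := β p * ψs p)
  have h2 := add_sq_le (a := k p * wx p * ψ p) (b := β p * ψx p)
  have h3 := add_sq_le (a := k p * wy p * ψ p) (b := β p * ψy p)
  calc _ ≤ exp p.1 * (2 * ((k p * ws p * ψ p) ^ 2 + (β p * ψs p) ^ 2)) + exp p.1 ^ 2 *
        (2 * ((k p * wx p * ψ p) ^ 2 + (β p * ψx p) ^ 2) +
          2 * ((k p * wy p * ψ p) ^ 2 + (β p * ψy p) ^ 2)) := by gcongr
    _ = _ := by ring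

/-- The integrand of the Moser iteration. -/
def moser (w : ℝ × ℝ × ℝ → ℝ) (p : ℝ) (P : ℝ × ℝ × ℝ) : ℝ :=
  exp P.1 ^ 2 * (logGap (w P) ^ p * bump 1 P ^ (3 * p - 3)) ^ 2

section Moser

variable {m M a t p B N : ℝ} {A w ws wx wy ψ ψs ψx ψy : ℝ × ℝ × ℝ → ℝ}

lemma continuous_moser (hc : Continuous w) (hpos : ∀ P, 0 < w P) (hp : 1 ≤ p) :
    Continuous (moser w p) := by
  have h1 := (continuousOn_logGap_rpow p).comp_continuous hc hpos
  have h2 := continuous_bump_rpow 1 (σ := 3 * p - 3) (by linarith)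
  unfold moser
  fun_prop

lemma IsSolution.energy_logGap_rpow_le (hab : a ≤ t) (hm : 0 < m) (hm1 : m ≤ 1) (hM1 : 1 ≤ M)
    (hw : IsSolution m M A w ws wx wy) (hpos : ∀ P, 0 < w P) (hψ : IsC1 ψ ψs ψx ψy)
    (h0 : VanishesOnBoundary a t 1 ψ) (hp : 1 ≤ p) : ∃ fs fx fy,
      IsC1 (fun P => logGap (w P) ^ p * ψ P) fs fx fy ∧ boxInt a t 1 (energy fs fx fy) ≤
        10 * p ^ 2 * (M / m) * boxInt a t 1 (fun P => (logGap (w P) ^ p) ^ 2 *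
          energy ψs ψx ψy P) := by
  have hβ := (hw.isC1.comp_pos hpos (fun τ hτ => hasDerivAt_logGap_rpow hτ p)
    (continuousOn_const.mul ((continuousOn_logGap_rpow (p - 1)).mul continuousOn_inv_mul_one_add)))
  have cβ := hβ.cont
  have cα : Continuous fun P => logGap (w P) ^ (p - 1) * -(w P * (1 + w P))⁻¹ :=
    ((continuousOn_logGap_rpow (p - 1)).mul continuousOn_inv_mul_one_add).comp_continuous
      hw.isC1.cont hpos
  have hf := hβ.mul hψ
  refine ⟨_, _, _, hf, ?_⟩
  have cE := hw.isC1.continuous_energy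
  have cEψ := hψ.continuous_energy
  have cψ := hψ.cont
  let κ : ℝ → ℝ := fun τ => (2 * p - 1) * (logGap τ ^ (2 * p - 1 - 1) * -(τ * (1 + τ))⁻¹) *
    -(τ * (1 + τ))⁻¹ + logGap τ ^ (2 * p - 1) * ((1 + 2 * τ) / (τ * (1 + τ)) ^ 2)
  have hκ : ∀ τ, 0 < τ → HasDerivAt (fun τ => logGap τ ^ (2 * p - 1) * -(τ * (1 + τ))⁻¹)
      (κ τ) τ := by
    intro τ hτ
    have h1 : τ * (1 + τ) ≠ 0 := by positivity
    refine (hasDerivAt_logGap_rpow hτ (2 * p - 1)).mul ?_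
    have h2 : HasDerivAt (fun t : ℝ => t * (1 + t)) (1 + 2 * τ) τ :=
      ((hasDerivAt_id' τ).mul ((hasDerivAt_id' τ).const_add 1)).congr_deriv (by ring)
    exact (h2.fun_inv h1).neg.congr_deriv (by ring)
  have cκ : ContinuousOn κ (Set.Ioi 0) := by
    refine ((continuousOn_const.mul ((continuousOn_logGap_rpow _).mul
      continuousOn_inv_mul_one_add)).mul continuousOn_inv_mul_one_add).add
      ((continuousOn_logGap_rpow _).mul (ContinuousOn.div (by fun_prop) (by fun_prop) ?_))
    intro τ hτ
    have := Set.mem_Ioi.1 hτ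
    positivity
  have hαβ := hw.isC1.comp_pos hpos hκ cκ
  have e1 : ∀ P, logGap (w P) ^ (2 * p - 1) * -(w P * (1 + w P))⁻¹ =
      logGap (w P) ^ (p - 1) * -(w P * (1 + w P))⁻¹ * logGap (w P) ^ p := by
    intro P
    have := logGap_pos (hpos P)
    rw [show 2 * p - 1 = (p - 1) + p by ring, Real.rpow_add this]
    ring
  simp only [e1] at hαβ
  have key := hw.caccioppoli hab zero_le_one hm.le hm1 hM1 hψ h0 cα cβ
    (cκ.comp_continuous hw.isC1.cont hpos) hαβ fun P => by
      have h1 := logGap_pos (hpos P)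
      have h2 := hpos P
      have h3 : logGap (w P) ^ (2 * p - 1 - 1) = (logGap (w P) ^ (p - 1)) ^ 2 := by
        rw [← Real.rpow_mul_natCast h1.le]; congr 1; push_cast; ring
      have h4 : 0 ≤ logGap (w P) ^ (2 * p - 1) * ((1 + 2 * w P) / (w P * (1 + w P)) ^ 2) := by
        positivity
      have h5 : 0 ≤ (p - 1) * (logGap (w P) ^ (p - 1) * -(w P * (1 + w P))⁻¹) ^ 2 :=
        mul_nonneg (by linarith) (sq_nonneg _)
      simp only [κ, Function.comp_apply, h3]
      linarith
  set X := boxInt a t 1 (fun P => (logGap (w P) ^ (p - 1) * -(w P * (1 + w P))⁻¹) ^ 2 * ψ P ^ 2 *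
    energy ws wx wy P) with hX
  set Y := boxInt a t 1 (fun P => (logGap (w P) ^ p) ^ 2 * energy ψs ψx ψy P) with hY
  have hY0 : 0 ≤ Y := boxInt_nonneg hab zero_le_one fun s _ x _ y _ =>
    mul_nonneg (sq_nonneg _) (energy_nonneg _ _ _ _)
  have hXY : X ≤ 4 * (M / m) * Y := by
    have : 4 * (M / m) * Y = 4 * M * Y / m := by ring
    rw [this, le_div_iff₀ hm]; linarith
  have hMm : 1 ≤ M / m := by rw [le_div_iff₀ hm]; linarith
  calc _ ≤ boxInt a t 1 (fun P => 2 * p ^ 2 * ((logGap (w P) ^ (p - 1) *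
        -(w P * (1 + w P))⁻¹) ^ 2 * ψ P ^ 2 * energy ws wx wy P) +
          2 * ((logGap (w P) ^ p) ^ 2 * energy ψs ψx ψy P)) := by
        refine boxInt_mono hab zero_le_one hf.continuous_energy (by fun_prop)
          fun s _ x _ y _ => ?_
        refine (energy_mul_le _ _ _ _ _ _ _ _ _ _).trans_eq ?_
        ring
    _ = 2 * p ^ 2 * X + 2 * Y := by
        rw [boxInt_add (by fun_prop) (by fun_prop), boxInt_const_mul (2 * p ^ 2),
          boxInt_const_mul 2]
    _ ≤ 2 * p ^ 2 * (4 * (M / m) * Y) + 2 * (p ^ 2 * (M / m) * Y) := by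
        have h1 : 1 ≤ p ^ 2 * (M / m) := one_le_mul_of_one_le_of_one_le (one_le_pow₀ hp) hMm
        have h2 := mul_le_mul_of_nonneg_right h1 hY0
        have h3 := mul_le_mul_of_nonneg_left hXY (by positivity : 0 ≤ 2 * p ^ 2)
        linarith
    _ = _ := by ring

lemma bump_one_mem {s x y : ℝ} (hs : s ≤ 0) (hx : x ∈ Set.Icc (-1) 1)
    (hy : y ∈ Set.Icc (-1) 1) : bump 1 (s, x, y) ∈ Set.Icc 0 1 := by
  have hb : exp 0 = (1 : ℝ) ^ 2 := by simp
  refine ⟨bump_nonneg hb hs hx hy, (bump_le hb hs hx hy).trans_eq (by norm_num)⟩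

lemma IsSolution.boxInt_cutoff_le (ha : a ≤ 0)
    (hw : IsSolution m M A w ws wx wy) (hpos : ∀ P, 0 < w P) (hB : ∀ P, logGap (w P) ≤ B)
    (hp : 1 ≤ p) :
    boxInt a 0 1 (fun P => (logGap (w P) ^ p) ^ 2 * energy (cutoffS 1 a (3 * p - 2))
      (cutoffX 1 a (3 * p - 2)) (cutoffY 1 a (3 * p - 2)) P) ≤
      8 * (B ^ p) ^ 2 * exp a + 90 * p ^ 2 * boxInt a 0 1 (moser w p) := by
  have hb : exp 0 = (1 : ℝ) ^ 2 := by simp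
  have cβ := (continuousOn_logGap_rpow p).comp_continuous hw.isC1.cont hpos
  have cE := (isC1_cutoff 1 a (σ := 3 * p - 2) (by linarith)).continuous_energy
  have cm := continuous_moser hw.isC1.cont hpos hp
  have cap := boxInt_capacity_le 1 a 0
  have hB0 : 0 ≤ B := (logGap_pos (hpos (0, 0, 0))).le.trans (hB _)
  calc _ ≤ boxInt a 0 1 (fun P => 2 * (B ^ p) ^ 2 * (exp a ^ 2 * exp (-P.1)) +
        90 * p ^ 2 * moser w p P) := by
        refine boxInt_mono ha zero_le_one (by fun_prop) (by fun_prop) fun s hs x hx y hy => ?_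
        have h1 := energy_cutoff_le (σ := 3 * p - 2) hb hs hx hy
        obtain ⟨h2, h3⟩ := bump_one_mem hs.2 hx hy
        rw [show 3 * p - 2 - 1 = 3 * p - 3 by ring] at h1
        simp only [moser]
        have h4 := logGap_pos (hpos (s, x, y))
        have h5 := hB (s, x, y)
        set g := logGap (w (s, x, y))
        set η := bump 1 (s, x, y)
        have h6 : η ^ (3 * p - 2) ≤ 1 := Real.rpow_le_one h2 h3 (by linarith)
        have h7 : 0 ≤ η ^ (3 * p - 2) := Real.rpow_nonneg h2 _
        have h8 : g ^ p ≤ B ^ p := Real.rpow_le_rpow h4.le h5 (by linarith)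
        have h9 : (3 * p - 2) ^ 2 ≤ 9 * p ^ 2 := by nlinarith
        calc _ ≤ (g ^ p) ^ 2 * (2 * (η ^ (3 * p - 2)) ^ 2 * (exp a ^ 2 * exp (-s)) +
              10 * 1 ^ 10 * (3 * p - 2) ^ 2 * (exp s ^ 2 * (η ^ (3 * p - 3)) ^ 2)) := by gcongr
          _ = 2 * (g ^ p) ^ 2 * ((η ^ (3 * p - 2)) ^ 2 * (exp a ^ 2 * exp (-s))) +
              10 * (3 * p - 2) ^ 2 * (exp s ^ 2 * (g ^ p * η ^ (3 * p - 3)) ^ 2) := by ring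
          _ ≤ 2 * (B ^ p) ^ 2 * (1 ^ 2 * (exp a ^ 2 * exp (-s))) +
              10 * (9 * p ^ 2) * (exp s ^ 2 * (g ^ p * η ^ (3 * p - 3)) ^ 2) := by gcongr
          _ = _ := by ring
    _ = 2 * (B ^ p) ^ 2 * boxInt a 0 1 (fun P => exp a ^ 2 * exp (-P.1)) +
        90 * p ^ 2 * boxInt a 0 1 (moser w p) := by
        rw [boxInt_add (by fun_prop) (by fun_prop), boxInt_const_mul (2 * (B ^ p) ^ 2),
          boxInt_const_mul (90 * p ^ 2)]
    _ ≤ 2 * (B ^ p) ^ 2 * (4 * 1 ^ 2 * exp a) + 90 * p ^ 2 * boxInt a 0 1 (moser w p) := by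
        gcongr
    _ = _ := by ring

lemma moser_le_cutoff {s x y : ℝ} (hpos : 0 < w (s, x, y)) (hat : a ≤ t - 1)
    (hs : s ∈ Set.Icc t 0) (hx : x ∈ Set.Icc (-1) 1) (hy : y ∈ Set.Icc (-1) 1) :
    moser w (3 / 2 * p) (s, x, y) ≤ 8 * (exp s ^ 2 *
      |logGap (w (s, x, y)) ^ p * cutoff 1 a (3 * p - 2) (s, x, y)| ^ 3) := by
  have h1 : 1 / 2 ≤ 1 - exp (a - s) := by
    have h2 : exp (a - s) ≤ exp (-1) := exp_le_exp.2 (by linarith [hs.1])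
    have h3 : exp (-1) * exp 1 = 1 := by rw [← exp_add]; simp
    have h4 : (2 : ℝ) ≤ exp 1 := by linarith [Real.add_one_le_exp (1 : ℝ)]
    nlinarith [exp_pos (-1)]
  obtain ⟨h2, -⟩ := bump_one_mem hs.2 hx hy
  have h4 := logGap_pos hpos
  simp only [moser, cutoff]
  set g := logGap (w (s, x, y))
  set η := bump 1 (s, x, y)
  set c := 1 - exp (a - s)
  have e1 : (g ^ (3 / 2 * p)) ^ 2 = (g ^ p) ^ 3 := by
    rw [← Real.rpow_mul_natCast h4.le, ← Real.rpow_mul_natCast h4.le]; congr 1; push_cast; ring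
  have e2 : (η ^ (3 * (3 / 2 * p) - 3)) ^ 2 = (η ^ (3 * p - 2)) ^ 3 := by
    rw [← Real.rpow_mul_natCast h2, ← Real.rpow_mul_natCast h2]; congr 1; push_cast; ring
  rw [abs_of_nonneg (by positivity)]
  calc exp s ^ 2 * (g ^ (3 / 2 * p) * η ^ (3 * (3 / 2 * p) - 3)) ^ 2
      = 8 * (exp s ^ 2 * (g ^ p * (1 / 2 * η ^ (3 * p - 2))) ^ 3) := by
        rw [mul_pow, e1, e2]; ring
    _ ≤ _ := by gcongr

lemma IsSolution.moser_step (hm : 0 < m) (hm1 : m ≤ 1) (hM1 : 1 ≤ M)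
    (hw : IsSolution m M A w ws wx wy) (hpos : ∀ P, 0 < w P) (hB : ∀ P, logGap (w P) ≤ B)
    (hp : 1 ≤ p) (hN : ∀ t ≤ -1, boxInt t 0 1 (moser w p) ≤ N) (ht : t ≤ -1) :
    boxInt t 0 1 (moser w (3 / 2 * p)) ^ 2 ≤ (32400 * (M / m) * p ^ 4 * N) ^ 3 := by
  have hb : exp 0 = (1 : ℝ) ^ 2 := by simp
  have hσ : 1 ≤ 3 * p - 2 := by linarith
  have ht0 : t ≤ 0 := by linarith
  have hMm : 0 ≤ M / m := by positivity
  have cβ := (continuousOn_logGap_rpow p).comp_continuous hw.isC1.cont hpos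
  have cm := continuous_moser hw.isC1.cont hpos (p := 3 / 2 * p) (by linarith)
  have bound : ∀ a ≤ t - 1, boxInt t 0 1 (moser w (3 / 2 * p)) ^ 2 ≤
      (360 * p ^ 2 * (M / m) * (8 * (B ^ p) ^ 2 * exp a + 90 * p ^ 2 * N)) ^ 3 := by
    intro a ha
    have ha0 : a ≤ 0 := by linarith
    have hψ := isC1_cutoff 1 a hσ
    have cψ := hψ.cont
    obtain ⟨fs, fx, fy, hf, hE⟩ := hw.energy_logGap_rpow_le ha0 hm hm1 hM1 hpos hψ
      (vanishesOnBoundary_cutoff hσ hb) hp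
    have hs := sobolev ha0 zero_le_one hf ((vanishesOnBoundary_cutoff hσ hb).mul_left _)
    have hI := hw.boxInt_cutoff_le ha0 hpos hB hp
    have hE0 : 0 ≤ boxInt a 0 1 (energy fs fx fy) :=
      boxInt_nonneg ha0 zero_le_one fun s _ x _ y _ => energy_nonneg _ _ _ _
    have h1 : boxInt t 0 1 (moser w (3 / 2 * p)) ≤ 8 * boxInt a 0 1 (fun P => exp P.1 ^ 2 *
        |logGap (w P) ^ p * cutoff 1 a (3 * p - 2) P| ^ 3) := by
      rw [← boxInt_const_mul]
      calc _ ≤ boxInt t 0 1 (fun P => 8 * (exp P.1 ^ 2 *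
            |logGap (w P) ^ p * cutoff 1 a (3 * p - 2) P| ^ 3)) :=
            boxInt_mono ht0 zero_le_one cm (by fun_prop) fun s hs x hx y hy =>
              moser_le_cutoff (hpos _) ha hs hx hy
        _ ≤ _ := boxInt_mono_box (by linarith) ht0 le_rfl zero_le_one le_rfl (by fun_prop)
            fun s _ x _ y _ => by positivity
    have h2 : 0 ≤ boxInt t 0 1 (moser w (3 / 2 * p)) :=
      boxInt_nonneg ht0 zero_le_one fun s _ x _ y _ => by unfold moser; positivity
    calc _ ≤ (8 * boxInt a 0 1 (fun P => exp P.1 ^ 2 *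
          |logGap (w P) ^ p * cutoff 1 a (3 * p - 2) P| ^ 3)) ^ 2 := by gcongr
      _ = 64 * boxInt a 0 1 (fun P => exp P.1 ^ 2 *
          |logGap (w P) ^ p * cutoff 1 a (3 * p - 2) P| ^ 3) ^ 2 := by ring
      _ ≤ 64 * (9 * boxInt a 0 1 (energy fs fx fy)) ^ 3 := by gcongr
      _ = (36 * boxInt a 0 1 (energy fs fx fy)) ^ 3 := by ring
      _ ≤ (36 * (10 * p ^ 2 * (M / m) * (8 * (B ^ p) ^ 2 * exp a + 90 * p ^ 2 * N))) ^ 3 := by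
          gcongr
          refine hE.trans ?_
          gcongr
          refine hI.trans ?_
          gcongr
          exact hN a (by linarith)
      _ = _ := by ring
  have lim : Filter.Tendsto (fun a => (360 * p ^ 2 * (M / m) *
      (8 * (B ^ p) ^ 2 * exp a + 90 * p ^ 2 * N)) ^ 3) Filter.atBot
      (nhds ((360 * p ^ 2 * (M / m) * (8 * (B ^ p) ^ 2 * 0 + 90 * p ^ 2 * N)) ^ 3)) :=
    (((Real.tendsto_exp_atBot.const_mul _).add_const _).const_mul _).pow 3
  refine (ge_of_tendsto lim (Filter.eventually_atBot.2 ⟨t - 1, bound⟩)).trans_eq ?_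
  ring

end Moser

section MoserIteration

variable {m M t B N : ℝ} {A w ws wx wy : ℝ × ℝ × ℝ → ℝ}

lemma IsSolution.moser_iterate (hm : 0 < m) (hm1 : m ≤ 1) (hM1 : 1 ≤ M)
    (hw : IsSolution m M A w ws wx wy) (hpos : ∀ P, 0 < w P) (hB : ∀ P, logGap (w P) ≤ B)
    (hN : ∀ t ≤ -1, boxInt t 0 1 (moser w 1) ≤ N) {K : ℝ}
    (hK : K = (32400 * (M / m)) ^ 3 * (81 / 16) ^ 6) (k : ℕ) :
    ∀ t ≤ -1, K * ((81 / 16) ^ 3) ^ k * boxInt t 0 1 (moser w ((3 / 2) ^ k)) ≤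
      (K * N) ^ ((3 / 2 : ℝ) ^ k) := by
  have hC : 0 < 32400 * (M / m) := by positivity
  set C := 32400 * (M / m) with hCdef
  have hK0 : 0 < K := by rw [hK]; positivity
  have hI : ∀ (k : ℕ), ∀ t ≤ (-1 : ℝ), 0 ≤ boxInt t 0 1 (moser w ((3 / 2) ^ k)) := fun k t ht =>
    boxInt_nonneg (by linarith) zero_le_one fun s _ x _ y _ => by unfold moser; positivity
  have hN0 : 0 ≤ N := by
    have h1 := hI 0 (-1) le_rfl
    rw [pow_zero] at h1
    exact h1.trans (hN (-1) le_rfl)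
  have hKN : 0 ≤ K * N := by positivity
  induction k with
  | zero =>
    intro t ht
    simp only [pow_zero, mul_one, Real.rpow_one]
    exact mul_le_mul_of_nonneg_left (hN t ht) hK0.le
  | succ k ih =>
    intro t ht
    set L := (K * N) ^ ((3 / 2 : ℝ) ^ k) with hL
    have hL0 : 0 ≤ L := Real.rpow_nonneg hKN _
    set Q : ℝ := ((81 / 16) ^ 3) ^ k with hQ
    have hQ0 : 0 < Q := by positivity
    have h1 : ∀ t ≤ (-1 : ℝ), boxInt t 0 1 (moser w ((3 / 2) ^ k)) ≤ L / (K * Q) := by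
      intro t ht
      rw [le_div_iff₀ (by positivity)]
      linarith [ih t ht]
    have h2 := hw.moser_step hm hm1 hM1 hpos hB (one_le_pow₀ (by norm_num : (1 : ℝ) ≤ 3 / 2))
      h1 ht
    rw [← hCdef, ← pow_succ'] at h2
    have e1 : ((3 / 2 : ℝ) ^ k) ^ 4 = (81 / 16) ^ k := by
      rw [← pow_mul, mul_comm, pow_mul]; norm_num
    have e2 : Q = ((81 / 16) ^ k) ^ 3 := by rw [hQ, ← pow_mul, ← pow_mul, mul_comm]
    rw [e1] at h2
    have hR : 0 ≤ (K * N) ^ ((3 / 2 : ℝ) ^ (k + 1)) := Real.rpow_nonneg hKN _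
    have e3 : ((K * N) ^ ((3 / 2 : ℝ) ^ (k + 1))) ^ 2 = L ^ 3 := by
      rw [hL, ← Real.rpow_mul_natCast hKN, ← Real.rpow_mul_natCast hKN]
      congr 1; push_cast; ring
    refine le_of_sq_le_sq ?_ hR
    rw [e3, pow_succ _ k, ← hQ]
    calc (K * (Q * (81 / 16) ^ 3) * boxInt t 0 1 (moser w ((3 / 2) ^ (k + 1)))) ^ 2
        = (K * (Q * (81 / 16) ^ 3)) ^ 2 * boxInt t 0 1 (moser w ((3 / 2) ^ (k + 1))) ^ 2 := by
          ring
      _ ≤ (K * (Q * (81 / 16) ^ 3)) ^ 2 * (C * (81 / 16) ^ k * (L / (K * Q))) ^ 3 := by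
          gcongr
      _ = L ^ 3 := by
          have : (C * (81 / 16) ^ k * (L / (K * Q))) ^ 3 = C ^ 3 * Q * L ^ 3 / (K * Q) ^ 3 := by
            rw [e2]; ring
          rw [this]
          field_simp
          rw [hK]
          ring

/-- The constant in the pointwise bound for solutions that are not small on a fixed set. -/
def moserConst (m M : ℝ) : ℝ :=
  (32400 * (M / m)) ^ 3 * (81 / 16) ^ 6 * (100000000000 * (M / m))

lemma IsSolution.logGap_le (hm : 0 < m) (hm1 : m ≤ 1) (hM1 : 1 ≤ M)
    (hw : IsSolution m M A w ws wx wy) (hpos : ∀ P, 0 < w P) (hB : ∀ P, logGap (w P) ≤ B)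
    (hw2 : ∀ P, w P ≤ 2) (hθ : 1 ≤ boxInt (-1) 0 1 (fun P => max (w P - 1 / 4) 0))
    {s x y : ℝ} (hs : s ≤ 0) (hx : x ∈ Set.Icc (-1) 1) (hy : y ∈ Set.Icc (-1) 1) :
    (logGap (w (s, x, y)) * bump 1 (s, x, y) ^ 3) ^ 2 ≤ moserConst m M := by
  by_contra! hlt
  have hMm : 0 < M / m := by positivity
  have hit := fun k => hw.moser_iterate hm hm1 hM1 hpos hB (N := 100000000000 * (M / m))
    (fun t ht => by
      have h := hw.boxInt_log_sq_le hm hm1 hM1 hpos hw2 hθ ht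
      have e : moser w 1 = fun p => exp p.1 ^ 2 * (log (1 + w p) - log (w p)) ^ 2 := by
        funext P; norm_num [moser, logGap]
      rwa [e]) rfl k (min s (-1)) (min_le_right _ _)
  change ∀ k : ℕ, _ ≤ moserConst m M ^ ((3 / 2 : ℝ) ^ k) at hit
  set D := moserConst m M
  have hD : 0 < D := by simp only [D, moserConst]; positivity
  set T := min s (-1)
  have hT : T < 0 := (min_le_right _ _).trans_lt (by norm_num)
  have cg := continuousOn_logGap.comp_continuous hw.isC1.cont hpos
  have cb := continuous_bump 1
  set κ := boxInt T 0 1 (fun P => exp P.1 ^ 2 *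
    max ((logGap (w P) * bump 1 P ^ 3) ^ 2 / D - 1) 0)
  have hκ : 0 < κ := by
    refine boxInt_pos hT one_pos (by fun_prop) (fun s _ x _ y _ => by positivity)
      (s := s) (x := x) (y := y) ⟨min_le_left _ _, hs⟩ hx hy ?_
    have : 1 < (logGap (w (s, x, y)) * bump 1 (s, x, y) ^ 3) ^ 2 / D := (one_lt_div hD).2 hlt
    exact mul_pos (by positivity) (lt_max_of_lt_left (by linarith))
  have lower : ∀ p : ℝ, 1 ≤ p → D ^ p * p * κ ≤ boxInt T 0 1 (moser w p) := by
    intro p hp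
    rw [← boxInt_const_mul]
    refine boxInt_mono hT.le zero_le_one (by fun_prop) (continuous_moser hw.isC1.cont hpos hp)
      fun s hs x hx y hy => ?_
    obtain ⟨h2, h3⟩ := bump_one_mem hs.2 hx hy
    have h4 := logGap_pos (hpos (s, x, y))
    simp only [moser]
    set g := logGap (w (s, x, y))
    set η := bump 1 (s, x, y)
    have h5 : (g * η ^ 3) ^ (2 * p) ≤ (g ^ p * η ^ (3 * p - 3)) ^ 2 := by
      have e1 : (g * η ^ 3) ^ (2 * p) = (g ^ p * η ^ (3 * p)) ^ 2 := by
        rw [mul_comm 2 p, Real.rpow_mul (by positivity), Real.mul_rpow h4.le (by positivity),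
          ← Real.rpow_natCast_mul h2]
        norm_cast
      rw [e1]
      have : η ^ (3 * p) ≤ η ^ (3 * p - 3) := by
        rcases h2.eq_or_lt with h | h
        · rw [← h, Real.zero_rpow (by linarith)]; exact Real.rpow_nonneg le_rfl _
        · exact Real.rpow_le_rpow_of_exponent_ge h h3 (by linarith)
      gcongr
    have h6 : D ^ p * (p * max ((g * η ^ 3) ^ 2 / D - 1) 0) ≤ (g * η ^ 3) ^ (2 * p) := by
      rcases le_total ((g * η ^ 3) ^ 2 / D - 1) 0 with h | h
      · rw [max_eq_right h]; simp only [mul_zero]; positivity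
      rw [max_eq_left h]
      have h7 := one_add_mul_self_le_rpow_one_add (by linarith : -1 ≤ (g * η ^ 3) ^ 2 / D - 1) hp
      rw [add_sub_cancel, Real.div_rpow (by positivity) hD.le,
        ← Real.rpow_natCast_mul (by positivity)] at h7
      have hDp : 0 < D ^ p := Real.rpow_pos_of_pos hD p
      rw [le_div_iff₀ hDp] at h7
      push_cast at h7
      linarith
    calc _ = exp s ^ 2 * (D ^ p * (p * max ((g * η ^ 3) ^ 2 / D - 1) 0)) := by ring
      _ ≤ _ := by gcongr; exact h6.trans h5
  set K := (32400 * (M / m)) ^ 3 * (81 / 16) ^ 6 with hK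
  have hK0 : 0 < K := by positivity
  have bound : ∀ k : ℕ, (3 / 2 : ℝ) ^ k ≤ 1 / (K * κ) := by
    intro k
    have h1 := lower ((3 / 2) ^ k) (one_le_pow₀ (by norm_num))
    have h2 := hit k
    have h3 : 0 < D ^ ((3 / 2 : ℝ) ^ k) := Real.rpow_pos_of_pos hD _
    have h4 : (1 : ℝ) ≤ ((81 / 16) ^ 3) ^ k := one_le_pow₀ (by norm_num)
    have h5 : 0 ≤ D ^ ((3 / 2 : ℝ) ^ k) * (3 / 2) ^ k * κ := by positivity
    rw [le_div_iff₀ (by positivity)]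
    have h6 : D ^ ((3 / 2 : ℝ) ^ k) * ((3 / 2) ^ k * (K * κ)) ≤ D ^ ((3 / 2 : ℝ) ^ k) * 1 := by
      calc _ = K * 1 * (D ^ ((3 / 2 : ℝ) ^ k) * (3 / 2) ^ k * κ) := by ring
        _ ≤ K * ((81 / 16) ^ 3) ^ k * boxInt T 0 1 (moser w ((3 / 2) ^ k)) := by gcongr
        _ ≤ _ := by rw [mul_one]; exact h2
    exact le_of_mul_le_mul_left h6 h3
  obtain ⟨k, hk⟩ := pow_unbounded_of_one_lt (1 / (K * κ)) (by norm_num : (1 : ℝ) < 3 / 2)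
  exact absurd (bound k) (not_le.2 hk)

end MoserIteration

/-! ### The Liouville theorem for bounded solutions -/

section Liouville

variable {m M : ℝ} {A w ws wx wy : ℝ × ℝ × ℝ → ℝ}

lemma IsSolution.affine (hw : IsSolution m M A w ws wx wy) (c d : ℝ) :
    IsSolution m M A (fun p => c * w p + d) (fun p => c * ws p) (fun p => c * wx p)
      (fun p => c * wy p) where
  isC1 :=
    { cont := (hw.isC1.cont.const_mul c).add_const d
      cont_s := hw.isC1.cont_s.const_mul c
      cont_x := hw.isC1.cont_x.const_mul c
      cont_y := hw.isC1.cont_y.const_mul c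
      deriv_s := fun s x y => ((hw.isC1.deriv_s s x y).const_mul c).add_const d
      deriv_x := fun s x y => ((hw.isC1.deriv_x s x y).const_mul c).add_const d
      deriv_y := fun s x y => ((hw.isC1.deriv_y s x y).const_mul c).add_const d }
  cont_A := hw.cont_A
  lower := hw.lower
  upper := hw.upper
  eqn := by
    obtain ⟨F, G, H, cF, cG, cH, hF, hG, hH, he⟩ := hw.eqn
    refine ⟨fun p => c * F p, fun p => c * G p, fun p => c * H p, cF.const_mul c, cG.const_mul c,
      cH.const_mul c, fun s x y => ?_, fun s x y => (hG s x y).const_mul c,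
      fun s x y => (hH s x y).const_mul c, fun p => by linear_combination c * he p⟩
    refine ((hF s x y).const_mul c).congr_of_eventuallyEq (Filter.Eventually.of_forall fun t => ?_)
    ring

/-- The scaling under which the equation is invariant. -/
def dilate (r : ℝ) (p : ℝ × ℝ × ℝ) : ℝ × ℝ × ℝ := (p.1 + 2 * r, exp r * p.2.1, exp r * p.2.2)

lemma continuous_dilate (r : ℝ) : Continuous (dilate r) := by unfold dilate; fun_prop

lemma hasDerivAt_comp_const_mul {f : ℝ → ℝ} {f' c x : ℝ} (h : HasDerivAt f f' (c * x)) :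
    HasDerivAt (fun t => f (c * t)) (c * f') x := by
  have h1 : HasDerivAt (fun t => c * t) c x := by simpa using (hasDerivAt_id x).const_mul c
  exact (HasDerivAt.comp x h h1).congr_deriv (by ring)

lemma IsSolution.comp_dilate (hw : IsSolution m M A w ws wx wy) (r : ℝ) :
    IsSolution m M (fun p => A (dilate r p)) (fun p => w (dilate r p)) (fun p => ws (dilate r p))
      (fun p => exp r * wx (dilate r p)) (fun p => exp r * wy (dilate r p)) where
  isC1 :=
    { cont := hw.isC1.cont.comp (continuous_dilate r)
      cont_s := hw.isC1.cont_s.comp (continuous_dilate r)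
      cont_x := (hw.isC1.cont_x.comp (continuous_dilate r)).const_mul _
      cont_y := (hw.isC1.cont_y.comp (continuous_dilate r)).const_mul _
      deriv_s := fun s x y =>
        (hw.isC1.deriv_s (s + 2 * r) (exp r * x) (exp r * y)).comp_add_const s (2 * r)
      deriv_x := fun s x y => hasDerivAt_comp_const_mul
        (hw.isC1.deriv_x (s + 2 * r) (exp r * x) (exp r * y))
      deriv_y := fun s x y => hasDerivAt_comp_const_mul
        (hw.isC1.deriv_y (s + 2 * r) (exp r * x) (exp r * y)) }
  cont_A := hw.cont_A.comp (continuous_dilate r)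
  lower p := hw.lower _
  upper p := hw.upper _
  eqn := by
    obtain ⟨F, G, H, cF, cG, cH, hF, hG, hH, he⟩ := hw.eqn
    have cd := continuous_dilate r
    have h1 : exp r * exp (-r) = 1 := by rw [← exp_add]; simp
    refine ⟨fun p => exp (-r) ^ 2 * F (dilate r p),
      fun p => exp r * (exp r * G (dilate r p)),
      fun p => exp r * (exp r * H (dilate r p)),
      by fun_prop, by fun_prop, by fun_prop, fun s x y => ?_, fun s x y => ?_, fun s x y => ?_,
      fun p => ?_⟩
    · have h := ((hF (s + 2 * r) (exp r * x) (exp r * y)).comp_add_const s (2 * r)).const_mul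
        (exp (-r) ^ 2)
      refine h.congr_of_eventuallyEq (Filter.Eventually.of_forall fun t => ?_)
      have e : exp (t + 2 * r) = exp t * exp r ^ 2 := by
        rw [exp_add, ← Real.exp_nat_mul]; norm_cast
      simp only [dilate, e]
      linear_combination (-exp t * A (t + 2 * r, exp r * x, exp r * y) *
        ws (t + 2 * r, exp r * x, exp r * y) * (exp r * exp (-r) + 1)) * h1
    · exact (hasDerivAt_comp_const_mul (hG (s + 2 * r) (exp r * x) (exp r * y))).const_mul (exp r)
    · exact (hasDerivAt_comp_const_mul (hH (s + 2 * r) (exp r * x) (exp r * y))).const_mul (exp r)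
    · have h2 := he (dilate r p)
      have e : exp (p.1 + 2 * r) = exp p.1 * exp r ^ 2 := by
        rw [exp_add, ← Real.exp_nat_mul]; norm_cast
      simp only [dilate, e] at h2 ⊢
      linear_combination exp (-r) ^ 2 * h2 - exp p.1 ^ 2 * exp r ^ 2 * (exp r * exp (-r) + 1) *
        (G (p.1 + 2 * r, exp r * p.2.1, exp r * p.2.2) +
          H (p.1 + 2 * r, exp r * p.2.1, exp r * p.2.2)) * h1

/-- The region on which nonnegative solutions are bounded below. -/
def core : Set (ℝ × ℝ × ℝ) :=
  {p | p.1 ≤ 0 ∧ p.2.1 ∈ Set.Icc (-1) 1 ∧ p.2.2 ∈ Set.Icc (-1) 1 ∧ 1 / 2 ≤ bump 1 p}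

/-- The lower bound for nonnegative solutions that are not small on a fixed set. -/
def growthConst (m M : ℝ) : ℝ := exp (-(8 * √(moserConst m M)))

lemma IsSolution.growthConst_le (hm : 0 < m) (hm1 : m ≤ 1) (hM1 : 1 ≤ M)
    (hw : IsSolution m M A w ws wx wy) (h0 : ∀ P, 0 ≤ w P) (h1 : ∀ P, w P ≤ 1)
    (hθ : 1 ≤ boxInt (-1) 0 1 (fun P => max (w P - 1 / 4) 0)) {P : ℝ × ℝ × ℝ} (hP : P ∈ core) :
    growthConst m M ≤ w P := by
  have key : ∀ ε, 0 < ε → ε ≤ 1 → growthConst m M ≤ w P + ε := by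
    intro ε hε hε1
    have hwε : IsSolution m M A (fun P => w P + ε) ws wx wy := by
      simpa only [one_mul] using hw.affine 1 ε
    have hpos : ∀ P, 0 < w P + ε := fun P => by linarith [h0 P]
    have cw := hw.isC1.cont
    obtain ⟨s, x, y⟩ := P
    obtain ⟨hs, hx, hy, hb⟩ := hP
    have h2 := hwε.logGap_le (B := log 3 - log ε) hm hm1 hM1 hpos
      (fun P => sub_le_sub (Real.log_le_log (by linarith [h0 P]) (by linarith [h1 P]))
        (Real.log_le_log hε (by linarith [h0 P])))
      (fun P => by linarith [h1 P])
      (hθ.trans (boxInt_mono (by norm_num) zero_le_one (by fun_prop) (by fun_prop)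
        fun s _ x _ y _ => max_le_max (by linarith) le_rfl)) hs hx hy
    have h3 := logGap_pos (hpos (s, x, y))
    have h4 := Real.le_sqrt_of_sq_le h2
    have h5 : (1 / 2 : ℝ) ^ 3 ≤ bump 1 (s, x, y) ^ 3 := by gcongr
    have h6 : logGap (w (s, x, y) + ε) ≤ 8 * √(moserConst m M) := by
      have := mul_le_mul_of_nonneg_left h5 h3.le
      linarith
    have h7 : 0 ≤ log (1 + (w (s, x, y) + ε)) := Real.log_nonneg (by linarith [h0 (s, x, y)])
    have h8 : -(8 * √(moserConst m M)) ≤ log (w (s, x, y) + ε) := by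
      simp only [logGap] at h6
      linarith
    exact (Real.le_log_iff_exp_le (hpos _)).1 h8
  refine le_of_forall_pos_le_add fun ε hε => ?_
  exact (key (min ε 1) (lt_min hε one_pos) (min_le_right _ _)).trans
    (by linarith [min_le_left ε 1])

lemma IsSolution.dichotomy (hm : 0 < m) (hm1 : m ≤ 1) (hM1 : 1 ≤ M)
    (hw : IsSolution m M A w ws wx wy) (h0 : ∀ P, 0 ≤ w P) (h1 : ∀ P, w P ≤ 1) :
    (∀ P ∈ core, growthConst m M ≤ w P) ∨ (∀ P ∈ core, growthConst m M ≤ 1 - w P) := by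
  have cw := hw.isC1.cont
  have hw' : IsSolution m M A (fun P => 1 - w P) (fun P => -1 * ws P) (fun P => -1 * wx P)
      (fun P => -1 * wy P) := by
    have h := hw.affine (-1) 1
    have e : (fun P => 1 - w P) = fun P => -1 * w P + 1 := by ext P; ring
    rwa [e]
  have sum : 2 ≤ boxInt (-1) 0 1 (fun P => max (w P - 1 / 4) 0) +
      boxInt (-1) 0 1 (fun P => max (1 - w P - 1 / 4) 0) := by
    rw [← boxInt_add (by fun_prop) (by fun_prop)]
    calc (2 : ℝ) = boxInt (-1) 0 1 (fun _ => 1 / 2) := by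
          simp only [boxInt, integral_const, smul_eq_mul]; norm_num
      _ ≤ _ := by
          refine boxInt_mono (by norm_num) zero_le_one (by fun_prop) (by fun_prop)
            fun s _ x _ y _ => ?_
          linarith [le_max_left (w (s, x, y) - 1 / 4) 0, le_max_left (1 - w (s, x, y) - 1 / 4) 0]
  rcases le_or_gt 1 (boxInt (-1) 0 1 (fun P => max (w P - 1 / 4) 0)) with h | h
  · exact Or.inl fun P hP => hw.growthConst_le hm hm1 hM1 h0 h1 h hP
  · refine Or.inr fun P hP => hw'.growthConst_le hm hm1 hM1 (fun P => by linarith [h1 P])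
      (fun P => by linarith [h0 P]) (by linarith) hP

lemma eventually_mem_dilate_core (P : ℝ × ℝ × ℝ) :
    ∀ᶠ r in Filter.atTop, ∃ Q ∈ core, dilate r Q = P := by
  obtain ⟨s, x, y⟩ := P
  have hr : Filter.Tendsto (fun r => exp (-r)) Filter.atTop (nhds 0) :=
    Real.tendsto_exp_neg_atTop_nhds_zero
  have lim : ∀ z : ℝ, Filter.Tendsto (fun r => exp (-r) * z) Filter.atTop (nhds 0) := fun z => by
    simpa using hr.mul_const z
  have hs : Filter.Tendsto (fun r => exp (s - 2 * r)) Filter.atTop (nhds 0) := by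
    have e : (fun r => exp (s - 2 * r)) = fun r => exp s * exp (-r) ^ 2 := by
      ext r; rw [← Real.exp_nat_mul, ← exp_add]; congr 1; push_cast; ring
    rw [e]
    simpa using (hr.pow 2).const_mul (exp s)
  have hb : Filter.Tendsto (fun r => bump 1 (s - 2 * r, exp (-r) * x, exp (-r) * y)) Filter.atTop
      (nhds 1) := by
    have := (hs.const_sub (1 ^ 2)).mul ((((lim x).pow 2).const_sub (1 ^ 2)).mul
      (((lim y).pow 2).const_sub (1 ^ 2)))
    simpa [bump] using this
  have near : ∀ z : ℝ, ∀ᶠ r in Filter.atTop, exp (-r) * z ∈ Set.Icc (-1 : ℝ) 1 := fun z =>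
    (lim z).eventually (Icc_mem_nhds (by norm_num) (by norm_num))
  filter_upwards [Filter.eventually_ge_atTop (s / 2), near x, near y,
    hb.eventually (lt_mem_nhds (by norm_num : (1 / 2 : ℝ) < 1))] with r h1 h2 h3 h4
  have he : exp r * exp (-r) = 1 := by rw [← exp_add]; simp
  refine ⟨(s - 2 * r, exp (-r) * x, exp (-r) * y), ⟨?_, h2, h3, h4.le⟩, ?_⟩
  · simp only; linarith
  · simp only [dilate, ← mul_assoc, he, one_mul, sub_add_cancel]

lemma IsSolution.global_dichotomy (hm : 0 < m) (hm1 : m ≤ 1) (hM1 : 1 ≤ M)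
    (hw : IsSolution m M A w ws wx wy) (h0 : ∀ P, 0 ≤ w P) (h1 : ∀ P, w P ≤ 1) :
    (∀ P, growthConst m M ≤ w P) ∨ (∀ P, growthConst m M ≤ 1 - w P) := by
  by_contra! h
  obtain ⟨⟨P, hP⟩, ⟨P', hP'⟩⟩ := h
  obtain ⟨r, ⟨Q, hQ, rfl⟩, ⟨Q', hQ', rfl⟩⟩ :=
    ((eventually_mem_dilate_core P).and (eventually_mem_dilate_core P')).exists
  rcases (hw.comp_dilate r).dichotomy hm hm1 hM1 (fun _ => h0 _) (fun _ => h1 _) with h | h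
  · linarith [h Q hQ]
  · linarith [h Q' hQ']

/-- Bounded entire solutions are constant. -/
theorem IsSolution.eq_of_bounded (hm : 0 < m) (hm1 : m ≤ 1) (hM1 : 1 ≤ M)
    (hw : IsSolution m M A w ws wx wy) {K : ℝ} (hK : ∀ P, |w P| ≤ K) (P Q : ℝ × ℝ × ℝ) :
    w P = w Q := by
  have hbb : BddBelow (Set.range w) := ⟨-K, by rintro _ ⟨P, rfl⟩; exact (abs_le.1 (hK P)).1⟩
  have hba : BddAbove (Set.range w) := ⟨K, by rintro _ ⟨P, rfl⟩; exact (abs_le.1 (hK P)).2⟩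
  set i := ⨅ P, w P
  set S := ⨆ P, w P
  have hi : ∀ P, i ≤ w P := ciInf_le hbb
  have hS : ∀ P, w P ≤ S := le_ciSup hba
  rcases le_or_gt S i with h | h
  · linarith [hi P, hS P, hi Q, hS Q]
  exfalso
  have hd : 0 < S - i := sub_pos.2 h
  have hc : 0 < growthConst m M := exp_pos _
  have e : ∀ P, (S - i)⁻¹ * w P + -(S - i)⁻¹ * i = (w P - i) / (S - i) := fun P => by
    field_simp; ring
  have h2 := (hw.affine (S - i)⁻¹ (-(S - i)⁻¹ * i)).global_dichotomy hm hm1 hM1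
    (fun P => by rw [e]; exact div_nonneg (by linarith [hi P]) hd.le)
    (fun P => by rw [e, div_le_one hd]; linarith [hS P])
  simp only [e] at h2
  rcases h2 with h2 | h2
  · have : i + growthConst m M * (S - i) ≤ i := le_ciInf fun P => by
      have := (le_div_iff₀ hd).1 (h2 P)
      linarith
    nlinarith
  · have : S ≤ S - growthConst m M * (S - i) := ciSup_le fun P => by
      have h3 := h2 P
      rw [le_sub_comm, div_le_iff₀ hd] at h3
      linarith
    nlinarith

end Liouville

/-! ### Reduction of the Toda equation -/

lemma isC1_of_contDiff {f : ℝ × ℝ × ℝ → ℝ} (hf : ContDiff ℝ 1 f) :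
    IsC1 f (fun P => fderiv ℝ f P (1, 0, 0)) (fun P => fderiv ℝ f P (0, 1, 0))
      (fun P => fderiv ℝ f P (0, 0, 1)) := by
  have hd : ∀ P, HasFDerivAt f (fderiv ℝ f P) P := fun P =>
    (hf.differentiable one_ne_zero P).hasFDerivAt
  have hc : ∀ v, Continuous fun P => fderiv ℝ f P v := fun v =>
    (hf.continuous_fderiv one_ne_zero).clm_apply continuous_const
  refine ⟨hf.continuous, hc _, hc _, hc _, fun s x y => ?_, fun s x y => ?_, fun s x y => ?_⟩
  · exact (hd (s, x, y)).comp_hasDerivAt s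
      ((hasDerivAt_id' s).prodMk ((hasDerivAt_const s x).prodMk (hasDerivAt_const s y)))
  · exact (hd (s, x, y)).comp_hasDerivAt x
      ((hasDerivAt_const x s).prodMk ((hasDerivAt_id' x).prodMk (hasDerivAt_const x y)))
  · exact (hd (s, x, y)).comp_hasDerivAt y
      ((hasDerivAt_const y s).prodMk ((hasDerivAt_const y x).prodMk (hasDerivAt_id' y)))

lemma ContDiff.fderiv_apply_const {f : ℝ × ℝ × ℝ → ℝ} (hf : ContDiff ℝ 2 f) (v : ℝ × ℝ × ℝ) :
    ContDiff ℝ 1 fun P => fderiv ℝ f P v :=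
  (hf.fderiv_right (by norm_num)).clm_apply contDiff_const

section Toda

variable {u : ℝ → ℝ → ℝ → ℝ}

lemma deriv_deriv_exp_comp_log {A K : ℝ → ℝ} {F s : ℝ} {w : ℝ → ℝ}
    (hA : ∀ s, HasDerivAt A (A s * w s) s) (hK : ∀ s, K s = exp s * A s * w s)
    (hF : HasDerivAt K F s) {E : ℝ → ℝ} (hE : ∀ ζ, 0 < ζ → E ζ = ζ * A (log ζ)) :
    deriv (deriv E) (exp s) = exp (-s) ^ 2 * F := by
  have hinv : ∀ s, exp s * exp (-s) = 1 := fun s => by rw [← exp_add]; simp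
  have h1 : ∀ ζ, 0 < ζ → deriv E ζ = A (log ζ) + exp (-log ζ) * K (log ζ) := by
    intro ζ hζ
    have hd : HasDerivAt (fun ζ => ζ * A (log ζ)) (1 * A (log ζ) +
        ζ * (A (log ζ) * w (log ζ) * ζ⁻¹)) ζ :=
      (hasDerivAt_id' ζ).mul ((hA (log ζ)).comp ζ (Real.hasDerivAt_log hζ.ne'))
    have he : E =ᶠ[nhds ζ] fun ζ => ζ * A (log ζ) := by
      filter_upwards [lt_mem_nhds hζ] with z hz using hE z hz
    rw [he.deriv_eq, hd.deriv, hK]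
    have h2 : ζ * ζ⁻¹ = 1 := mul_inv_cancel₀ hζ.ne'
    linear_combination A (log ζ) * w (log ζ) * h2 - A (log ζ) * w (log ζ) * hinv (log ζ)
  have he : deriv E =ᶠ[nhds (exp s)] fun ζ => A (log ζ) + exp (-log ζ) * K (log ζ) := by
    filter_upwards [lt_mem_nhds (exp_pos s)] with z hz using h1 z hz
  have hd : HasDerivAt (fun s => A s + exp (-s) * K s) (exp (-s) * F) s := by
    have hn : HasDerivAt (fun s => exp (-s)) (-exp (-s)) s := by
      simpa using (hasDerivAt_id' s).neg.exp
    refine ((hA s).add (hn.mul hF)).congr_deriv ?_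
    rw [hK]
    linear_combination (-A s * w s) * hinv s
  have hl : HasDerivAt log (exp s)⁻¹ (exp s) := Real.hasDerivAt_log (exp_ne_zero s)
  have hc : HasDerivAt (fun ζ => A (log ζ) + exp (-log ζ) * K (log ζ))
      (exp (-s) * F * (exp s)⁻¹) (exp s) :=
    HasDerivAt.comp (exp s) (h₂ := fun s => A s + exp (-s) * K s) (by rwa [Real.log_exp]) hl
  rw [he.deriv_eq, hc.deriv, ← exp_neg]
  ring

/-- In the coordinate `s = log ζ`, the function `u - log ζ` solves the degenerate equation. -/
lemma isSolution_of_toda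
    (hreg : ContDiffOn ℝ 2 (fun p : ℝ × ℝ × ℝ => u p.1 p.2.1 p.2.2) {p : ℝ × ℝ × ℝ | 0 < p.1})
    (hpde : ∀ ζ : ℝ, 0 < ζ → ∀ x y : ℝ,
      deriv (deriv (fun s => Real.exp (u s x y))) ζ +
        deriv (deriv (fun x' => u ζ x' y)) x +
        deriv (deriv (fun y' => u ζ x y')) y = 0)
    {K : ℝ} (hK : ∀ ζ : ℝ, 0 < ζ → ∀ x y : ℝ, |u ζ x y - Real.log ζ| ≤ K) :
    ∃ ws wx wy, IsSolution (exp (-K)) (exp K)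
      (fun p => exp (u (exp p.1) p.2.1 p.2.2 - p.1)) (fun p => u (exp p.1) p.2.1 p.2.2 - p.1)
      ws wx wy := by
  set v : ℝ × ℝ × ℝ → ℝ := fun p => u (exp p.1) p.2.1 p.2.2 - p.1 with hv
  have hv2 : ContDiff ℝ 2 v := by
    have h1 : ContDiff ℝ 2 (fun p : ℝ × ℝ × ℝ => (exp p.1, p.2.1, p.2.2)) := by fun_prop
    exact (hreg.comp_contDiff h1 fun p => exp_pos p.1).sub contDiff_fst
  have hb : ∀ p, |v p| ≤ K := fun p => by
    have := hK (exp p.1) (exp_pos _) p.2.1 p.2.2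
    rwa [Real.log_exp] at this
  have h1 := isC1_of_contDiff (hv2.of_le one_le_two)
  set ws := fun P => fderiv ℝ v P (1, 0, 0) with hws
  set wx := fun P => fderiv ℝ v P (0, 1, 0) with hwx
  set wy := fun P => fderiv ℝ v P (0, 0, 1) with hwy
  have hflux : ContDiff ℝ 1 fun p : ℝ × ℝ × ℝ => exp p.1 * exp (v p) * ws p := by
    have := hv2.of_le one_le_two
    have := ContDiff.fderiv_apply_const hv2 (1, 0, 0)
    fun_prop
  have hs := isC1_of_contDiff hflux
  have hx := isC1_of_contDiff (ContDiff.fderiv_apply_const hv2 (0, 1, 0))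
  have hy := isC1_of_contDiff (ContDiff.fderiv_apply_const hv2 (0, 0, 1))
  refine ⟨ws, wx, wy, h1, h1.cont.rexp, fun p => exp_le_exp.2 (abs_le.1 (hb p)).1,
    fun p => exp_le_exp.2 (abs_le.1 (hb p)).2, _, _, _, hs.cont_s, hx.cont_x, hy.cont_y,
    hs.deriv_s, hx.deriv_x, hy.deriv_y, fun p => ?_⟩
  obtain ⟨s, x, y⟩ := p
  have eq := hpde (exp s) (exp_pos s) x y
  have e1 := deriv_deriv_exp_comp_log (A := fun s => exp (v (s, x, y)))
    (w := fun s => ws (s, x, y)) (fun s => (h1.deriv_s s x y).exp) (fun _ => rfl)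
    (hs.deriv_s s x y) (E := fun s => Real.exp (u s x y)) (fun ζ hζ => by
      simp only [hv, Real.exp_log hζ, Real.exp_sub]
      field_simp)
  have e2 : deriv (fun x' => u (exp s) x' y) = fun x' => wx (s, x', y) := by
    ext x'
    refine HasDerivAt.deriv (((h1.deriv_x s x' y).add_const s).congr_of_eventuallyEq
      (Filter.Eventually.of_forall fun t => ?_))
    simp [hv]
  have e3 : deriv (fun y' => u (exp s) x y') = fun y' => wy (s, x, y') := by
    ext y'
    refine HasDerivAt.deriv (((h1.deriv_y s x y').add_const s).congr_of_eventuallyEq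
      (Filter.Eventually.of_forall fun t => ?_))
    simp [hv]
  rw [e1, e2, e3, (hx.deriv_x s x y).deriv, (hy.deriv_y s x y).deriv] at eq
  have hinv : exp s * exp (-s) = 1 := by rw [← exp_add]; simp
  linear_combination exp s ^ 2 * eq - (exp s * exp (-s) + 1) *
    fderiv ℝ (fun p : ℝ × ℝ × ℝ => exp p.1 * exp (v p) * ws p) (s, x, y) (1, 0, 0) * hinv

end Toda

end TodaLiouville

/-- Liouville theorem for the Toda equation on the open half-space `(0,∞) × ℝ²`:
a solution with `u − log ζ` bounded equals `log(cζ)`. -/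
theorem stmt16 (u : ℝ → ℝ → ℝ → ℝ)
    (hreg : ContDiffOn ℝ 2 (fun p : ℝ × ℝ × ℝ => u p.1 p.2.1 p.2.2)
      {p : ℝ × ℝ × ℝ | 0 < p.1})
    (hpde : ∀ ζ : ℝ, 0 < ζ → ∀ x y : ℝ,
      deriv (deriv (fun s => Real.exp (u s x y))) ζ +
        deriv (deriv (fun x' => u ζ x' y)) x +
        deriv (deriv (fun y' => u ζ x y')) y = 0)
    (hbd : ∃ M : ℝ, ∀ ζ : ℝ, 0 < ζ → ∀ x y : ℝ, |u ζ x y - Real.log ζ| ≤ M) :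
    ∃ c : ℝ, 0 < c ∧ ∀ ζ : ℝ, 0 < ζ → ∀ x y : ℝ, u ζ x y = Real.log (c * ζ) := by
  obtain ⟨K, hK⟩ := hbd
  have hK0 : 0 ≤ K := (abs_nonneg _).trans (hK 1 one_pos 0 0)
  obtain ⟨ws, wx, wy, hw⟩ := TodaLiouville.isSolution_of_toda hreg hpde hK
  have hconst := hw.eq_of_bounded (exp_pos _) (Real.exp_le_one_iff.2 (by linarith))
    (Real.one_le_exp hK0) (K := K) fun p => by
      have := hK (exp p.1) (exp_pos _) p.2.1 p.2.2
      rwa [Real.log_exp] at this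
  refine ⟨exp (u 1 0 0), exp_pos _, fun ζ hζ x y => ?_⟩
  have h := hconst (log ζ, x, y) (0, 0, 0)
  simp only [Real.exp_log hζ, exp_zero, sub_zero] at h
  rw [Real.log_mul (exp_ne_zero _) hζ.ne', Real.log_exp]
  linarith
end
end

section
/- Let u : [0,∞) × ℝ² → ℝ be continuous, twice continuously differentiable on (0,∞) × ℝ², satisfying (e^u)_{ζζ} + u_{xx} + u_{yy} = 0 on (0,∞) × ℝ² (subscripts denoting partial derivatives in (ζ,x,y)), with boundary condition u(0,x,y) = 0 for all (x,y) ∈ ℝ². If the function (ζ,x,y) ↦ u(ζ,x,y) − log(1 + ζ) is bounded on [0,∞) × ℝ², then there exists a constant c > 0 such that u(ζ,x,y) = log(1 + c·ζ) for all (ζ,x,y) ∈ [0,∞) × ℝ². -/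
open Real

noncomputable section

open Set Filter Topology

/-- The second derivative is nonpositive at an interior local maximum. -/
theorem second_deriv_nonpos_of_isLocalMax {f f' : ℝ → ℝ} {c : ℝ} (hmax : IsLocalMax f 0)
    (h1 : ∀ᶠ t in 𝓝 0, HasDerivAt f (f' t) t) (h2 : HasDerivAt f' c 0) : c ≤ 0 := by
  by_contra! hc
  have hd : deriv f =ᶠ[𝓝 0] f' := h1.mono fun t ht => ht.deriv
  have hdd : deriv (deriv f) 0 = c := (hd.deriv_eq).trans h2.deriv
  have hmin : IsLocalMin f 0 :=
    isLocalMin_of_deriv_deriv_pos (by rw [hdd]; exact hc) hmax.deriv_eq_zero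
      h1.self_of_nhds.continuousAt
  have hconst : f =ᶠ[𝓝 0] fun _ => f 0 := by
    filter_upwards [hmax, hmin] with t ha hb using le_antisymm ha hb
  have h0 : deriv f =ᶠ[𝓝 0] fun _ => (0 : ℝ) := by
    filter_upwards [hconst.eventually_nhds] with t ht
    rw [Filter.EventuallyEq.deriv_eq ht]; simp
  have : deriv (deriv f) 0 = 0 := by rw [h0.deriv_eq]; simp
  linarith

section Line

variable {E : Type*} [NormedAddCommGroup E] [NormedSpace ℝ E] {f : E → ℝ} {c v : E} {t₀ : ℝ}

/-- First derivatives along a line, near a point of twice differentiability. -/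
theorem eventually_hasDerivAt_line (hf : ContDiffAt ℝ 2 f (c + t₀ • v)) :
    ∀ᶠ t in 𝓝 t₀, HasDerivAt (fun t : ℝ => f (c + t • v)) (fderiv ℝ f (c + t • v) v) t := by
  have hcont : ContinuousAt (fun t : ℝ => c + t • v) t₀ := by fun_prop
  filter_upwards [hcont.eventually (hf.eventually (by simp))] with t ht
  have h1 : HasDerivAt (fun t : ℝ => c + t • v) v t := by
    simpa using ((hasDerivAt_id t).smul_const v).const_add c
  exact ((ht.differentiableAt (by simp)).hasFDerivAt).comp_hasDerivAt t h1

/-- Second derivatives along a line. -/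
theorem hasDerivAt_fderiv_line (hf : ContDiffAt ℝ 2 f (c + t₀ • v)) :
    HasDerivAt (fun t : ℝ => fderiv ℝ f (c + t • v) v)
      (fderiv ℝ (fderiv ℝ f) (c + t₀ • v) v v) t₀ := by
  have h1 : HasDerivAt (fun t : ℝ => c + t • v) v t₀ := by
    simpa using ((hasDerivAt_id t₀).smul_const v).const_add c
  have h2 : DifferentiableAt ℝ (fderiv ℝ f) (c + t₀ • v) :=
    (hf.fderiv_right (m := 1) (by norm_num)).differentiableAt (by simp)
  have h3 := h2.hasFDerivAt.comp_hasDerivAt t₀ h1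
  exact h3.clm_apply (hasDerivAt_const t₀ v) |>.congr_deriv (by simp)

theorem deriv_deriv_line (hf : ContDiffAt ℝ 2 f (c + t₀ • v)) :
    deriv (deriv fun t : ℝ => f (c + t • v)) t₀ =
      fderiv ℝ (fderiv ℝ f) (c + t₀ • v) v v := by
  have hd : deriv (fun t : ℝ => f (c + t • v)) =ᶠ[𝓝 t₀] fun t => fderiv ℝ f (c + t • v) v :=
    (eventually_hasDerivAt_line hf).mono fun t ht => ht.deriv
  rw [hd.deriv_eq, (hasDerivAt_fderiv_line hf).deriv]

/-- First and second order conditions when the doubled function `f (p + t v) - f (q + t w)` is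
touched from above at `t = 0` by a function `b` of one variable. -/
theorem line_test {p q w : E} {b b' : ℝ → ℝ} {b'' : ℝ} (hp : ContDiffAt ℝ 2 f p)
    (hq : ContDiffAt ℝ 2 f q) (hb : ∀ᶠ t in 𝓝 0, HasDerivAt b (b' t) t)
    (hb' : HasDerivAt b' b'' 0)
    (hle : ∀ᶠ t in 𝓝 (0 : ℝ), f (p + t • v) - f (q + t • w) ≤ b t) (heq : f p - f q = b 0) :
    fderiv ℝ f p v - fderiv ℝ f q w = b' 0 ∧
      fderiv ℝ (fderiv ℝ f) p v v - fderiv ℝ (fderiv ℝ f) q w w ≤ b'' := by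
  have hp' : ContDiffAt ℝ 2 f (p + (0 : ℝ) • v) := by simpa using hp
  have hq' : ContDiffAt ℝ 2 f (q + (0 : ℝ) • w) := by simpa using hq
  have hmax : IsLocalMax (fun t : ℝ => f (p + t • v) - f (q + t • w) - b t) 0 := by
    filter_upwards [hle] with t ht
    simp only [zero_smul, add_zero]
    linarith
  have h1 : ∀ᶠ t in 𝓝 0, HasDerivAt (fun t : ℝ => f (p + t • v) - f (q + t • w) - b t)
      (fderiv ℝ f (p + t • v) v - fderiv ℝ f (q + t • w) w - b' t) t := by
    filter_upwards [eventually_hasDerivAt_line hp', eventually_hasDerivAt_line hq', hb]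
      with t a1 a2 a3 using (a1.sub a2).sub a3
  have h2 := ((hasDerivAt_fderiv_line hp').sub (hasDerivAt_fderiv_line hq')).sub hb'
  have e1 := hmax.hasDerivAt_eq_zero h1.self_of_nhds
  have e2 := second_deriv_nonpos_of_isLocalMax hmax h1 h2
  simp only [zero_smul, add_zero] at e1 e2
  exact ⟨by linarith, by linarith⟩

end Line

/-- First and second derivative of the barrier along a line in the doubled space. -/
theorem hasDerivAt_barrier {β : ℝ} (r m K s₀ s₁ s₂ p₀ p₁ p₂ : ℝ) (hs : 0 < s₀) :
    (∀ᶠ t in 𝓝 (0 : ℝ), HasDerivAt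
      (fun t => r * (m + K * (s₀ + s₁ * t + s₂ * t ^ 2) ^ β + (p₀ + p₁ * t + p₂ * t ^ 2)))
      (r * (K * ((s₁ + 2 * s₂ * t) * β * (s₀ + s₁ * t + s₂ * t ^ 2) ^ (β - 1)) +
        (p₁ + 2 * p₂ * t))) t) ∧
    HasDerivAt (fun t => r * (K * ((s₁ + 2 * s₂ * t) * β *
        (s₀ + s₁ * t + s₂ * t ^ 2) ^ (β - 1)) + (p₁ + 2 * p₂ * t)))
      (r * (K * β * (2 * s₂ * s₀ + (β - 1) * s₁ ^ 2) * s₀ ^ β / s₀ ^ 2 + 2 * p₂)) 0 := by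
  have poly : ∀ a b c t : ℝ, HasDerivAt (fun t => a + b * t + c * t ^ 2) (b + 2 * c * t) t := by
    intro a b c t
    have := (((hasDerivAt_id t).const_mul b).const_add a).add
      (((hasDerivAt_id t).pow 2).const_mul c)
    refine this.congr_deriv ?_
    simp; ring
  have lin : ∀ b c t : ℝ, HasDerivAt (fun t => b + 2 * c * t) (2 * c) t := by
    intro b c t
    simpa using ((hasDerivAt_id t).const_mul (2 * c)).const_add b
  constructor
  · have hcont : ContinuousAt (fun t : ℝ => s₀ + s₁ * t + s₂ * t ^ 2) 0 := by fun_prop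
    have hpos : ∀ᶠ t in 𝓝 (0 : ℝ), 0 < s₀ + s₁ * t + s₂ * t ^ 2 :=
      hcont.eventually (lt_mem_nhds (by simpa using hs))
    filter_upwards [hpos] with t ht
    have h := (((poly s₀ s₁ s₂ t).rpow_const (p := β) (Or.inl ht.ne')).const_mul K).const_add m
    exact (h.add (poly p₀ p₁ p₂ t)).const_mul r
  · have h := ((poly s₀ s₁ s₂ 0).rpow_const (p := β - 1) (Or.inl (by simpa using hs.ne')))
    have h2 := ((((lin s₁ s₂ 0).mul_const β).mul h).const_mul K).add (lin p₁ p₂ 0)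
    refine (h2.const_mul r).congr_deriv ?_
    have e1 : s₀ ^ (β - 1) = s₀ ^ β / s₀ := by rw [Real.rpow_sub hs, Real.rpow_one]
    have e2 : s₀ ^ (β - 1 - 1) = s₀ ^ β / s₀ ^ 2 := by
      rw [Real.rpow_sub hs, e1, Real.rpow_one]; field_simp
    simp only [mul_zero, add_zero, ne_eq, OfNat.ofNat_ne_zero, not_false_eq_true, zero_pow, e1, e2]
    field_simp

/-- The equation `w_ζζ + Δ log w = 0` at the point `p`, with the logarithm expanded. -/
def TodaAt (W : ℝ × ℝ × ℝ → ℝ) (p : ℝ × ℝ × ℝ) : Prop :=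
  fderiv ℝ (fderiv ℝ W) p (1, 0, 0) (1, 0, 0) +
    (fderiv ℝ (fderiv ℝ W) p (0, 1, 0) (0, 1, 0) +
      fderiv ℝ (fderiv ℝ W) p (0, 0, 1) (0, 0, 1)) / W p -
    ((fderiv ℝ W p (0, 1, 0)) ^ 2 + (fderiv ℝ W p (0, 0, 1)) ^ 2) / W p ^ 2 = 0

theorem horizontal_apply (A : ℝ × ℝ × ℝ →L[ℝ] ℝ) (a b : ℝ) :
    A (0, a, b) = a * A (0, 1, 0) + b * A (0, 0, 1) := by
  have h : ((0, a, b) : ℝ × ℝ × ℝ) = a • (0, 1, 0) + b • (0, 0, 1) := by simp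
  rw [h, map_add, map_smul, map_smul]; simp

theorem horizontal_apply₂ (A : ℝ × ℝ × ℝ →L[ℝ] ℝ × ℝ × ℝ →L[ℝ] ℝ) (a b : ℝ) :
    A (0, a, b) (0, a, b) = a ^ 2 * A (0, 1, 0) (0, 1, 0) +
      a * b * (A (0, 1, 0) (0, 0, 1) + A (0, 0, 1) (0, 1, 0)) +
      b ^ 2 * A (0, 0, 1) (0, 0, 1) := by
  have h : ((0, a, b) : ℝ × ℝ × ℝ) = a • (0, 1, 0) + b • (0, 0, 1) := by simp
  rw [horizontal_apply, h]
  simp only [map_add, map_smul, add_apply, smul_apply, smul_eq_mul]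
  ring

/-- The barrier for `W (ζ, x) - W (ζ, y)`. -/
def barrier (β K ε ε' μ ζ x₁ x₂ y₁ y₂ : ℝ) : ℝ :=
  (1 + ζ) * (μ + K * ((x₁ - y₁) ^ 2 + (x₂ - y₂) ^ 2) ^ β + ε * log (1 + ζ) +
    ε' * (x₁ ^ 2 + x₂ ^ 2))

section Touching

variable {W : ℝ × ℝ × ℝ → ℝ} {β K ε ε' μ ζ x₁ x₂ y₁ y₂ : ℝ}

theorem vertical_test (hζ : 0 < ζ) (hP : ContDiffAt ℝ 2 W (ζ, x₁, x₂))
    (hQ : ContDiffAt ℝ 2 W (ζ, y₁, y₂))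
    (hle : ∀ τ > 0, W (τ, x₁, x₂) - W (τ, y₁, y₂) ≤ barrier β K ε ε' μ τ x₁ x₂ y₁ y₂)
    (heq : W (ζ, x₁, x₂) - W (ζ, y₁, y₂) = barrier β K ε ε' μ ζ x₁ x₂ y₁ y₂) :
    fderiv ℝ (fderiv ℝ W) (ζ, x₁, x₂) (1, 0, 0) (1, 0, 0) -
      fderiv ℝ (fderiv ℝ W) (ζ, y₁, y₂) (1, 0, 0) (1, 0, 0) ≤ ε / (1 + ζ) := by
  have hcont : ContinuousAt (fun t : ℝ => ζ + t) 0 := by fun_prop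
  have hpos : ∀ᶠ t in 𝓝 (0 : ℝ), 0 < ζ + t := hcont.eventually (lt_mem_nhds (by simpa using hζ))
  have hlin : ∀ t : ℝ, HasDerivAt (fun t => 1 + (ζ + t)) 1 t := fun t => by
    simpa using ((hasDerivAt_id t).const_add ζ).const_add 1
  set k := μ + K * ((x₁ - y₁) ^ 2 + (x₂ - y₂) ^ 2) ^ β + ε' * (x₁ ^ 2 + x₂ ^ 2) with hk
  have hb : ∀ᶠ t in 𝓝 (0 : ℝ), HasDerivAt
      (fun t => barrier β K ε ε' μ (ζ + t) x₁ x₂ y₁ y₂)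
      (k + ε * log (1 + (ζ + t)) + ε) t := by
    filter_upwards [hpos] with t ht
    have hne : 1 + (ζ + t) ≠ 0 := by positivity
    have h := (hlin t).mul ((((hlin t).log hne).const_mul ε).const_add k)
    refine (h.congr_deriv (by field_simp)).congr_of_eventuallyEq (.of_forall fun t => ?_)
    simp only [barrier, hk, Pi.mul_apply]; ring
  have hb' : HasDerivAt (fun t => k + ε * log (1 + (ζ + t)) + ε) (ε / (1 + ζ)) 0 := by
    have hne : 1 + (ζ + 0) ≠ 0 := by positivity
    refine (((((hlin 0).log hne).const_mul ε).const_add k).add_const ε).congr_deriv ?_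
    simp; ring
  refine (line_test hP hQ hb hb' ?_ (by simpa using heq)).2
  filter_upwards [hpos] with t ht
  simpa using hle (ζ + t) ht

theorem horizontal_test (hs : 0 < (x₁ - y₁) ^ 2 + (x₂ - y₂) ^ 2)
    (hP : ContDiffAt ℝ 2 W (ζ, x₁, x₂)) (hQ : ContDiffAt ℝ 2 W (ζ, y₁, y₂))
    (hle : ∀ a₁ a₂ b₁ b₂, W (ζ, a₁, a₂) - W (ζ, b₁, b₂) ≤ barrier β K ε ε' μ ζ a₁ a₂ b₁ b₂)
    (heq : W (ζ, x₁, x₂) - W (ζ, y₁, y₂) = barrier β K ε ε' μ ζ x₁ x₂ y₁ y₂)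
    {s P : ℝ} (hs' : s = (x₁ - y₁) ^ 2 + (x₂ - y₂) ^ 2) (hP' : P = s ^ β) (d₁ d₂ e₁ e₂ : ℝ) :
    fderiv ℝ W (ζ, x₁, x₂) (0, d₁, d₂) - fderiv ℝ W (ζ, y₁, y₂) (0, e₁, e₂) =
      (1 + ζ) * (2 * K * β * ((x₁ - y₁) * (d₁ - e₁) + (x₂ - y₂) * (d₂ - e₂)) * P / s +
        2 * ε' * (x₁ * d₁ + x₂ * d₂)) ∧
    fderiv ℝ (fderiv ℝ W) (ζ, x₁, x₂) (0, d₁, d₂) (0, d₁, d₂) -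
      fderiv ℝ (fderiv ℝ W) (ζ, y₁, y₂) (0, e₁, e₂) (0, e₁, e₂) ≤
      (1 + ζ) * (K * β * (2 * ((d₁ - e₁) ^ 2 + (d₂ - e₂) ^ 2) * s + (β - 1) *
        (2 * ((x₁ - y₁) * (d₁ - e₁) + (x₂ - y₂) * (d₂ - e₂))) ^ 2) * P / s ^ 2 +
        2 * (ε' * (d₁ ^ 2 + d₂ ^ 2))) := by
  rw [← hs'] at hs
  obtain ⟨hb, hb'⟩ := hasDerivAt_barrier (β := β) (1 + ζ) (μ + ε * log (1 + ζ)) K s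
    (2 * ((x₁ - y₁) * (d₁ - e₁) + (x₂ - y₂) * (d₂ - e₂)))
    ((d₁ - e₁) ^ 2 + (d₂ - e₂) ^ 2) (ε' * (x₁ ^ 2 + x₂ ^ 2)) (2 * ε' * (x₁ * d₁ + x₂ * d₂))
    (ε' * (d₁ ^ 2 + d₂ ^ 2)) hs
  have key := line_test (v := ((0, d₁, d₂) : ℝ × ℝ × ℝ)) (w := ((0, e₁, e₂) : ℝ × ℝ × ℝ))
    hP hQ hb hb' (.of_forall fun t => ?_) ?_
  · refine ⟨?_, by rw [hP']; exact key.2⟩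
    rw [key.1, hP', mul_zero, mul_zero, mul_zero]
    simp only [add_zero, ne_eq, OfNat.ofNat_ne_zero, not_false_eq_true, zero_pow, mul_zero]
    rw [Real.rpow_sub hs, Real.rpow_one]
    ring
  · have h := hle (x₁ + t * d₁) (x₂ + t * d₂) (y₁ + t * e₁) (y₂ + t * e₂)
    simp only [Prod.smul_mk, smul_eq_mul, mul_zero, Prod.mk_add_mk, add_zero]
    refine h.trans_eq ?_
    rw [barrier, hs']
    ring_nf
  · rw [heq, barrier, hs']
    ring_nf

/-- The numerical inequality that rules out an interior touching point. -/
theorem touching_ineq {N ρ α γ q s : ℝ} (hN : 1 ≤ N) (hρ : 0 < ρ) (hα : 0 < α) (hγ : 0 < γ)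
    (hβ : β = 1 / (5 * N ^ 4)) (hq : 0 < q) (hqs : q * s ≤ N) (hε' : 0 < ε')
    (hα₁ : 1 / N ≤ ρ * α ^ 2) (hα₂ : ρ * α ^ 2 ≤ N) (hγ₁ : 1 / N ≤ ρ * γ ^ 2)
    (hγ₂ : ρ * γ ^ 2 ≤ N) (hsmall : ε + 4 * ε' * N < 4 * β * q / N) :
    ε + ρ * (2 * β * q * ((α - γ) ^ 2 - (1 - 2 * β) * (α + γ) ^ 2) + 4 * ε' * α ^ 2) +
      4 * γ ^ 4 * ρ ^ 2 * β ^ 2 * q ^ 2 * s < 0 := by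
  have hN0 : 0 < N := by linarith
  have hβ0 : 0 < β := by rw [hβ]; positivity
  have hG0 : 0 < ρ * α * γ := by positivity
  have hGG : (ρ * α * γ) ^ 2 = (ρ * α ^ 2) * (ρ * γ ^ 2) := by ring
  have hG₁ : 1 / N ≤ ρ * α * γ := by
    refine le_of_sq_le_sq ?_ hG0.le
    rw [hGG, sq (1 / N)]
    exact mul_le_mul hα₁ hγ₁ (by positivity) (by positivity)
  have hG₂ : ρ * α * γ ≤ N := by
    refine le_of_sq_le_sq ?_ hN0.le
    rw [hGG, sq N]
    exact mul_le_mul hα₂ hγ₂ (by positivity) (by positivity)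
  have h1 : ρ * ((α - γ) ^ 2 - (1 - 2 * β) * (α + γ) ^ 2) ≤ -4 / N + 8 * β * N := by
    have e : ρ * ((α - γ) ^ 2 - (1 - 2 * β) * (α + γ) ^ 2) = -4 * (ρ * α * γ) +
      2 * β * (ρ * α ^ 2 + ρ * γ ^ 2 + 2 * (ρ * α * γ)) := by ring
    have h2 : 2 * β * (ρ * α ^ 2 + ρ * γ ^ 2 + 2 * (ρ * α * γ)) ≤ 2 * β * (4 * N) :=
      mul_le_mul_of_nonneg_left (by linarith) (by positivity)
    have h3 : -4 / N = -4 * (1 / N) := by ring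
    rw [e, h3]; linarith
  have h2 : 4 * γ ^ 4 * ρ ^ 2 * β ^ 2 * q ^ 2 * s ≤ 2 * β * q * (2 * β * N ^ 3) := by
    have e : 4 * γ ^ 4 * ρ ^ 2 * β ^ 2 * q ^ 2 * s =
      4 * β ^ 2 * q * ((ρ * γ ^ 2) ^ 2 * (q * s)) := by ring
    have h3 : (ρ * γ ^ 2) ^ 2 * (q * s) ≤ N ^ 2 * N := by
      have h4 : (ρ * γ ^ 2) ^ 2 ≤ N ^ 2 := by gcongr
      calc _ ≤ (ρ * γ ^ 2) ^ 2 * N := by gcongr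
        _ ≤ _ := by gcongr
    rw [e]
    calc _ ≤ 4 * β ^ 2 * q * (N ^ 2 * N) := by gcongr
      _ = _ := by ring
  have h3 : 4 * ε' * (ρ * α ^ 2) ≤ 4 * ε' * N := by gcongr
  have h4 : 2 * β * q * (ρ * ((α - γ) ^ 2 - (1 - 2 * β) * (α + γ) ^ 2)) ≤
      2 * β * q * (-4 / N + 8 * β * N) := by gcongr
  have h5 : 8 * β * N + 2 * β * N ^ 3 ≤ 2 / N := by
    have h6 : N ≤ N ^ 3 := by nlinarith [sq_nonneg N, mul_le_mul hN hN zero_le_one hN0.le]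
    calc _ ≤ 8 * β * N ^ 3 + 2 * β * N ^ 3 := by gcongr
      _ = 2 / N := by rw [hβ]; field_simp; norm_num
  have h6 : 2 * β * q * (-4 / N + (8 * β * N + 2 * β * N ^ 3)) ≤ 2 * β * q * (-4 / N + 2 / N) := by
    gcongr
  have h7 : 2 * β * q * (-4 / N + 2 / N) = -(4 * β * q / N) := by ring
  nlinarith

/-- Adding the second order conditions along the reflected radial direction and along the
parallel transverse direction produces the two Laplacians. -/
theorem laplacian_le_of_pair {ρ q s P α γ z₁ z₂ A₁ A₂ A₃ B₁ B₂ B₃ : ℝ} (hs : 0 < s)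
    (hz : s = z₁ ^ 2 + z₂ ^ 2) (hq : q = K * P / s)
    (i₁ : (α * z₁) ^ 2 * A₁ + α * z₁ * (α * z₂) * A₂ + (α * z₂) ^ 2 * A₃ -
      ((-γ * z₁) ^ 2 * B₁ + -γ * z₁ * (-γ * z₂) * B₂ + (-γ * z₂) ^ 2 * B₃) ≤
      ρ * (K * β * (2 * ((α * z₁ - -γ * z₁) ^ 2 + (α * z₂ - -γ * z₂) ^ 2) * s + (β - 1) *
        (2 * (z₁ * (α * z₁ - -γ * z₁) + z₂ * (α * z₂ - -γ * z₂))) ^ 2) * P / s ^ 2 +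
        2 * (ε' * ((α * z₁) ^ 2 + (α * z₂) ^ 2))))
    (i₂ : (α * -z₂) ^ 2 * A₁ + α * -z₂ * (α * z₁) * A₂ + (α * z₁) ^ 2 * A₃ -
      ((γ * -z₂) ^ 2 * B₁ + γ * -z₂ * (γ * z₁) * B₂ + (γ * z₁) ^ 2 * B₃) ≤
      ρ * (K * β * (2 * ((α * -z₂ - γ * -z₂) ^ 2 + (α * z₁ - γ * z₁) ^ 2) * s + (β - 1) *
        (2 * (z₁ * (α * -z₂ - γ * -z₂) + z₂ * (α * z₁ - γ * z₁))) ^ 2) * P / s ^ 2 +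
        2 * (ε' * ((α * -z₂) ^ 2 + (α * z₁) ^ 2)))) :
    α ^ 2 * (A₁ + A₃) - γ ^ 2 * (B₁ + B₃) ≤
      ρ * (2 * β * q * ((α - γ) ^ 2 - (1 - 2 * β) * (α + γ) ^ 2) + 4 * ε' * α ^ 2) := by
  refine le_of_mul_le_mul_left ?_ hs
  have r₁ : 2 * ((α * z₁ - -γ * z₁) ^ 2 + (α * z₂ - -γ * z₂) ^ 2) * s + (β - 1) *
      (2 * (z₁ * (α * z₁ - -γ * z₁) + z₂ * (α * z₂ - -γ * z₂))) ^ 2 =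
      s ^ 2 * ((α + γ) ^ 2 * (4 * β - 2)) := by
    rw [hz]; ring
  have r₂ : 2 * ((α * -z₂ - γ * -z₂) ^ 2 + (α * z₁ - γ * z₁) ^ 2) * s + (β - 1) *
      (2 * (z₁ * (α * -z₂ - γ * -z₂) + z₂ * (α * z₁ - γ * z₁))) ^ 2 =
      s ^ 2 * (2 * (α - γ) ^ 2) := by
    rw [hz]; ring
  have c : ∀ X : ℝ, K * β * (s ^ 2 * X) * P / s ^ 2 = s * (β * q * X) := fun X => by
    rw [hq]; field_simp
  have t₁ : (α * z₁) ^ 2 + (α * z₂) ^ 2 = s * α ^ 2 := by rw [hz]; ring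
  have t₂ : (α * -z₂) ^ 2 + (α * z₁) ^ 2 = s * α ^ 2 := by rw [hz]; ring
  rw [r₁, c, t₁] at i₁
  rw [r₂, c, t₂] at i₂
  refine le_trans (le_of_eq ?_) ((add_le_add i₁ i₂).trans (le_of_eq ?_))
  · rw [hz]; ring
  · ring

/-- The doubled function cannot be touched from above by the barrier at an interior point. -/
theorem not_touching {N s : ℝ} (hN : 1 ≤ N) (hβ : β = 1 / (5 * N ^ 4)) (hK : 0 < K) (hε : 0 < ε)
    (hε' : 0 < ε') (hζ : 0 < ζ) (hs : 0 < s) (hs' : s = (x₁ - y₁) ^ 2 + (x₂ - y₂) ^ 2)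
    (hP : ContDiffAt ℝ 2 W (ζ, x₁, x₂)) (hQ : ContDiffAt ℝ 2 W (ζ, y₁, y₂))
    (hTP : TodaAt W (ζ, x₁, x₂)) (hTQ : TodaAt W (ζ, y₁, y₂))
    (hWP₁ : (1 + ζ) / N ≤ W (ζ, x₁, x₂)) (hWP₂ : W (ζ, x₁, x₂) ≤ N * (1 + ζ))
    (hWQ₁ : (1 + ζ) / N ≤ W (ζ, y₁, y₂)) (hWQ₂ : W (ζ, y₁, y₂) ≤ N * (1 + ζ))
    (hle : ∀ τ > 0, ∀ a₁ a₂ b₁ b₂,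
      W (τ, a₁, a₂) - W (τ, b₁, b₂) ≤ barrier β K ε ε' μ τ a₁ a₂ b₁ b₂)
    (heq : W (ζ, x₁, x₂) - W (ζ, y₁, y₂) = barrier β K ε ε' μ ζ x₁ x₂ y₁ y₂)
    (hKs : K * s ^ β ≤ N) (hsmall : ε + 4 * ε' * N < 4 * β * (K * s ^ β / s) / N) : False := by
  have hN0 : 0 < N := by linarith
  have hρ : 0 < 1 + ζ := by linarith
  have inv_bounds : ∀ w : ℝ, (1 + ζ) / N ≤ w → w ≤ N * (1 + ζ) → ∃ α : ℝ, 0 < α ∧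
      α ^ 2 = 1 / w ∧ 1 / N ≤ (1 + ζ) * α ^ 2 ∧ (1 + ζ) * α ^ 2 ≤ N := by
    intro w h1 h2
    have hw : 0 < w := lt_of_lt_of_le (by positivity) h1
    have e : (1 / √w) ^ 2 = 1 / w := by rw [div_pow, one_pow, Real.sq_sqrt hw.le]
    refine ⟨1 / √w, by positivity, e, ?_, ?_⟩
    · rw [e, mul_one_div, div_le_div_iff₀ hN0 hw]; linarith
    · rw [e, mul_one_div, div_le_iff₀ hw]
      rw [div_le_iff₀ hN0] at h1; linarith
  obtain ⟨α, hα, eα, hα₁, hα₂⟩ := inv_bounds _ hWP₁ hWP₂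
  obtain ⟨γ, hγ, eγ, hγ₁, hγ₂⟩ := inv_bounds _ hWQ₁ hWQ₂
  have hv := vertical_test hζ hP hQ (fun τ hτ => hle τ hτ _ _ _ _) heq
  have ht := horizontal_test (hs' ▸ hs) hP hQ (hle ζ hζ) heq hs' rfl
  have g₁ := (ht 0 0 1 0).1
  have g₂ := (ht 0 0 0 1).1
  have i₁ := (ht (α * (x₁ - y₁)) (α * (x₂ - y₂)) (-γ * (x₁ - y₁)) (-γ * (x₂ - y₂))).2
  have i₂ := (ht (α * -(x₂ - y₂)) (α * (x₁ - y₁)) (γ * -(x₂ - y₂)) (γ * (x₁ - y₁))).2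
  clear ht
  rw [horizontal_apply₂ _ (α * (x₁ - y₁)), horizontal_apply₂ _ (-γ * (x₁ - y₁))] at i₁
  rw [horizontal_apply₂ _ (α * -(x₂ - y₂)), horizontal_apply₂ _ (γ * -(x₂ - y₂))] at i₂
  have hz : ((0, 0, 0) : ℝ × ℝ × ℝ) = 0 := rfl
  rw [hz, map_zero] at g₁ g₂
  unfold TodaAt at hTP hTQ
  have eα' : ∀ X : ℝ, X / W (ζ, x₁, x₂) = α ^ 2 * X := fun X => by rw [eα]; ring
  have eγ' : ∀ X : ℝ, X / W (ζ, y₁, y₂) = γ ^ 2 * X := fun X => by rw [eγ]; ring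
  have eα'' : ∀ X : ℝ, X / W (ζ, x₁, x₂) ^ 2 = α ^ 4 * X := fun X => by
    rw [show α ^ 4 = (α ^ 2) ^ 2 by ring, eα]; ring
  have eγ'' : ∀ X : ℝ, X / W (ζ, y₁, y₂) ^ 2 = γ ^ 4 * X := fun X => by
    rw [show γ ^ 4 = (γ ^ 2) ^ 2 by ring, eγ]; ring
  rw [eα', eα''] at hTP
  rw [eγ', eγ''] at hTQ
  have hq : 0 < K * s ^ β / s := by positivity
  have hqs : K * s ^ β / s * s ≤ N := by rwa [div_mul_cancel₀ _ hs.ne']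
  have key := touching_ineq hN hρ hα hγ hβ hq hqs hε' hα₁ hα₂ hγ₁ hγ₂ hsmall
  set ρ := 1 + ζ
  set P := s ^ β
  set q := K * P / s with hqdef
  have hv' : ε / ρ ≤ ε := div_le_self hε.le (by simp only [ρ]; linarith)
  have hgrad : (fderiv ℝ W (ζ, y₁, y₂) (0, 1, 0)) ^ 2 + (fderiv ℝ W (ζ, y₁, y₂) (0, 0, 1)) ^ 2 =
      4 * ρ ^ 2 * β ^ 2 * q ^ 2 * s := by
    have g₁' : fderiv ℝ W (ζ, y₁, y₂) (0, 1, 0) = 2 * ρ * β * q * (x₁ - y₁) := by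
      rw [hqdef]; linear_combination -g₁
    have g₂' : fderiv ℝ W (ζ, y₁, y₂) (0, 0, 1) = 2 * ρ * β * q * (x₂ - y₂) := by
      rw [hqdef]; linear_combination -g₂
    rw [g₁', g₂', hs']; ring
  rw [hgrad] at hTQ
  have hlap' := laplacian_le_of_pair hs (P := P) hs' hqdef i₁ i₂
  have hnn : 0 ≤ α ^ 4 * ((fderiv ℝ W (ζ, x₁, x₂) (0, 1, 0)) ^ 2 +
    (fderiv ℝ W (ζ, x₁, x₂) (0, 0, 1)) ^ 2) := by positivity
  linarith

end Touching

/-- A positive value of the doubled function minus the barrier yields a touching point. -/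
theorem exists_touching {W : ℝ × ℝ × ℝ → ℝ} {β K ε ε' N : ℝ} (hN : 0 < N) (hβ : 0 < β)
    (hK : 0 < K) (hε : 0 < ε) (hε' : 0 < ε') (hcont : ContinuousOn W {p | 0 ≤ p.1})
    (hbc : ∀ x y, W (0, x, y) = 1) (hW₀ : ∀ ζ ≥ 0, ∀ x y, 0 ≤ W (ζ, x, y))
    (hW₁ : ∀ ζ ≥ 0, ∀ x y, W (ζ, x, y) ≤ N * (1 + ζ)) {τ a₁ a₂ b₁ b₂ : ℝ} (hτ : 0 ≤ τ)
    (h0 : barrier β K ε ε' 0 τ a₁ a₂ b₁ b₂ < W (τ, a₁, a₂) - W (τ, b₁, b₂)) :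
    ∃ μ ζ x₁ x₂ y₁ y₂, 0 < ζ ∧ 0 < (x₁ - y₁) ^ 2 + (x₂ - y₂) ^ 2 ∧
      K * ((x₁ - y₁) ^ 2 + (x₂ - y₂) ^ 2) ^ β ≤ N ∧
      (∀ τ ≥ 0, ∀ a₁ a₂ b₁ b₂,
        W (τ, a₁, a₂) - W (τ, b₁, b₂) ≤ barrier β K ε ε' μ τ a₁ a₂ b₁ b₂) ∧
      W (ζ, x₁, x₂) - W (ζ, y₁, y₂) = barrier β K ε ε' μ ζ x₁ x₂ y₁ y₂ := by
  let Φ : ℝ × ℝ × ℝ × ℝ × ℝ → ℝ := fun p =>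
    (W (p.1, p.2.1, p.2.2.1) - W (p.1, p.2.2.2.1, p.2.2.2.2)) / (1 + p.1) -
      barrier β K ε ε' 0 p.1 p.2.1 p.2.2.1 p.2.2.2.1 p.2.2.2.2 / (1 + p.1)
  have hΦ : ∀ ζ ≥ 0, ∀ x₁ x₂ y₁ y₂, Φ (ζ, x₁, x₂, y₁, y₂) =
      (W (ζ, x₁, x₂) - W (ζ, y₁, y₂)) / (1 + ζ) - (K * ((x₁ - y₁) ^ 2 + (x₂ - y₂) ^ 2) ^ β +
        ε * log (1 + ζ) + ε' * (x₁ ^ 2 + x₂ ^ 2)) := by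
    intro ζ hζ x₁ x₂ y₁ y₂
    have : (1 + ζ) ≠ 0 := by positivity
    simp only [Φ, barrier, zero_add]
    rw [mul_div_cancel_left₀ _ this]
  have hΦcont : ContinuousOn Φ {p | 0 ≤ p.1} := by
    have e : ContinuousOn (fun p : ℝ × ℝ × ℝ × ℝ × ℝ =>
        (W (p.1, p.2.1, p.2.2.1) - W (p.1, p.2.2.2.1, p.2.2.2.2)) / (1 + p.1) -
        (K * ((p.2.1 - p.2.2.2.1) ^ 2 + (p.2.2.1 - p.2.2.2.2) ^ 2) ^ β +
        ε * log (1 + p.1) + ε' * (p.2.1 ^ 2 + p.2.2.1 ^ 2))) {p | 0 ≤ p.1} := by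
      have hne : ∀ p ∈ {p : ℝ × ℝ × ℝ × ℝ × ℝ | 0 ≤ p.1}, 1 + p.1 ≠ 0 := by
        intro p hp
        have : 0 ≤ p.1 := hp
        positivity
      have c₁ : ContinuousOn (fun p : ℝ × ℝ × ℝ × ℝ × ℝ => W (p.1, p.2.1, p.2.2.1))
          {p | 0 ≤ p.1} :=
        hcont.comp (f := fun p : ℝ × ℝ × ℝ × ℝ × ℝ => (p.1, p.2.1, p.2.2.1))
          (by fun_prop) fun p hp => hp
      have c₂ : ContinuousOn (fun p : ℝ × ℝ × ℝ × ℝ × ℝ => W (p.1, p.2.2.2.1, p.2.2.2.2))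
          {p | 0 ≤ p.1} :=
        hcont.comp (f := fun p : ℝ × ℝ × ℝ × ℝ × ℝ => (p.1, p.2.2.2.1, p.2.2.2.2))
          (by fun_prop) fun p hp => hp
      have c₃ : ContinuousOn (fun p : ℝ × ℝ × ℝ × ℝ × ℝ =>
          ((p.2.1 - p.2.2.2.1) ^ 2 + (p.2.2.1 - p.2.2.2.2) ^ 2) ^ β) {p | 0 ≤ p.1} :=
        ContinuousOn.rpow_const (by fun_prop) fun p _ => Or.inr hβ.le
      have c₄ : ContinuousOn (fun p : ℝ × ℝ × ℝ × ℝ × ℝ => log (1 + p.1)) {p | 0 ≤ p.1} :=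
        ContinuousOn.log (by fun_prop) hne
      exact ((c₁.sub c₂).div (by fun_prop) hne).sub
        (((c₃.const_mul K).add (c₄.const_mul ε)).add (by fun_prop))
    exact e.congr fun p hp => hΦ p.1 hp _ _ _ _
  have hΦpos : ∀ ζ ≥ 0, ∀ x₁ x₂ y₁ y₂, 0 < Φ (ζ, x₁, x₂, y₁, y₂) →
      K * ((x₁ - y₁) ^ 2 + (x₂ - y₂) ^ 2) ^ β ≤ N ∧ ε * log (1 + ζ) ≤ N ∧
        ε' * (x₁ ^ 2 + x₂ ^ 2) ≤ N := by
    intro ζ hζ x₁ x₂ y₁ y₂ h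
    rw [hΦ ζ hζ] at h
    have h1 : (W (ζ, x₁, x₂) - W (ζ, y₁, y₂)) / (1 + ζ) ≤ N := by
      rw [div_le_iff₀ (by positivity)]
      linarith [hW₁ ζ hζ x₁ x₂, hW₀ ζ hζ y₁ y₂]
    have h2 : 0 ≤ K * ((x₁ - y₁) ^ 2 + (x₂ - y₂) ^ 2) ^ β := by positivity
    have h3 : 0 ≤ ε * log (1 + ζ) := mul_nonneg hε.le (Real.log_nonneg (by linarith))
    have h4 : 0 ≤ ε' * (x₁ ^ 2 + x₂ ^ 2) := by positivity
    exact ⟨by linarith, by linarith, by linarith⟩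
  set Z := exp (N / ε)
  set R := N / ε' + 1
  set S := (N / K) ^ (1 / β) + 1
  have hS : 0 ≤ (N / K) ^ (1 / β) := by positivity
  have hbox : ∀ ζ ≥ 0, ∀ x₁ x₂ y₁ y₂, 0 < Φ (ζ, x₁, x₂, y₁, y₂) →
      (ζ, x₁, x₂, y₁, y₂) ∈
        Icc ((0, -R, -R, -(R + S), -(R + S)) : ℝ × ℝ × ℝ × ℝ × ℝ) (Z, R, R, R + S, R + S) := by
    intro ζ hζ x₁ x₂ y₁ y₂ h
    obtain ⟨h1, h2, h3⟩ := hΦpos ζ hζ x₁ x₂ y₁ y₂ h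
    have k0 : ∀ a b C : ℝ, a ^ 2 + b ^ 2 ≤ C → 0 ≤ C → |a| ≤ C + 1 ∧ |b| ≤ C + 1 := by
      intro a b C h hC
      constructor <;> refine abs_le_of_sq_le_sq ?_ (by linarith) <;>
        nlinarith [sq_nonneg a, sq_nonneg b]
    have k1 := k0 x₁ x₂ (N / ε') (by rw [le_div_iff₀ hε']; linarith) (by positivity)
    have k2 := k0 (x₁ - y₁) (x₂ - y₂) ((N / K) ^ (1 / β)) (by
      rw [one_div, Real.le_rpow_inv_iff_of_pos (by positivity) (by positivity) hβ,
        le_div_iff₀ hK]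
      linarith) hS
    have k3 : ζ ≤ Z := by
      have : log (1 + ζ) ≤ N / ε := by rw [le_div_iff₀ hε]; linarith
      have := (Real.log_le_iff_le_exp (by positivity)).1 this
      linarith
    simp only [abs_le] at k1 k2
    obtain ⟨⟨k11, k12⟩, k13, k14⟩ := k1
    obtain ⟨⟨k21, k22⟩, k23, k24⟩ := k2
    simp only [mem_Icc, Prod.mk_le_mk]
    exact ⟨⟨hζ, k11, k13, by simp only [R, S]; linarith, by simp only [R, S]; linarith⟩,
      k3, k12, k14, by simp only [R, S]; linarith, by simp only [R, S]; linarith⟩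
  have h0' : 0 < Φ (τ, a₁, a₂, b₁, b₂) := by
    have : 0 < 1 + τ := by positivity
    simp only [Φ, ← sub_div]
    exact div_pos (by linarith) this
  obtain ⟨⟨ζ, x₁, x₂, y₁, y₂⟩, hmem, hmax⟩ := isCompact_Icc.exists_isMaxOn ⟨_, hbox τ hτ _ _ _ _ h0'⟩
    (hΦcont.mono fun p hp => hp.1.1)
  have hζ : 0 ≤ ζ := hmem.1.1
  set μ := Φ (ζ, x₁, x₂, y₁, y₂) with hμ
  have hμpos : 0 < μ := h0'.trans_le (hmax (hbox τ hτ _ _ _ _ h0'))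
  have hglob : ∀ τ ≥ 0, ∀ a₁ a₂ b₁ b₂, Φ (τ, a₁, a₂, b₁, b₂) ≤ μ := by
    intro τ hτ a₁ a₂ b₁ b₂
    by_cases h : 0 < Φ (τ, a₁, a₂, b₁, b₂)
    · exact hmax (hbox τ hτ _ _ _ _ h)
    · linarith
  have hV : W (ζ, x₁, x₂) ≠ W (ζ, y₁, y₂) := by
    intro h
    have : μ ≤ 0 := by
      rw [hμ, hΦ ζ hζ, h, sub_self, zero_div, zero_sub, neg_nonpos]
      have : 0 ≤ log (1 + ζ) := Real.log_nonneg (by linarith)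
      positivity
    linarith
  refine ⟨μ, ζ, x₁, x₂, y₁, y₂, ?_, ?_, (hΦpos ζ hζ _ _ _ _ hμpos).1, ?_, ?_⟩
  · refine lt_of_le_of_ne hζ fun h => hV ?_
    rw [← h, hbc, hbc]
  · by_contra! h
    have e₁ : x₁ = y₁ := by nlinarith [sq_nonneg (x₁ - y₁), sq_nonneg (x₂ - y₂)]
    have e₂ : x₂ = y₂ := by nlinarith [sq_nonneg (x₁ - y₁), sq_nonneg (x₂ - y₂)]
    exact hV (by rw [e₁, e₂])
  · intro τ hτ a₁ a₂ b₁ b₂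
    have h := hglob τ hτ a₁ a₂ b₁ b₂
    have hpos : 0 < 1 + τ := by positivity
    rw [hΦ τ hτ, sub_le_iff_le_add, div_le_iff₀ hpos] at h
    unfold barrier
    linarith
  · have hpos : 1 + ζ ≠ 0 := by positivity
    have h := hΦ ζ hζ x₁ x₂ y₁ y₂
    rw [← hμ, eq_sub_iff_add_eq, eq_div_iff hpos] at h
    unfold barrier
    linarith

/-- Solutions comparable with `1 + ζ` and equal to `1` on the boundary are horizontally
constant. -/
theorem TodaAt.le_of_bounds {W : ℝ × ℝ × ℝ → ℝ} {N : ℝ} (hN : 1 ≤ N)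
    (hcont : ContinuousOn W {p | 0 ≤ p.1}) (hreg : ∀ p : ℝ × ℝ × ℝ, 0 < p.1 → ContDiffAt ℝ 2 W p)
    (hT : ∀ p : ℝ × ℝ × ℝ, 0 < p.1 → TodaAt W p) (hbc : ∀ x y, W (0, x, y) = 1)
    (hW₀ : ∀ ζ ≥ 0, ∀ x y, (1 + ζ) / N ≤ W (ζ, x, y))
    (hW₁ : ∀ ζ ≥ 0, ∀ x y, W (ζ, x, y) ≤ N * (1 + ζ)) {τ : ℝ} (hτ : 0 ≤ τ) (a₁ a₂ b₁ b₂ : ℝ) :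
    W (τ, a₁, a₂) ≤ W (τ, b₁, b₂) := by
  by_contra! hlt
  have hN0 : 0 < N := by linarith
  obtain ⟨β, hβ⟩ : ∃ β, β = 1 / (5 * N ^ 4) := ⟨_, rfl⟩
  have hβ0 : 0 < β := by rw [hβ]; positivity
  have hβ1 : β ≤ 1 := by
    rw [hβ]
    refine div_le_one_of_le₀ ?_ (by positivity)
    linarith [one_le_pow₀ hN (n := 4)]
  have hρ : 0 < 1 + τ := by positivity
  obtain ⟨v, hv, hv'⟩ : ∃ v > 0, v * (1 + τ) = W (τ, a₁, a₂) - W (τ, b₁, b₂) :=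
    ⟨(W (τ, a₁, a₂) - W (τ, b₁, b₂)) / (1 + τ), div_pos (by linarith) hρ,
      div_mul_cancel₀ _ hρ.ne'⟩
  have small : ∀ c ≥ 0, ∀ κ > 0, ∃ δ > 0, δ * c ≤ v / 4 ∧ δ ≤ κ := by
    intro c hc κ hκ
    refine ⟨min κ (v / 4 / (c + 1)), lt_min hκ (by positivity), ?_, min_le_left _ _⟩
    calc _ ≤ v / 4 / (c + 1) * (c + 1) := by
          gcongr
          · exact min_le_right _ _
          · linarith
      _ = v / 4 := div_mul_cancel₀ _ (by positivity)
  obtain ⟨K, hK, hKv, -⟩ := small (((a₁ - b₁) ^ 2 + (a₂ - b₂) ^ 2) ^ β) (by positivity) 1 one_pos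
  set κ := 4 * β * (K * ((N / K) ^ (1 / β)) ^ (β - 1)) / N with hκdef
  have hκ : 0 < κ := by positivity
  obtain ⟨ε, hε, hεv, hεκ⟩ := small (log (1 + τ)) (Real.log_nonneg (by linarith)) (κ / 4)
    (by positivity)
  obtain ⟨ε', hε', hεv', hεκ'⟩ := small (a₁ ^ 2 + a₂ ^ 2) (by positivity) (κ / (16 * N))
    (by positivity)
  have h0 : barrier β K ε ε' 0 τ a₁ a₂ b₁ b₂ < W (τ, a₁, a₂) - W (τ, b₁, b₂) := by
    rw [← hv', barrier, mul_comm v]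
    exact mul_lt_mul_of_pos_left (by linarith) hρ
  have hW : ∀ ζ ≥ 0, ∀ x y, 0 ≤ W (ζ, x, y) := fun ζ hζ x y =>
    le_trans (by positivity) (hW₀ ζ hζ x y)
  obtain ⟨μ, ζ, x₁, x₂, y₁, y₂, hζ, hs, hKs, hle, heq⟩ :=
    exists_touching hN0 hβ0 hK hε hε' hcont hbc hW hW₁ hτ h0
  refine not_touching hN hβ hK hε hε' hζ hs rfl (hreg _ hζ) (hreg _ hζ) (hT _ hζ) (hT _ hζ)
    (hW₀ _ hζ.le _ _) (hW₁ _ hζ.le _ _) (hW₀ _ hζ.le _ _) (hW₁ _ hζ.le _ _)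
    (fun t ht => hle t ht.le) heq hKs ?_
  generalize (x₁ - y₁) ^ 2 + (x₂ - y₂) ^ 2 = s at hs hKs
  have hsS : s ≤ (N / K) ^ (1 / β) := by
    rw [one_div, Real.le_rpow_inv_iff_of_pos hs.le (by positivity) hβ0, le_div_iff₀ hK]
    linarith
  have hpow : ((N / K) ^ (1 / β)) ^ (β - 1) ≤ s ^ β / s := by
    have := Real.rpow_le_rpow_of_nonpos hs hsS (by linarith : β - 1 ≤ 0)
    rwa [Real.rpow_sub hs, Real.rpow_one] at this
  have h1 : κ ≤ 4 * β * (K * s ^ β / s) / N := by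
    rw [hκdef, mul_div_assoc K]
    gcongr
  have h2 : 4 * ε' * N ≤ κ / 4 := by
    rw [le_div_iff₀ (by positivity)] at hεκ'
    linarith
  linarith

/-- The chain rule for `exp ∘ U`. -/
theorem fderiv_exp_comp {E : Type*} [NormedAddCommGroup E] [NormedSpace ℝ E] {U : E → ℝ} {p : E}
    (hU : ContDiffAt ℝ 2 U p) (v : E) :
    fderiv ℝ (fun q => exp (U q)) p v = exp (U p) * fderiv ℝ U p v ∧
    fderiv ℝ (fderiv ℝ fun q => exp (U q)) p v v =
      exp (U p) * (fderiv ℝ (fderiv ℝ U) p v v + (fderiv ℝ U p v) ^ 2) := by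
  have hU' : ContDiffAt ℝ 2 U (p + (0 : ℝ) • v) := by simpa using hU
  have hW : ContDiffAt ℝ 2 (fun q => exp (U q)) (p + (0 : ℝ) • v) := hU'.exp
  have h1 := eventually_hasDerivAt_line hU'
  have h2 := eventually_hasDerivAt_line hW
  have e : (fun t : ℝ => fderiv ℝ (fun q => exp (U q)) (p + t • v) v) =ᶠ[𝓝 0]
      fun t => exp (U (p + t • v)) * fderiv ℝ U (p + t • v) v := by
    filter_upwards [h1, h2] with t t1 t2 using t2.unique t1.exp
  have h3 := (hasDerivAt_fderiv_line hW).unique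
    ((h1.self_of_nhds.exp.mul (hasDerivAt_fderiv_line hU')).congr_of_eventuallyEq e)
  have e0 := e.self_of_nhds
  simp only [zero_smul, add_zero] at e0 h3
  exact ⟨e0, by rw [h3]; ring⟩

/-- A continuous function on `[0, ∞)` whose second derivative vanishes on `(0, ∞)` is affine. -/
theorem eq_affine_of_deriv_deriv_eq_zero {f : ℝ → ℝ} (hf : ContinuousOn f (Ici 0))
    (hf₂ : ContDiffOn ℝ 2 f (Ioi 0)) (h : ∀ t > 0, deriv (deriv f) t = 0) :
    ∃ c, ∀ t ≥ 0, f t = f 0 + c * t := by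
  have hd : DifferentiableOn ℝ f (Ioi 0) := hf₂.differentiableOn (by simp)
  have hd' : DifferentiableOn ℝ (deriv f) (Ioi 0) :=
    ((contDiffOn_succ_iff_deriv_of_isOpen (n := 1) isOpen_Ioi).1 hf₂).2.2.differentiableOn
      (by simp)
  obtain ⟨c, hc⟩ := isOpen_Ioi.exists_is_const_of_deriv_eq_zero isPreconnected_Ioi hd'
    fun t ht => h t ht
  have hg : ∀ t ∈ Ioi (0 : ℝ), HasDerivAt (fun t => f t - c * t) 0 t := fun t ht => by
    have h1 := (hd.differentiableAt (Ioi_mem_nhds ht)).hasDerivAt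
    rw [hc t ht] at h1
    exact (h1.sub ((hasDerivAt_id t).const_mul c)).congr_deriv (by simp)
  obtain ⟨d, hd⟩ := isOpen_Ioi.exists_is_const_of_deriv_eq_zero isPreconnected_Ioi
    (fun t ht => (hg t ht).differentiableAt.differentiableWithinAt) fun t ht => (hg t ht).deriv
  have hcl : EqOn (fun t => f t - c * t) (fun _ => d) (Ici 0) := by
    have hdense : Ici (0 : ℝ) ⊆ closure (Ioi 0) := by rw [closure_Ioi]
    exact EqOn.of_subset_closure (fun t ht => hd t ht) (hf.sub (by fun_prop)) continuousOn_const
      Ioi_subset_Ici_self hdense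
  refine ⟨c, fun t ht => ?_⟩
  have e₀ := hcl (self_mem_Ici (a := (0 : ℝ)))
  have e₁ := hcl (mem_Ici.2 ht)
  simp only at e₀ e₁
  linarith

/-- Liouville theorem for the Toda equation on the closed half-space `[0,∞) × ℝ²` with
zero boundary data: a solution with `u − log(1+ζ)` bounded equals `log(1 + cζ)`. -/
theorem stmt17 (u : ℝ → ℝ → ℝ → ℝ)
    (hcont : ContinuousOn (fun p : ℝ × ℝ × ℝ => u p.1 p.2.1 p.2.2)
      {p : ℝ × ℝ × ℝ | 0 ≤ p.1})
    (hreg : ContDiffOn ℝ 2 (fun p : ℝ × ℝ × ℝ => u p.1 p.2.1 p.2.2)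
      {p : ℝ × ℝ × ℝ | 0 < p.1})
    (hpde : ∀ ζ : ℝ, 0 < ζ → ∀ x y : ℝ,
      deriv (deriv (fun s => Real.exp (u s x y))) ζ +
        deriv (deriv (fun x' => u ζ x' y)) x +
        deriv (deriv (fun y' => u ζ x y')) y = 0)
    (hbc : ∀ x y : ℝ, u 0 x y = 0)
    (hbd : ∃ M : ℝ, ∀ ζ ≥ (0:ℝ), ∀ x y : ℝ, |u ζ x y - Real.log (1 + ζ)| ≤ M) :
    ∃ c : ℝ, 0 < c ∧ ∀ ζ ≥ (0:ℝ), ∀ x y : ℝ, u ζ x y = Real.log (1 + c * ζ) := by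
  obtain ⟨M, hM⟩ := hbd
  have hM0 : 0 ≤ M := (abs_nonneg _).trans (hM 0 le_rfl 0 0)
  set U : ℝ × ℝ × ℝ → ℝ := fun p => u p.1 p.2.1 p.2.2 with hUdef
  set W : ℝ × ℝ × ℝ → ℝ := fun p => exp (U p) with hWdef
  have hopen : IsOpen {p : ℝ × ℝ × ℝ | 0 < p.1} := isOpen_lt continuous_const continuous_fst
  have hU : ∀ p : ℝ × ℝ × ℝ, 0 < p.1 → ContDiffAt ℝ 2 U p := fun p hp =>
    hreg.contDiffAt (hopen.mem_nhds hp)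
  have hW : ∀ p : ℝ × ℝ × ℝ, 0 < p.1 → ContDiffAt ℝ 2 W p := fun p hp => (hU p hp).exp
  have hWcont : ContinuousOn W {p | 0 ≤ p.1} := hcont.rexp
  have hT : ∀ p : ℝ × ℝ × ℝ, 0 < p.1 → TodaAt W p := by
    rintro ⟨ζ, x, y⟩ (hζ : 0 < ζ)
    have h := hpde ζ hζ x y
    have e₁ : deriv (deriv fun s => exp (u s x y)) ζ =
        fderiv ℝ (fderiv ℝ W) (ζ, x, y) (1, 0, 0) (1, 0, 0) := by
      have := deriv_deriv_line (f := W) (c := (0, x, y)) (v := (1, 0, 0)) (t₀ := ζ)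
        (by simpa using hW (ζ, x, y) hζ)
      simpa [hWdef, hUdef] using this
    have e₂ : deriv (deriv fun x' => u ζ x' y) x =
        fderiv ℝ (fderiv ℝ U) (ζ, x, y) (0, 1, 0) (0, 1, 0) := by
      have := deriv_deriv_line (f := U) (c := (ζ, 0, y)) (v := (0, 1, 0)) (t₀ := x)
        (by simpa using hU (ζ, x, y) hζ)
      simpa [hUdef] using this
    have e₃ : deriv (deriv fun y' => u ζ x y') y =
        fderiv ℝ (fderiv ℝ U) (ζ, x, y) (0, 0, 1) (0, 0, 1) := by
      have := deriv_deriv_line (f := U) (c := (ζ, x, 0)) (v := (0, 0, 1)) (t₀ := y)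
        (by simpa using hU (ζ, x, y) hζ)
      simpa [hUdef] using this
    rw [e₁, e₂, e₃] at h
    have hc := fderiv_exp_comp (hU (ζ, x, y) hζ)
    unfold TodaAt
    rw [(hc (0, 1, 0)).1, (hc (0, 1, 0)).2, (hc (0, 0, 1)).1, (hc (0, 0, 1)).2]
    refine Eq.trans ?_ h
    have hpos : exp (U (ζ, x, y)) ≠ 0 := (exp_pos _).ne'
    simp only [hWdef]
    field_simp
    ring
  have hbounds : ∀ ζ ≥ 0, ∀ x y, (1 + ζ) / exp M ≤ W (ζ, x, y) ∧
      W (ζ, x, y) ≤ exp M * (1 + ζ) := by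
    intro ζ hζ x y
    have hρ : 0 < 1 + ζ := by positivity
    obtain ⟨h₁, h₂⟩ := abs_le.1 (hM ζ hζ x y)
    constructor
    · calc (1 + ζ) / exp M = exp (log (1 + ζ) - M) := by rw [exp_sub, exp_log hρ]
        _ ≤ W (ζ, x, y) := exp_le_exp.2 (by simp only [hUdef]; linarith)
    · calc W (ζ, x, y) ≤ exp (M + log (1 + ζ)) := exp_le_exp.2 (by simp only [hUdef]; linarith)
        _ = exp M * (1 + ζ) := by rw [exp_add, exp_log hρ]
  have hle := fun {τ : ℝ} (hτ : 0 ≤ τ) => TodaAt.le_of_bounds (one_le_exp hM0) hWcont hW hT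
    (fun x y => by simp [hWdef, hUdef, hbc]) (fun ζ hζ x y => (hbounds ζ hζ x y).1)
    (fun ζ hζ x y => (hbounds ζ hζ x y).2) hτ
  have hconst : ∀ ζ ≥ 0, ∀ x y, u ζ x y = u ζ 0 0 := fun ζ hζ x y =>
    exp_injective (le_antisymm (hle hζ x y 0 0) (hle hζ 0 0 x y))
  obtain ⟨c, hc⟩ := eq_affine_of_deriv_deriv_eq_zero (f := fun s => exp (u s 0 0))
    (hWcont.comp (f := fun s : ℝ => (s, (0 : ℝ), (0 : ℝ))) (by fun_prop) fun s hs => hs)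
    (ContDiffOn.comp (g := W) (f := fun s : ℝ => (s, (0 : ℝ), (0 : ℝ))) hreg.exp
      (by fun_prop) fun s hs => hs)
    fun t ht => by
      have h := hpde t ht 0 0
      have e₁ : (fun x' => u t x' 0) = fun _ => u t 0 0 := funext fun x' => hconst t ht.le x' 0
      have e₂ : (fun y' => u t 0 y') = fun _ => u t 0 0 := funext fun y' => hconst t ht.le 0 y'
      rw [e₁, e₂] at h
      simpa using h
  simp only [hbc, exp_zero] at hc
  refine ⟨c, ?_, fun ζ hζ x y => ?_⟩
  · by_contra! hc0
    have h₁ := (hbounds (exp M) (exp_pos M).le 0 0).1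
    have h₂ : W (exp M, 0, 0) = 1 + c * exp M := hc _ (exp_pos M).le
    rw [h₂, div_le_iff₀ (exp_pos M)] at h₁
    nlinarith [exp_pos M, mul_nonneg (neg_nonneg.2 hc0) (mul_pos (exp_pos M) (exp_pos M)).le]
  · rw [hconst ζ hζ, ← hc ζ hζ, log_exp]
end
end
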